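/- arXiv:1910.04605 — 4 statements merged into one kernel-verified Lean document; each statement's English description precedes it below -/
import Mathlib

section
/- Let M be a finite loopless matroid whose largest circuit has size c(M) = k > 1. Then gamma(M) <= s_M(k(k-1)/2), where s_M(i) is the maximum cardinality of a subset of the ground set of M of rank at most i, and gamma(M) = max over nonempty subsets A of ceil(|A| / rank(A)). -/
open Set Matroid

variable {α : Type*}

/-- A circuit of a matroid: a minimally dependent subset of the ground set. -/
def Matroid.IsCircuit' (M : Matroid α) (C : Set α) : Prop :=
  C ⊆ M.E ∧ ¬ M.Indep C ∧ ∀ D ⊂ C, M.Indep D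

/-- A matroid is loopless if no single element forms a circuit, i.e. every
singleton of the ground set is independent. -/
def Matroid.Loopless' (M : Matroid α) : Prop := ∀ e ∈ M.E, M.Indep {e}

/-- The rank of a set `A` in a matroid `M`: the maximum size of an independent
subset of `A`. -/
noncomputable def Matroid.rk' (M : Matroid α) (A : Set α) : ℕ :=
  sSup {n | ∃ I, I ⊆ A ∧ M.Indep I ∧ I.ncard = n}

/-- `c(M)`: the maximum size of a circuit of `M`. -/
noncomputable def Matroid.cMax (M : Matroid α) : ℕ :=
  sSup {n | ∃ C, M.IsCircuit' C ∧ C.ncard = n}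

/-- `γ(M) = max{⌈|A| / rank(A)⌉ : A a nonempty subset of the ground set}`. -/
noncomputable def Matroid.gamma (M : Matroid α) : ℕ :=
  sSup {n | ∃ A ⊆ M.E, A.Nonempty ∧ n = ⌈(A.ncard : ℚ) / (M.rk' A : ℚ)⌉₊}

/-- The connected component of an element `e`: the set of `f` with `f = e` or
such that some circuit contains both `e` and `f`. -/
def Matroid.component (M : Matroid α) (e : α) : Set α :=
  {f | f = e ∨ ∃ C, M.IsCircuit' C ∧ e ∈ C ∧ f ∈ C}

/-- `s_M(i)`: the maximum cardinality of a subset of the ground set of rank at most `i`. -/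
noncomputable def Matroid.sFun (M : Matroid α) (i : ℕ) : ℕ :=
  sSup {n | ∃ A ⊆ M.E, M.rk' A ≤ i ∧ A.ncard = n}

namespace Matroid

variable {M : Matroid α} {X Y C D K : Set α} {e f : α}

lemma isCircuit'_iff : M.IsCircuit' C ↔ M.IsCircuit C := by
  rw [isCircuit_iff_forall_ssubset, IsCircuit', dep_iff]
  tauto

section Rank

lemma coe_rk' (M : Matroid α) [M.Finite] (A : Set α) : (M.rk' A : ℕ∞) = M.eRk A := by
  obtain ⟨I, hI⟩ := M.exists_isBasis' A
  have hfin : ∀ J, M.Indep J → J.Finite := fun J hJ ↦ M.set_finite J hJ.subset_ground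
  have h : IsGreatest {n | ∃ I, I ⊆ A ∧ M.Indep I ∧ I.ncard = n} I.ncard := by
    refine ⟨⟨I, hI.subset, hI.indep, rfl⟩, ?_⟩
    rintro _ ⟨J, hJA, hJ, rfl⟩
    have := hJ.encard_le_eRk_of_subset hJA
    rw [← hI.encard_eq_eRk, ← (hfin J hJ).cast_ncard_eq, ← (hfin I hI.indep).cast_ncard_eq] at this
    exact_mod_cast this
  rw [rk', h.csSup_eq, (hfin I hI.indep).cast_ncard_eq, hI.encard_eq_eRk]

variable [M.Finite]

lemma rk'_mono (h : X ⊆ Y) : M.rk' X ≤ M.rk' Y := by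
  have := M.eRk_mono h
  rw [← coe_rk', ← coe_rk'] at this
  exact_mod_cast this

lemma rk'_submod (X Y : Set α) : M.rk' (X ∩ Y) + M.rk' (X ∪ Y) ≤ M.rk' X + M.rk' Y := by
  have := M.eRk_submod X Y
  simp only [← coe_rk'] at this
  exact_mod_cast this

lemma rk'_submod_of_subset {P Q : Set α} (hP : P ⊆ X ∩ Y) (hQ : Q ⊆ X ∪ Y) :
    M.rk' P + M.rk' Q ≤ M.rk' X + M.rk' Y :=
  (add_le_add (rk'_mono hP) (rk'_mono hQ)).trans (rk'_submod X Y)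

lemma IsBasis'.rk'_eq_ncard {I : Set α} (hI : M.IsBasis' I X) : M.rk' X = I.ncard := by
  have := hI.encard_eq_eRk
  rw [← coe_rk', ← (M.set_finite I hI.indep.subset_ground).cast_ncard_eq] at this
  exact_mod_cast this.symm

lemma Indep.rk'_eq_ncard (hX : M.Indep X) : M.rk' X = X.ncard := by
  have := hX.eRk_eq_encard
  rw [← coe_rk', ← (M.set_finite X hX.subset_ground).cast_ncard_eq] at this
  exact_mod_cast this

lemma Indep.ncard_le_rk' (hX : M.Indep X) (hXY : X ⊆ Y) : X.ncard ≤ M.rk' Y :=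
  hX.rk'_eq_ncard.ge.trans (rk'_mono hXY)

lemma indep_of_ncard_le_rk' (hX : X ⊆ M.E) (h : X.ncard ≤ M.rk' X) : M.Indep X := by
  have hfin := M.set_finite X hX
  refine (M.isRkFinite_of_finite hfin).indep_of_encard_le_eRk ?_
  rw [← coe_rk', ← hfin.cast_ncard_eq]
  exact_mod_cast h

lemma rk'_le_ncard (hX : X ⊆ M.E) : M.rk' X ≤ X.ncard := by
  have := M.eRk_le_encard X
  rw [← coe_rk', ← (M.set_finite X hX).cast_ncard_eq] at this
  exact_mod_cast this

lemma IsCircuit.rk'_add_one_eq (hC : M.IsCircuit C) : M.rk' C + 1 = C.ncard := by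
  have := hC.eRk_add_one_eq
  rw [← coe_rk', ← (M.set_finite C hC.subset_ground).cast_ncard_eq] at this
  exact_mod_cast this

lemma rk'_closure (X : Set α) : M.rk' (M.closure X) = M.rk' X := by
  have := M.eRk_closure_eq X
  rw [← coe_rk', ← coe_rk'] at this
  exact_mod_cast this

lemma IsCircuit.rk'_diff_singleton (hC : M.IsCircuit C) (he : e ∈ C) (hCX : C ⊆ X) :
    M.rk' (X \ {e}) = M.rk' X := by
  refine le_antisymm (rk'_mono sdiff_subset) ?_
  have h := rk'_submod_of_subset (M := M) (P := C \ {e}) (Q := X) (X := C) (Y := X \ {e})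
    (subset_inter sdiff_subset (sdiff_subset_sdiff_left hCX))
    (fun x hx ↦ by by_cases hxe : x = e <;> simp_all)
  have h1 := (hC.sdiff_singleton_indep he).rk'_eq_ncard
  have h2 := ncard_sdiff_singleton_add_one he (M.set_finite C hC.subset_ground)
  have h3 := hC.rk'_add_one_eq
  omega

lemma restrict_rk' {A : Set α} (hA : A ⊆ M.E) (hX : X ⊆ A) : (M ↾ A).rk' X = M.rk' X := by
  have : (M ↾ A).Finite := ⟨M.set_finite A hA⟩
  have := M.restrict_eRk_eq hX
  rw [← coe_rk', ← coe_rk'] at this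
  exact_mod_cast this

lemma rk'_contract_add_ncard {I : Set α} (hI : M.Indep I) (X : Set α) :
    (M ／ I).rk' X + I.ncard = M.rk' (X ∪ I) := by
  have hfin : ∀ J, M.Indep J → J.Finite := fun J hJ ↦ M.set_finite J hJ.subset_ground
  obtain ⟨J, hJ⟩ := (M ／ I).exists_isBasis' X
  have hJi := hI.contract_indep_iff.1 hJ.indep
  obtain ⟨B, hB, hIB⟩ := hI.subset_isBasis'_of_subset (X := X ∪ I) subset_union_right
  have hBI : (M ／ I).Indep (B \ I) :=
    hI.contract_indep_iff.2 ⟨disjoint_sdiff_left, by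
      rw [sdiff_union_of_subset hIB]; exact hB.indep⟩
  have e1 := hJ.rk'_eq_ncard
  have e2 := hB.rk'_eq_ncard
  have h1 := hJi.2.ncard_le_rk' (union_subset_union_left I hJ.subset)
  rw [ncard_union_eq hJi.1 (hfin J (hJi.2.subset subset_union_left)) (hfin I hI)] at h1
  have h2 := hBI.ncard_le_rk' (Y := X) (by
    rw [sdiff_subset_iff, union_comm]; exact hB.subset)
  have h3 := ncard_sdiff_add_ncard_of_subset hIB (hfin B hB.indep)
  omega

lemma rk'_add_ncard_le_rk'_union {Z W : Set α} (hZ : Z ⊆ M.E)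
    (h : ∀ z ∈ Z, M.rk' (X ∪ (Z \ {z})) < M.rk' (X ∪ Z)) (hWZ : W ⊆ Z) :
    M.rk' X + W.ncard ≤ M.rk' (X ∪ W) := by
  have hW := M.set_finite W (hWZ.trans hZ)
  induction W, hW using Set.Finite.induction_on with
  | empty => simp
  | @insert w W hw hW ih =>
    have ih := ih ((subset_insert w W).trans hWZ)
    have hwZ := hWZ (mem_insert w W)
    have h1 := h w hwZ
    have h2 := rk'_submod_of_subset (M := M) (P := X ∪ W) (Q := X ∪ Z) (X := X ∪ insert w W)
      (Y := X ∪ (Z \ {w}))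
      (by
        refine subset_inter (union_subset_union_right _ (subset_insert w W))
          (union_subset_union_right _ fun x hx ↦ ⟨hWZ (Or.inr hx), ?_⟩)
        rintro rfl
        exact hw hx)
      (fun x hx ↦ by
        by_cases hxw : x = w
        · simp [hxw]
        · rcases hx with hx | hx <;> simp [hx, hxw])
    rw [ncard_insert_of_notMem hw hW]
    omega

end Rank

section Connectivity

variable [M.Finite]

/-- Lying in a common circuit is a transitive relation. -/
lemma IsCircuit.exists_isCircuit_of_inter_nonempty {K₁ K₂ : Set α} (h₁ : M.IsCircuit K₁)
    (h₂ : M.IsCircuit K₂) (he : e ∈ K₁) (hf : f ∈ K₂) (hne : (K₁ ∩ K₂).Nonempty) :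
    ∃ K, M.IsCircuit K ∧ e ∈ K ∧ f ∈ K := by
  induction hn : (K₁ ∪ K₂).ncard using Nat.strong_induction_on generalizing K₁ K₂ with
  | _ n ih =>
  subst hn
  by_contra hcon
  have hfin : (K₁ ∪ K₂).Finite :=
    M.set_finite _ (union_subset h₁.subset_ground h₂.subset_ground)
  have he₂ : e ∉ K₂ := fun h ↦ hcon ⟨K₂, h₂, h, hf⟩
  have hf₁ : f ∉ K₁ := fun h ↦ hcon ⟨K₁, h₁, he, h⟩
  obtain ⟨x, hx₁, hx₂⟩ := hne
  obtain ⟨K₃, hs₃, h₃, he₃⟩ := h₁.strong_elimination h₂ hx₁ hx₂ he he₂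
  obtain ⟨K₄, hs₄, h₄, hf₄⟩ := h₂.strong_elimination h₁ hx₂ hx₁ hf hf₁
  rw [union_comm] at hs₄
  obtain ⟨y, hy₃, hy₁⟩ : ∃ y ∈ K₃, y ∉ K₁ := not_subset.1 fun h ↦
    (hs₃ (h₃.eq_of_subset_isCircuit h₁ h ▸ hx₁)).2 rfl
  obtain ⟨z, hz₄, hz₂⟩ : ∃ z ∈ K₄, z ∉ K₂ := not_subset.1 fun h ↦
    (hs₄ (h₄.eq_of_subset_isCircuit h₂ h ▸ hx₂)).2 rfl
  have hz₁ : z ∈ K₁ := (hs₄ hz₄).1.resolve_right hz₂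
  have hy₂ : y ∈ K₂ := (hs₃ hy₃).1.resolve_left hy₁
  have hz₃ : z ∈ K₃ := by
    by_contra hz₃
    refine hcon (ih _ (ncard_lt_ncard ?_ hfin) h₃ h₂ he₃ hf ⟨y, hy₃, hy₂⟩ rfl)
    refine ⟨union_subset (hs₃.trans sdiff_subset) subset_union_right, fun h ↦ ?_⟩
    exact (h (Or.inl hz₁)).elim hz₃ hz₂
  refine hcon (ih _ (ncard_lt_ncard ?_ hfin) h₃ h₄ he₃ hf₄ ⟨z, hz₃, hz₄⟩ rfl)
  refine ⟨union_subset (hs₃.trans sdiff_subset) (hs₄.trans sdiff_subset), fun h ↦ ?_⟩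
  exact (h (Or.inl hx₁)).elim (fun h ↦ (hs₃ h).2 rfl) (fun h ↦ (hs₄ h).2 rfl)

lemma rk'_add_rk'_diff_le (h : ∀ K, M.IsCircuit K → K ⊆ X ∨ Disjoint K X) :
    M.rk' X + M.rk' (M.E \ X) ≤ M.rk' M.E := by
  have hfin : ∀ J, M.Indep J → J.Finite := fun J hJ ↦ M.set_finite J hJ.subset_ground
  obtain ⟨I, hI⟩ := M.exists_isBasis' X
  obtain ⟨J, hJ⟩ := M.exists_isBasis' (M.E \ X)
  have hdj : Disjoint I J := disjoint_of_subset hI.subset hJ.subset disjoint_sdiff_right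
  have hind : M.Indep (I ∪ J) := by
    by_contra hdep
    obtain ⟨K, hKs, hK⟩ := Dep.exists_isCircuit_subset
      (⟨hdep, union_subset hI.indep.subset_ground hJ.indep.subset_ground⟩ : M.Dep (I ∪ J))
    rcases h K hK with h | h
    · refine hK.not_indep (hI.indep.subset fun x hx ↦ ?_)
      exact (hKs hx).resolve_right fun hxJ ↦ (hJ.subset hxJ).2 (h hx)
    · refine hK.not_indep (hJ.indep.subset fun x hx ↦ ?_)
      exact (hKs hx).resolve_left fun hxI ↦ disjoint_left.1 h hx (hI.subset hxI)
  have := hind.ncard_le_rk' hind.subset_ground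
  rwa [ncard_union_eq hdj (hfin I hI.indep) (hfin J hJ.indep), ← hI.rk'_eq_ncard,
    ← hJ.rk'_eq_ncard] at this

/-- If disjoint sets `C` and `D` both meet some circuit `K`, then there is a minimal set `Z`
such that `C` and `D` are not skew after contracting `Z`. -/
lemma IsCircuit.exists_connecting_set (hdj : Disjoint C D) (hK : M.IsCircuit K)
    (hKC : (K ∩ C).Nonempty) (hKD : (K ∩ D).Nonempty) :
    ∃ Z ⊆ M.E, M.rk' (C ∪ D ∪ Z) + M.rk' Z < M.rk' (C ∪ Z) + M.rk' (D ∪ Z) ∧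
      ∀ z ∈ Z, M.rk' (C ∪ (Z \ {z})) + M.rk' (D ∪ (Z \ {z})) ≤
        M.rk' (C ∪ D ∪ (Z \ {z})) + M.rk' (Z \ {z}) := by
  set P : Set (Set α) :=
    {Z | Z ⊆ M.E ∧ M.rk' (C ∪ D ∪ Z) + M.rk' Z < M.rk' (C ∪ Z) + M.rk' (D ∪ Z)} with hP
  have hPfin : P.Finite := M.ground_finite.finite_subsets.subset fun Z hZ ↦ hZ.1
  have hmem : K \ (C ∪ D) ∈ P := by
    refine ⟨sdiff_subset.trans hK.subset_ground, ?_⟩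
    set Z := K \ (C ∪ D)
    have hKfin := M.set_finite K hK.subset_ground
    have hiC : M.Indep (K \ D) := hK.ssubset_indep
      ⟨sdiff_subset, fun h ↦ by obtain ⟨x, hx, hxD⟩ := hKD; exact (h hx).2 hxD⟩
    have hiD : M.Indep (K \ C) := hK.ssubset_indep
      ⟨sdiff_subset, fun h ↦ by obtain ⟨x, hx, hxC⟩ := hKC; exact (h hx).2 hxC⟩
    have hZ : M.Indep Z := hiD.subset (sdiff_subset_sdiff_right subset_union_left)
    have hcard : (K \ C).ncard + (K \ D).ncard = K.ncard + Z.ncard := by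
      rw [← ncard_union_add_ncard_inter _ _ (hKfin.subset sdiff_subset)
        (hKfin.subset sdiff_subset)]
      congr 2
      · ext x
        have : x ∈ C → x ∉ D := fun h ↦ disjoint_left.1 hdj h
        simp only [mem_union, mem_sdiff]; tauto
      · ext x
        simp only [Z, mem_inter_iff, mem_union, mem_sdiff]; tauto
    have h1 := rk'_submod_of_subset (M := M) (P := K \ D) (Q := C ∪ D ∪ Z) (X := C ∪ Z)
      (Y := K ∪ D)
      (fun x hx ↦ by simp only [Z, mem_inter_iff, mem_union, mem_sdiff] at hx ⊢; tauto)
      (fun x hx ↦ by simp only [Z, mem_union, mem_sdiff] at hx ⊢; tauto)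
    have h2 := rk'_submod_of_subset (M := M) (P := K \ C) (Q := K ∪ D) (X := D ∪ Z) (Y := K)
      (fun x hx ↦ by simp only [Z, mem_inter_iff, mem_union, mem_sdiff] at hx ⊢; tauto)
      (fun x hx ↦ by simp only [mem_union] at hx ⊢; tauto)
    rw [hiC.rk'_eq_ncard] at h1
    rw [hiD.rk'_eq_ncard] at h2
    have h3 := hK.rk'_add_one_eq
    have h4 := hZ.rk'_eq_ncard
    omega
  obtain ⟨Z, -, hZ⟩ := hPfin.exists_le_minimal hmem
  refine ⟨Z, hZ.prop.1, hZ.prop.2, fun z hz ↦ ?_⟩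
  by_contra! hlt
  have := hZ.le_of_le (y := Z \ {z}) ⟨sdiff_subset.trans hZ.prop.1, hlt⟩ sdiff_subset
  exact (this hz).2 rfl

/-- Two skew circuits in the same component are, on average, smaller than some third circuit. -/
lemma IsCircuit.exists_isCircuit_add_ncard_lt (hC : M.IsCircuit C) (hD : M.IsCircuit D)
    (hdj : Disjoint C D) (hskew : M.rk' C + M.rk' D ≤ M.rk' (C ∪ D)) (hK : M.IsCircuit K)
    (hKC : (K ∩ C).Nonempty) (hKD : (K ∩ D).Nonempty) :
    ∃ L, M.IsCircuit L ∧ C.ncard + D.ncard < 2 * L.ncard := by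
  obtain ⟨Z, hZE, hZ, hmin⟩ := hK.exists_connecting_set hdj hKC hKD
  have hCE := hC.subset_ground
  have hDE := hD.subset_ground
  have hCfin := M.set_finite C hCE
  have hDfin := M.set_finite D hDE
  have hZfin := M.set_finite Z hZE
  have hrC := hC.rk'_add_one_eq
  have hrD := hD.rk'_add_one_eq
  have hinc : ∀ z ∈ Z, M.rk' (C ∪ (Z \ {z})) < M.rk' (C ∪ Z) ∧
      M.rk' (D ∪ (Z \ {z})) < M.rk' (D ∪ Z) := by
    intro z hz
    have h0 := hmin z hz
    have hm : M.rk' (C ∪ D ∪ (Z \ {z})) ≤ M.rk' (C ∪ D ∪ Z) :=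
      rk'_mono (union_subset_union_right _ sdiff_subset)
    have key : ∀ Y, M.rk' (Z \ {z}) + M.rk' (Y ∪ Z) ≤ M.rk' (Y ∪ (Z \ {z})) + M.rk' Z := fun Y ↦
      rk'_submod_of_subset (subset_inter subset_union_right sdiff_subset)
        (union_subset (subset_union_left.trans subset_union_left) subset_union_right)
    have h1 := key C
    have h2 := key D
    omega
  have hZZ : Z.Nonempty := by
    rw [nonempty_iff_ne_empty]
    rintro rfl
    simp only [union_empty] at hZ
    omega
  have hdC : Disjoint C Z := disjoint_right.2 fun z hz hzC ↦ by
    refine (hinc z hz).1.not_ge (rk'_mono fun x hx ↦ ?_)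
    by_cases hxz : x = z
    · exact Or.inl (hxz ▸ hzC)
    · exact hx.imp_right fun h ↦ ⟨h, hxz⟩
  have hdD : Disjoint D Z := disjoint_right.2 fun z hz hzD ↦ by
    refine (hinc z hz).2.not_ge (rk'_mono fun x hx ↦ ?_)
    by_cases hxz : x = z
    · exact Or.inl (hxz ▸ hzD)
    · exact hx.imp_right fun h ↦ ⟨h, hxz⟩
  have hunion : ∀ X Y, M.rk' (X ∪ Y) ≤ M.rk' X + M.rk' Y := fun X Y ↦
    (Nat.le_add_left _ _).trans (rk'_submod X Y)
  have hrZ := rk'_le_ncard hZE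
  have hrCZ : M.rk' (C ∪ Z) = M.rk' C + Z.ncard := by
    have h1 := rk'_add_ncard_le_rk'_union hZE (fun z hz ↦ (hinc z hz).1) subset_rfl
    have h2 := hunion C Z
    omega
  have hrDZ : M.rk' (D ∪ Z) = M.rk' D + Z.ncard := by
    have h1 := rk'_add_ncard_le_rk'_union hZE (fun z hz ↦ (hinc z hz).2) subset_rfl
    have h2 := hunion D Z
    omega
  set S := C ∪ D ∪ Z with hS
  have hSE : S ⊆ M.E := union_subset (union_subset hCE hDE) hZE
  have hSfin := M.set_finite S hSE
  have hCDcard := ncard_union_eq hdj hCfin hDfin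
  have hScard : S.ncard = C.ncard + D.ncard + Z.ncard := by
    rw [hS, ncard_union_eq (disjoint_union_left.2 ⟨hdC, hdD⟩) (hCfin.union hDfin) hZfin, hCDcard]
  have hrS : M.rk' S + 3 = S.ncard := by
    obtain ⟨z, hz⟩ := hZZ
    have h1 := rk'_add_ncard_le_rk'_union hZE (fun z hz ↦ (hinc z hz).1)
      (sdiff_subset : Z \ {z} ⊆ Z)
    have h2 := rk'_add_ncard_le_rk'_union hZE (fun z hz ↦ (hinc z hz).2)
      (sdiff_subset : Z \ {z} ⊆ Z)
    have h3 := hmin z hz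
    have h4 : M.rk' (C ∪ D ∪ (Z \ {z})) ≤ M.rk' S :=
      rk'_mono (union_subset_union_right _ sdiff_subset)
    have h5 := rk'_le_ncard (M := M) (X := Z \ {z}) (sdiff_subset.trans hZE)
    have h6 := ncard_sdiff_singleton_add_one hz hZfin
    have h7 := hunion C Z
    omega
  have hCS : C ⊆ S := subset_union_left.trans subset_union_left
  have hDS : D ⊆ S := subset_union_right.trans subset_union_left
  have hindep : ∀ c ∈ C, ∀ d ∈ D, M.Indep ((C ∪ Z) \ {c}) ∧ M.Indep ((D ∪ Z) \ {d}) ∧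
      M.Indep (((C ∪ D) \ {c}) \ {d}) := by
    intro c hc d hd
    have hDc : D ⊆ (C ∪ D) \ {c} :=
      subset_sdiff_singleton subset_union_right (disjoint_left.1 hdj hc)
    refine ⟨indep_of_ncard_le_rk' (sdiff_subset.trans (union_subset hCE hZE)) ?_,
      indep_of_ncard_le_rk' (sdiff_subset.trans (union_subset hDE hZE)) ?_,
      indep_of_ncard_le_rk'
        (sdiff_subset.trans (sdiff_subset.trans (union_subset hCE hDE))) ?_⟩
    · rw [hC.rk'_diff_singleton hc subset_union_left]
      have := ncard_sdiff_singleton_add_one (mem_union_left _ hc) (hCfin.union hZfin)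
      rw [ncard_union_eq hdC hCfin hZfin] at this
      omega
    · rw [hD.rk'_diff_singleton hd subset_union_left]
      have := ncard_sdiff_singleton_add_one (mem_union_left _ hd) (hDfin.union hZfin)
      rw [ncard_union_eq hdD hDfin hZfin] at this
      omega
    · rw [hD.rk'_diff_singleton hd hDc, hC.rk'_diff_singleton hc subset_union_left]
      have h1 := ncard_sdiff_singleton_add_one (hDc hd) ((hCfin.union hDfin).subset sdiff_subset)
      have h2 := ncard_sdiff_singleton_add_one (mem_union_left _ hc) (hCfin.union hDfin)
      omega
  have hrank : ∀ c ∈ C, ∀ d ∈ D, M.rk' ((S \ {c}) \ {d}) + 1 = ((S \ {c}) \ {d}).ncard := by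
    intro c hc d hd
    have hDc : D ⊆ S \ {c} := subset_sdiff_singleton hDS (disjoint_left.1 hdj hc)
    rw [hD.rk'_diff_singleton hd hDc, hC.rk'_diff_singleton hc hCS]
    have h1 := ncard_sdiff_singleton_add_one (hDc hd) (hSfin.subset sdiff_subset)
    have h2 := ncard_sdiff_singleton_add_one (hCS hc) hSfin
    omega
  have hex : ∀ c ∈ C, ∀ d ∈ D, ∃ K ⊆ (S \ {c}) \ {d}, M.IsCircuit K ∧ (K ∩ C).Nonempty ∧
      (K ∩ D).Nonempty ∧ (K ∩ Z).Nonempty := by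
    intro c hc d hd
    have hdep : M.Dep ((S \ {c}) \ {d}) := by
      refine ⟨fun h ↦ ?_, sdiff_subset.trans (sdiff_subset.trans hSE)⟩
      have h1 := h.rk'_eq_ncard
      have h2 := hrank c hc d hd
      omega
    obtain ⟨K, hKs, hK⟩ := hdep.exists_isCircuit_subset
    obtain ⟨hi₁, hi₂, hi₃⟩ := hindep c hc d hd
    refine ⟨K, hKs, hK, ?_, ?_, ?_⟩ <;> rw [← not_disjoint_iff_nonempty_inter, disjoint_left] <;>
      intro h
    · refine hK.not_indep (hi₂.subset fun x hx ↦ ⟨?_, (hKs hx).2⟩)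
      exact (hKs hx).1.1.imp_left fun h' ↦ h'.resolve_left (h hx)
    · refine hK.not_indep (hi₁.subset fun x hx ↦ ⟨?_, (hKs hx).1.2⟩)
      exact (hKs hx).1.1.imp_left fun h' ↦ h'.resolve_right (h hx)
    · refine hK.not_indep (hi₃.subset fun x hx ↦ ⟨⟨?_, (hKs hx).1.2⟩, (hKs hx).2⟩)
      exact (hKs hx).1.1.resolve_right (h hx)
  have huniq : ∀ c ∈ C, ∀ d ∈ D, ∀ K ⊆ (S \ {c}) \ {d}, M.IsCircuit K → ∀ w ∈ K,
      M.Indep (((S \ {c}) \ {d}) \ {w}) := by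
    intro c hc d hd K hKs hK w hw
    refine indep_of_ncard_le_rk'
      (sdiff_subset.trans (sdiff_subset.trans (sdiff_subset.trans hSE))) ?_
    rw [hK.rk'_diff_singleton hw hKs]
    have h1 := hrank c hc d hd
    have h2 := ncard_sdiff_singleton_add_one (hKs hw)
      (hSfin.subset (sdiff_subset.trans sdiff_subset))
    omega
  obtain ⟨c₀, hc₀⟩ := hC.nonempty
  obtain ⟨d₀, hd₀⟩ := hD.nonempty
  obtain ⟨K₁, hs₁, hK₁, ⟨c, hcK, hc⟩, ⟨d, hdK, hd⟩, hZ₁⟩ := hex c₀ hc₀ d₀ hd₀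
  obtain ⟨K₂, hs₂, hK₂, -, -, hZ₂⟩ := hex c hc d hd
  have hK₁S : K₁ ⊆ S := hs₁.trans (sdiff_subset.trans sdiff_subset)
  have hcov : C ∪ D ⊆ (K₁ \ Z) ∪ (K₂ \ Z) := by
    intro x hx
    have hxZ : x ∉ Z := disjoint_left.1 (disjoint_union_left.2 ⟨hdC, hdD⟩) hx
    by_contra hxK
    have hx₁ : x ∉ K₁ := fun h ↦ hxK (Or.inl ⟨h, hxZ⟩)
    have hx₂ : x ∉ K₂ := fun h ↦ hxK (Or.inr ⟨h, hxZ⟩)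
    rcases hx with hx | hx
    · obtain ⟨K₃, hs₃, hK₃, hcK₃⟩ :=
        hK₁.strong_elimination hD hdK hd hcK (disjoint_left.1 hdj hc)
      refine hK₂.not_indep ((huniq x hx d hd K₃ (fun y hy ↦ ?_) hK₃ c hcK₃).subset fun y hy ↦ ?_)
      · refine ⟨⟨union_subset hK₁S hDS (hs₃ hy).1, ?_⟩, (hs₃ hy).2⟩
        rintro rfl
        exact (hs₃ hy).1.elim hx₁ (disjoint_left.1 hdj hx)
      · exact ⟨⟨⟨(hs₂ hy).1.1, fun h ↦ hx₂ (h ▸ hy)⟩, (hs₂ hy).2⟩, (hs₂ hy).1.2⟩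
    · obtain ⟨K₃, hs₃, hK₃, hdK₃⟩ :=
        hK₁.strong_elimination hC hcK hc hdK (disjoint_right.1 hdj hd)
      refine hK₂.not_indep ((huniq c hc x hx K₃ (fun y hy ↦ ?_) hK₃ d hdK₃).subset fun y hy ↦ ?_)
      · refine ⟨⟨union_subset hK₁S hCS (hs₃ hy).1, (hs₃ hy).2⟩, ?_⟩
        rintro rfl
        exact (hs₃ hy).1.elim hx₁ (disjoint_right.1 hdj hx)
      · exact ⟨⟨(hs₂ hy).1, fun h ↦ hx₂ (h ▸ hy)⟩, (hs₂ hy).2⟩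
  have hlt : ∀ L, M.IsCircuit L → (L ∩ Z).Nonempty → (L \ Z).ncard < L.ncard := by
    rintro L hL ⟨z, hzL, hzZ⟩
    exact ncard_lt_ncard ⟨sdiff_subset, fun h ↦ (h hzL).2 hzZ⟩ (M.set_finite L hL.subset_ground)
  have h1 := hlt K₁ hK₁ hZ₁
  have h2 := hlt K₂ hK₂ hZ₂
  have h3 := ncard_le_ncard hcov
    (((M.set_finite K₁ hK₁.subset_ground).subset sdiff_subset).union
      ((M.set_finite K₂ hK₂.subset_ground).subset sdiff_subset))
  have h4 := ncard_union_le (K₁ \ Z) (K₂ \ Z)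
  rcases le_total K₁.ncard K₂.ncard with h | h
  · exact ⟨K₂, hK₂, by omega⟩
  · exact ⟨K₁, hK₁, by omega⟩

end Connectivity

section Density

variable [M.Finite]

/-- Contracting a longest circuit of a connected matroid decreases the circumference. -/
lemma IsCircuit.ncard_lt_of_isCircuit_contract {k : ℕ} {c : α} (hC : M.IsCircuit C)
    (hCk : C.ncard = k) (hub : ∀ K, M.IsCircuit K → K.ncard ≤ k)
    (hconn : ∀ e ∈ M.E, ∀ f ∈ M.E, e ≠ f → ∃ K, M.IsCircuit K ∧ e ∈ K ∧ f ∈ K) (hc : c ∈ C)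
    (hD : ((M ／ (C \ {c})) ↾ (M.E \ M.closure C)).IsCircuit D) : D.ncard < k := by
  have hI := hC.sdiff_singleton_indep hc
  set I := C \ {c} with hIdef
  have hCE := hC.subset_ground
  have hIE : I ⊆ M.E := hI.subset_ground
  have hDs : D ⊆ M.E \ M.closure C := hD.subset_ground
  have hdCD : Disjoint C D :=
    disjoint_right.2 fun x hx hxC ↦ (hDs hx).2 (M.subset_closure C hCE hxC)
  have hDI : Disjoint D I := (hdCD.mono_left sdiff_subset).symm
  have hind : ∀ J ⊆ D, ((M ／ I) ↾ (M.E \ M.closure C)).Indep J ↔ M.Indep (J ∪ I) := by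
    intro J hJ
    rw [restrict_indep_iff, hI.contract_indep_iff]
    exact ⟨fun h ↦ h.1.2, fun h ↦ ⟨⟨hDI.mono_left hJ, h⟩, hJ.trans hDs⟩⟩
  have hDE : D ⊆ M.E := hDs.trans sdiff_subset
  obtain ⟨L, hLs, hL⟩ := Dep.exists_isCircuit_subset
    (⟨fun h ↦ hD.not_indep ((hind D subset_rfl).2 h), union_subset hDE hIE⟩ : M.Dep (D ∪ I))
  have hLD : L \ I = D := by
    by_contra hne
    have hss : L \ I ⊂ D := ssubset_iff_subset_ne.2
      ⟨sdiff_subset_iff.2 (by rwa [union_comm]), hne⟩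
    refine hL.not_indep (((hind _ hss.subset).1 (hD.ssubset_indep hss)).subset ?_)
    exact subset_sdiff_union L I
  have hDL : D ⊆ L := hLD ▸ sdiff_subset
  rcases hDL.eq_or_ssubset with rfl | hss
  · by_contra! hk
    obtain ⟨d, hd⟩ := hL.nonempty
    have hcd : c ≠ d := fun h ↦ disjoint_left.1 hdCD hc (h ▸ hd)
    obtain ⟨K, hK, hcK, hdK⟩ := hconn c (hCE hc) d (hDE hd) hcd
    have hskew : M.rk' C + M.rk' D ≤ M.rk' (C ∪ D) := by
      have h1 : M.Indep ((D \ {d}) ∪ I) :=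
        (hind _ sdiff_subset).1 (hD.sdiff_singleton_indep hd)
      have h2 := h1.ncard_le_rk' (Y := C ∪ D) (union_subset
        (sdiff_subset.trans subset_union_right) (sdiff_subset.trans subset_union_left))
      rw [ncard_union_eq (hDI.mono_left sdiff_subset) ((M.set_finite D hDE).subset sdiff_subset)
        (M.set_finite I hIE)] at h2
      have h3 := ncard_sdiff_singleton_add_one hd (M.set_finite D hDE)
      have h4 := ncard_sdiff_singleton_add_one hc (M.set_finite C hCE)
      have h5 := hC.rk'_add_one_eq
      have h6 := hL.rk'_add_one_eq
      rw [← hIdef] at h4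
      omega
    obtain ⟨L', hL', hlt⟩ := hC.exists_isCircuit_add_ncard_lt hL hdCD hskew hK
      ⟨c, hcK, hc⟩ ⟨d, hdK, hd⟩
    have := hub L' hL'
    omega
  · exact (ncard_lt_ncard hss (M.set_finite L hL.subset_ground)).trans_le (hub L hL)

/-- A finite loopless matroid with circuits of size at most `k`, in which sets of rank at most
`k * (k - 1) / 2` have size at most `s`, has density at most `s`. -/
lemma ncard_ground_le_rk'_mul (M : Matroid α) [M.Finite] (hM : ∀ e ∈ M.E, M.Indep {e})
    {k s : ℕ} (hs : 1 ≤ s) (hub : ∀ K, M.IsCircuit K → K.ncard ≤ k)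
    (hbd : ∀ X ⊆ M.E, M.rk' X ≤ k * (k - 1) / 2 → X.ncard ≤ s) :
    M.E.ncard ≤ M.rk' M.E * s := by
  induction hn : M.E.ncard using Nat.strong_induction_on generalizing M k with
  | _ n ih =>
  subst hn
  by_cases hfree : M.Indep M.E
  · rw [hfree.rk'_eq_ncard]
    exact Nat.le_mul_of_pos_right _ hs
  have hEfin := M.ground_finite
  by_cases hsep : ∃ X ⊆ M.E, X.Nonempty ∧ X ≠ M.E ∧ ∀ K, M.IsCircuit K → K ⊆ X ∨ Disjoint K X
  · obtain ⟨X, hXE, hXne, hXE', hX⟩ := hsep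
    have hres : ∀ Y ⊂ M.E, Y.ncard ≤ M.rk' Y * s := by
      intro Y hY
      have hfin : (M ↾ Y).Finite := ⟨M.set_finite Y hY.subset⟩
      have := ih Y.ncard (ncard_lt_ncard hY hEfin) (M ↾ Y) (k := k)
        (fun e he ↦ restrict_indep_iff.2 ⟨hM e (hY.subset he), singleton_subset_iff.2 he⟩)
        (fun K hK ↦ hub K ((restrict_isCircuit_iff hY.subset).1 hK).1)
        (fun Z hZ h ↦ hbd Z (hZ.trans hY.subset) (by rwa [restrict_rk' hY.subset hZ] at h)) rfl
      rwa [restrict_ground_eq, restrict_rk' hY.subset subset_rfl] at this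
    have h1 := hres X (ssubset_iff_subset_ne.2 ⟨hXE, hXE'⟩)
    have h2 := hres (M.E \ X) ⟨sdiff_subset, fun h ↦ by
      obtain ⟨x, hx⟩ := hXne
      exact (h (hXE hx)).2 hx⟩
    have h3 := ncard_sdiff_add_ncard_of_subset hXE hEfin
    have h4 := Nat.mul_le_mul_right s (rk'_add_rk'_diff_le hX)
    rw [add_mul] at h4
    omega
  have hconn : ∀ e ∈ M.E, ∀ f ∈ M.E, e ≠ f → ∃ K, M.IsCircuit K ∧ e ∈ K ∧ f ∈ K := by
    intro e he
    by_contra! hcon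
    obtain ⟨f, hf, hef, hcon⟩ := hcon
    refine hsep ⟨{x | x ∈ M.E ∧ (x = e ∨ ∃ K, M.IsCircuit K ∧ e ∈ K ∧ x ∈ K)},
      fun x hx ↦ hx.1, ⟨e, he, Or.inl rfl⟩, fun h ↦ ?_, fun K hK ↦ ?_⟩
    · rcases (h.ge hf).2 with rfl | ⟨K, hK, heK, hfK⟩
      exacts [hef rfl, hcon K hK heK hfK]
    · refine or_iff_not_imp_right.2 fun hdj y hy ↦ ⟨hK.subset_ground hy, Or.inr ?_⟩
      obtain ⟨x, hxK, -, rfl | ⟨K', hK', heK', hxK'⟩⟩ := not_disjoint_iff.1 hdj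
      · exact ⟨K, hK, hxK, hy⟩
      · exact hK'.exists_isCircuit_of_inter_nonempty hK heK' hy ⟨x, hxK', hxK⟩
  obtain ⟨C, hC, hmax⟩ : ∃ C, M.IsCircuit C ∧ ∀ K, M.IsCircuit K → K.ncard ≤ C.ncard := by
    obtain ⟨C, -, hC⟩ := Dep.exists_isCircuit_subset (⟨hfree, subset_rfl⟩ : M.Dep M.E)
    obtain ⟨C, hC, hmax⟩ := (hEfin.finite_subsets.subset
      (fun K hK ↦ IsCircuit.subset_ground hK : {K | M.IsCircuit K} ⊆ _)).exists_maximalFor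
      Set.ncard _ ⟨C, hC⟩
    exact ⟨C, hC, fun K hK ↦ (le_total K.ncard C.ncard).elim id fun h ↦ hmax hK h⟩
  obtain ⟨m, hm⟩ : ∃ m, C.ncard = m + 2 := by
    obtain ⟨c, hc⟩ := hC.nonempty
    have hfin := M.set_finite C hC.subset_ground
    refine ⟨C.ncard - 2, ?_⟩
    have h1 : {c} ⊂ C := ssubset_iff_subset_ne.2 ⟨singleton_subset_iff.2 hc, fun h ↦
      hC.not_indep (h ▸ hM c (hC.subset_ground hc))⟩
    have h2 := ncard_lt_ncard h1 hfin
    rw [ncard_singleton] at h2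
    omega
  have hmk : m + 2 ≤ k := hm ▸ hub C hC
  have htri : (m + 1) * m / 2 + (m + 1) ≤ k * (k - 1) / 2 := by
    calc (m + 1) * m / 2 + (m + 1) = ((m + 1) * m + (m + 1) * 2) / 2 := by
          rw [Nat.add_mul_div_right _ _ two_pos]
      _ = ((m + 2) * (m + 1)) / 2 := by congr 1; ring
      _ ≤ k * (k - 1) / 2 := Nat.div_le_div_right (Nat.mul_le_mul hmk (by omega))
  obtain ⟨c, hc⟩ := hC.nonempty
  have hI := hC.sdiff_singleton_indep hc
  have hIcard := ncard_sdiff_singleton_add_one hc (M.set_finite C hC.subset_ground)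
  have hrC := hC.rk'_add_one_eq
  set F := M.closure C with hF
  have hFE : F ⊆ M.E := M.closure_subset_ground C
  have hCF : C ⊆ F := M.subset_closure C hC.subset_ground
  set I := C \ {c} with hIdef
  have hIF : Disjoint (M.E \ F) I :=
    disjoint_sdiff_left.mono_right (sdiff_subset.trans hCF)
  have hEF : M.E \ F ⊆ (M ／ I).E := subset_sdiff.2 ⟨sdiff_subset, hIF⟩
  have hrk : ∀ X ⊆ M.E \ F, ((M ／ I) ↾ (M.E \ F)).rk' X + I.ncard = M.rk' (X ∪ I) := by
    intro X hX
    rw [restrict_rk' hEF hX, rk'_contract_add_ncard hI]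
  have hfin : ((M ／ I) ↾ (M.E \ F)).Finite := ⟨hEfin.subset sdiff_subset⟩
  have hlt : (M.E \ F).ncard < M.E.ncard := ncard_lt_ncard
    ⟨sdiff_subset, fun h ↦ (h (hFE (hCF hc))).2 (hCF hc)⟩ hEfin
  have hih := ih _ hlt ((M ／ I) ↾ (M.E \ F)) (k := m + 1)
    (fun e he ↦ by
      refine restrict_indep_iff.2 ⟨hI.contract_indep_iff.2
        ⟨hIF.mono_left (singleton_subset_iff.2 he), ?_⟩, singleton_subset_iff.2 he⟩
      rw [singleton_union, hI.insert_indep_iff, hIdef, hC.closure_sdiff_singleton_eq c]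
      exact Or.inl he)
    (fun K hK ↦ Nat.lt_succ_iff.1 (hC.ncard_lt_of_isCircuit_contract hm
      (fun L hL ↦ (hmax L hL).trans hm.le) hconn hc hK))
    (fun X hX hXr ↦ hbd X (hX.trans sdiff_subset) (by
      have h1 := hrk X hX
      have h2 : M.rk' X ≤ M.rk' (X ∪ I) := rk'_mono subset_union_left
      simp only [Nat.add_sub_cancel] at hXr
      omega)) rfl
  have h1 := hrk _ subset_rfl
  have h2 : M.rk' ((M.E \ F) ∪ I) ≤ M.rk' M.E :=
    rk'_mono (union_subset sdiff_subset hI.subset_ground)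
  have h3 : F.ncard ≤ s := hbd F hFE (by rw [hF, rk'_closure]; omega)
  have h4 := ncard_sdiff_add_ncard_of_subset hFE hEfin
  rw [restrict_ground_eq] at hih
  calc M.E.ncard ≤ ((M ／ I) ↾ (M.E \ F)).rk' (M.E \ F) * s + s := by omega
    _ = (((M ／ I) ↾ (M.E \ F)).rk' (M.E \ F) + 1) * s := by ring
    _ ≤ M.rk' M.E * s := Nat.mul_le_mul_right s (by omega)

end Density

end Matroid

/-- If `M` is a finite loopless matroid whose largest circuit has size `c(M) = k > 1`,
then `γ(M) ≤ s_M(k(k-1)/2)`. -/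
theorem gamma_le_sFun (M : Matroid α) [M.Finite] (hLoopless : M.Loopless')
    (k : ℕ) (hk : 1 < k)
    (hex : ∃ C, M.IsCircuit' C ∧ C.ncard = k)
    (hub : ∀ C, M.IsCircuit' C → C.ncard ≤ k) :
    M.gamma ≤ M.sFun (k * (k - 1) / 2) := by
  have hbdd : BddAbove {n | ∃ A ⊆ M.E, M.rk' A ≤ k * (k - 1) / 2 ∧ A.ncard = n} := by
    refine ⟨M.E.ncard, ?_⟩
    rintro _ ⟨A, hA, -, rfl⟩
    exact ncard_le_ncard hA M.ground_finite
  have hle : ∀ A ⊆ M.E, M.rk' A ≤ k * (k - 1) / 2 → A.ncard ≤ M.sFun (k * (k - 1) / 2) :=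
    fun A hA h ↦ le_csSup hbdd ⟨A, hA, h, rfl⟩
  have hpos : 1 ≤ M.sFun (k * (k - 1) / 2) := by
    obtain ⟨C, hC, -⟩ := hex
    obtain ⟨c, hc⟩ := (isCircuit'_iff.1 hC).nonempty
    have h1 : 1 ≤ k * (k - 1) / 2 := by
      rw [Nat.one_le_div_iff two_pos]
      exact Nat.mul_le_mul hk (Nat.le_sub_one_of_lt hk)
    simpa using hle {c} (singleton_subset_iff.2 (hC.1 hc))
      ((rk'_le_ncard (singleton_subset_iff.2 (hC.1 hc))).trans (by simpa using h1))
  refine csSup_le' ?_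
  rintro _ ⟨A, hA, ⟨a, ha⟩, rfl⟩
  have hfin : (M ↾ A).Finite := ⟨M.set_finite A hA⟩
  have hmain := ncard_ground_le_rk'_mul (M ↾ A) (k := k)
    (fun e he ↦ restrict_indep_iff.2 ⟨hLoopless e (hA he), singleton_subset_iff.2 he⟩) hpos
    (fun K hK ↦ hub K (isCircuit'_iff.2 ((restrict_isCircuit_iff hA).1 hK).1))
    (fun X hX h ↦ hle X (hX.trans hA) (by rwa [restrict_rk' hA hX] at h))
  rw [restrict_ground_eq, restrict_rk' hA subset_rfl] at hmain
  have hrpos : 0 < M.rk' A := by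
    have := (hLoopless a (hA ha)).ncard_le_rk' (singleton_subset_iff.2 ha)
    rwa [ncard_singleton] at this
  rw [Nat.ceil_le, div_le_iff₀ (by exact_mod_cast hrpos), mul_comm]
  exact_mod_cast hmain
end

section
/- Fix a field F and an integer d >= 1. For every k >= 1 there is a constant b_d > 0 (depending only on d) such that: if K is a finite simplicial d-complex whose d-simplices support at least one nontrivial d-cycle over F, and f_d(K) > b_d * k^{2 + 2/d} * rank_d(K), then K contains a simple d-cycle of size greater than k. -/
open Finset

/-- The simplicial boundary of a simplex `σ` (a finite set of vertices from a linearly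
ordered vertex set), as an element of the free `F`-vector space on the set of all
simplices: if `σ = [v_0, …, v_d]` with `v_0 < ⋯ < v_d`, then
`∂σ = ∑ⱼ (-1)ʲ [v_0, …, v̂_j, …, v_d]`. -/
noncomputable def sbdry (F : Type) [Field F] {V : Type} [LinearOrder V]
    (σ : Finset V) : (Finset V) →₀ F :=
  ∑ v ∈ σ, ((-1 : F) ^ ((σ.filter (fun w => w < v)).card)) •
    Finsupp.single (σ.erase v) (1 : F)

/-- `c` is a `d`-cycle over `F`: an `F`-linear combination of `d`-simplices
(i.e. `(d+1)`-element vertex sets) whose boundary is `0`. -/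
def IsCycle (F : Type) [Field F] {V : Type} [LinearOrder V] (d : ℕ)
    (c : (Finset V) →₀ F) : Prop :=
  (∀ σ ∈ c.support, σ.card = d + 1) ∧ ∑ σ ∈ c.support, c σ • sbdry F σ = 0

/-- A nontrivial `d`-cycle is simple if its support does not strictly contain the
support of any other nontrivial `d`-cycle. -/
def IsSimpleCycle (F : Type) [Field F] {V : Type} [LinearOrder V] (d : ℕ)
    (c : (Finset V) →₀ F) : Prop :=
  IsCycle F d c ∧ c ≠ 0 ∧
    ∀ c' : (Finset V) →₀ F, IsCycle F d c' → c' ≠ 0 → c'.support ⊆ c.support →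
      c'.support = c.support

/-- The rank over `F` of a finite set `A` of `d`-simplices: the dimension of the span
of the boundaries of the members of `A`. -/
noncomputable def rankBd (F : Type) [Field F] {V : Type} [LinearOrder V]
    (A : Finset (Finset V)) : ℕ :=
  Module.finrank F (Submodule.span F ((fun σ => sbdry F σ) '' (↑A : Set (Finset V))))

namespace Matroid

open Set

variable {α : Type*} {M : Matroid α} {C D Z : Set α}

/-- Lying in a common circuit is a transitive relation. -/
theorem exists_isCircuit_mem_mem_of_inter_nonempty [M.Finite] {e g : α} {C₁ C₂ : Set α}
    (hC₁ : M.IsCircuit C₁) (hC₂ : M.IsCircuit C₂) (he : e ∈ C₁) (hg : g ∈ C₂)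
    (hne : (C₁ ∩ C₂).Nonempty) : ∃ C, M.IsCircuit C ∧ e ∈ C ∧ g ∈ C := by
  induction hn : (C₁ ∪ C₂).ncard using Nat.strong_induction_on generalizing C₁ C₂ with
  | _ n ih =>
  subst hn
  have hfin : (C₁ ∪ C₂).Finite :=
    M.ground_finite.subset (union_subset hC₁.subset_ground hC₂.subset_ground)
  by_cases heC₂ : e ∈ C₂
  · exact ⟨C₂, hC₂, heC₂, hg⟩
  by_cases hgC₁ : g ∈ C₁
  · exact ⟨C₁, hC₁, he, hgC₁⟩
  obtain ⟨f, hf₁, hf₂⟩ := hne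
  obtain ⟨C₃, hC₃s, hC₃, he₃⟩ := hC₁.strong_elimination hC₂ hf₁ hf₂ he heC₂
  obtain ⟨C₄, hC₄s, hC₄, hg₄⟩ := hC₂.strong_elimination hC₁ hf₂ hf₁ hg hgC₁
  have h₃ : ∃ x ∈ C₃, x ∉ C₁ := by
    by_contra! h
    have := hC₃.eq_of_subset_isCircuit hC₁ h
    exact (hC₃s (this ▸ hf₁)).2 rfl
  have h₄ : ∃ x ∈ C₄, x ∉ C₂ := by
    by_contra! h
    have := hC₄.eq_of_subset_isCircuit hC₂ h
    exact (hC₄s (this ▸ hf₂)).2 rfl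
  obtain ⟨x, hx₃, hx₁⟩ := h₃
  obtain ⟨y, hy₄, hy₂⟩ := h₄
  have hx₂ : x ∈ C₂ := by grind
  have hy₁ : y ∈ C₁ := by grind
  by_cases hx₄ : x ∈ C₄
  · refine ih _ (ncard_lt_ncard ?_ hfin) hC₃ hC₄ he₃ hg₄ ⟨x, hx₃, hx₄⟩ rfl
    refine ⟨by grind, fun h ↦ ?_⟩
    have := h (Or.inl hf₁)
    grind
  · refine ih _ (ncard_lt_ncard ?_ hfin) hC₁ hC₄ he hg₄ ⟨y, hy₁, hy₄⟩ rfl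
    refine ⟨by grind, fun h ↦ ?_⟩
    have := h (Or.inr hx₂)
    grind

/-- Let `Z` be a circuit meeting two disjoint circuits `C` and `D` whose part outside `C ∪ D` is
nonempty and minimal. Then the part of `Z` in `C` can be changed to another one, the two parts
covering `C`, with the rest of `Z` untouched. -/
theorem IsCircuit.exists_exchange_inter (hC : M.IsCircuit C) (hD : M.IsCircuit D)
    (hCD : Disjoint C D) (hZ : M.IsCircuit Z) (hZC : (Z ∩ C).Nonempty) (hZD : (Z ∩ D).Nonempty)
    (hP : (Z \ (C ∪ D)).Nonempty)
    (hmin : ∀ Z', M.IsCircuit Z' → (Z' ∩ C).Nonempty → (Z' ∩ D).Nonempty →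
      ¬ Z' \ (C ∪ D) ⊂ Z \ (C ∪ D)) :
    ∃ Z', M.IsCircuit Z' ∧ (Z' ∩ C).Nonempty ∧ Z' ∩ D = Z ∩ D ∧ Z' \ (C ∪ D) = Z \ (C ∪ D) ∧
      C ⊆ Z ∪ Z' := by
  have hdj : ∀ x ∈ C, x ∉ D := fun x hx hx' ↦ hCD.ne_of_mem hx hx' rfl
  obtain ⟨e, heZ, heC⟩ := hZC
  obtain ⟨f, hfZ, hfD⟩ := hZD
  obtain ⟨p, hpZ, hp⟩ := hP
  -- a circuit inside `C ∪ Z` avoiding a point of `Z \ (C ∪ D)` cannot meet both `C` and `D`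
  have key : ∀ Q q, M.IsCircuit Q → Q ⊆ C ∪ Z → q ∈ Z → q ∉ C ∪ D → q ∉ Q →
      (Q ∩ C).Nonempty → (Q ∩ D).Nonempty → False := by
    intro Q q hQ hQs hqZ hq hqQ h1 h2
    refine hmin Q hQ h1 h2 ⟨by grind, fun h ↦ hqQ (h ⟨hqZ, hq⟩).1⟩
  -- and a circuit contained in `Z` is all of `Z`
  have sub : ∀ Q, M.IsCircuit Q → Q ⊆ Z → e ∈ Q ∧ p ∈ Q ∧ f ∈ Q := by
    intro Q hQ h
    rw [hQ.eq_of_subset_isCircuit hZ h]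
    exact ⟨heZ, hpZ, hfZ⟩
  obtain ⟨Z₂, hZ₂s, hZ₂, hf₂⟩ := hZ.strong_elimination hC heZ heC hfZ (fun h ↦ hdj f h hfD)
  have he₂ : e ∉ Z₂ := fun h ↦ (hZ₂s h).2 rfl
  have hZ₂C : (Z₂ ∩ C).Nonempty := by
    by_contra h
    exact he₂ (sub Z₂ hZ₂ fun x hx ↦ (hZ₂s hx).1.resolve_right fun hxC ↦ h ⟨x, hx, hxC⟩).1
  have hPP : ∀ x ∈ Z, x ∉ C ∪ D → x ∈ Z₂ := by
    intro x hx hxCD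
    by_contra hx₂
    exact key Z₂ x hZ₂ (by grind) hx hxCD hx₂ hZ₂C ⟨f, hf₂, hfD⟩
  have hDD : ∀ y ∈ Z, y ∈ D → y ∈ Z₂ := by
    intro y hy hyD
    by_contra hy₂
    obtain ⟨Q, hQs, hQ, hyQ⟩ := hZ.strong_elimination hZ₂ hpZ (hPP p hpZ hp) hy hy₂
    have hpQ : p ∉ Q := fun h ↦ (hQs h).2 rfl
    by_cases hQC : (Q ∩ C).Nonempty
    · exact key Q p hQ (by grind) hpZ hp hpQ hQC ⟨y, hyQ, hyD⟩
    · refine hpQ (sub Q hQ fun x hx ↦ ?_).2.1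
      have hxC : x ∉ C := fun hxC ↦ hQC ⟨x, hx, hxC⟩
      exact (hQs hx).1.elim id fun h ↦ (hZ₂s h).1.resolve_right hxC
  refine ⟨Z₂, hZ₂, hZ₂C, by grind, by grind, ?_⟩
  obtain ⟨Q, hQs, hQ, heQ⟩ := hZ.strong_elimination hZ₂ hpZ (hPP p hpZ hp) heZ he₂
  have hpQ : p ∉ Q := fun h ↦ (hQs h).2 rfl
  have hQD : ¬ (Q ∩ D).Nonempty := fun h ↦ key Q p hQ (by grind) hpZ hp hpQ ⟨e, heQ, heC⟩ h
  rw [Set.not_nonempty_iff_eq_empty] at hQD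
  by_cases hQC : Q ⊆ C
  · rw [← hQ.eq_of_subset_isCircuit hC hQC]
    grind
  exfalso
  obtain ⟨q, hqQ, hqC⟩ := not_subset.1 hQC
  have hqD : q ∉ D := fun h ↦ by
    have : q ∈ Q ∩ D := ⟨hqQ, h⟩
    simp [hQD] at this
  have hqZ : q ∈ Z := by grind
  have hfQ : f ∉ Q := fun h ↦ by
    have : f ∈ Q ∩ D := ⟨h, hfD⟩
    simp [hQD] at this
  obtain ⟨R, hRs, hR, hfR⟩ := hZ.strong_elimination hQ hqZ hqQ hfZ hfQ
  have hqR : q ∉ R := fun h ↦ (hRs h).2 rfl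
  by_cases hRC : (R ∩ C).Nonempty
  · exact key R q hR (by grind) hqZ (by grind) hqR hRC ⟨f, hfR, hfD⟩
  · have hRZ : R ⊆ Z := fun x hx ↦ by
      have hxC : x ∉ C := fun hxC ↦ hRC ⟨x, hx, hxC⟩
      refine (hRs hx).1.elim id fun h ↦ (hQs h).1.elim id fun h ↦ ?_
      exact (hZ₂s h).1.resolve_right hxC
    exact hqR (hR.eq_of_subset_isCircuit hZ hRZ ▸ hqZ)

/-- The circuit obtained by the exchange can be chosen to contain at least half of `C`. -/
theorem IsCircuit.exists_half_inter [M.Finite] (hC : M.IsCircuit C) (hD : M.IsCircuit D)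
    (hCD : Disjoint C D) (hZ : M.IsCircuit Z) (hZC : (Z ∩ C).Nonempty) (hZD : (Z ∩ D).Nonempty)
    (hP : (Z \ (C ∪ D)).Nonempty)
    (hmin : ∀ Z', M.IsCircuit Z' → (Z' ∩ C).Nonempty → (Z' ∩ D).Nonempty →
      ¬ Z' \ (C ∪ D) ⊂ Z \ (C ∪ D)) :
    ∃ Z', M.IsCircuit Z' ∧ (Z' ∩ C).Nonempty ∧ Z' ∩ D = Z ∩ D ∧ Z' \ (C ∪ D) = Z \ (C ∪ D) ∧
      C.ncard ≤ 2 * (Z' ∩ C).ncard := by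
  obtain ⟨Z₂, hZ₂, h1, h2, h3, h4⟩ := hC.exists_exchange_inter hD hCD hZ hZC hZD hP hmin
  have hCfin : C.Finite := M.ground_finite.subset hC.subset_ground
  have hcard : C.ncard ≤ (Z ∩ C).ncard + (Z₂ ∩ C).ncard := by
    refine le_trans (ncard_le_ncard (t := (Z ∩ C) ∪ (Z₂ ∩ C)) (by grind) ?_) (ncard_union_le _ _)
    exact hCfin.subset (by grind)
  by_cases h : C.ncard ≤ 2 * (Z ∩ C).ncard
  · exact ⟨Z, hZ, hZC, rfl, rfl, h⟩
  · exact ⟨Z₂, hZ₂, h1, h2, h3, by omega⟩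

/-- If some circuit meets both of two disjoint circuits `C` and `D`, but none contained in `C ∪ D`
does, then there is a circuit with more than `(|C| + |D|) / 2` elements. -/
theorem IsCircuit.exists_isCircuit_add_lt_two_mul [M.Finite] (hC : M.IsCircuit C)
    (hD : M.IsCircuit D) (hCD : Disjoint C D)
    (hskew : ∀ Z, M.IsCircuit Z → (Z ∩ C).Nonempty → (Z ∩ D).Nonempty → ¬ Z ⊆ C ∪ D)
    (hconn : ∃ Z, M.IsCircuit Z ∧ (Z ∩ C).Nonempty ∧ (Z ∩ D).Nonempty) :
    ∃ Z, M.IsCircuit Z ∧ C.ncard + D.ncard < 2 * Z.ncard := by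
  let 𝒵 : Set (Set α) := {Z | M.IsCircuit Z ∧ (Z ∩ C).Nonempty ∧ (Z ∩ D).Nonempty}
  have h𝒵 : 𝒵.Finite := M.ground_finite.finite_subsets.subset fun Z hZ ↦ hZ.1.subset_ground
  obtain ⟨Z, ⟨hZ, hZC, hZD⟩, hZmin⟩ :=
    h𝒵.exists_minimalFor (fun Z ↦ Z \ (C ∪ D)) 𝒵 hconn
  have hmin : ∀ Z', M.IsCircuit Z' → (Z' ∩ C).Nonempty → (Z' ∩ D).Nonempty →
      ¬ Z' \ (C ∪ D) ⊂ Z \ (C ∪ D) :=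
    fun Z' h1 h2 h3 hss ↦ hss.2 (hZmin ⟨h1, h2, h3⟩ hss.1)
  have hP : (Z \ (C ∪ D)).Nonempty := by
    obtain ⟨x, hx⟩ := not_subset.1 (hskew Z hZ hZC hZD)
    exact ⟨x, hx⟩
  obtain ⟨Z₁, hZ₁, hZ₁C, hZ₁D, hZ₁P, hZ₁c⟩ := hC.exists_half_inter hD hCD hZ hZC hZD hP hmin
  obtain ⟨Z₂, hZ₂, hZ₂D, hZ₂C, hZ₂P, hZ₂c⟩ := hD.exists_half_inter hC hCD.symm hZ₁
    (hZ₁D ▸ hZD) hZ₁C (by rwa [union_comm, hZ₁P]) (fun Z' h1 h2 h3 ↦ by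
      rw [union_comm, hZ₁P]; exact hmin Z' h1 h3 h2)
  refine ⟨Z₂, hZ₂, ?_⟩
  have hfin : Z₂.Finite := M.ground_finite.subset hZ₂.subset_ground
  have hsplit : Z₂.ncard = (Z₂ ∩ C).ncard + ((Z₂ ∩ D).ncard + (Z₂ \ (D ∪ C)).ncard) := by
    rw [← ncard_union_eq _ (hfin.subset inter_subset_left) (hfin.subset sdiff_subset),
      ← ncard_union_eq _ (hfin.subset inter_subset_left)
        (hfin.subset (union_subset inter_subset_left sdiff_subset))]
    · congr 1; grind
    · rw [Set.disjoint_left] at hCD ⊢; grind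
    · rw [Set.disjoint_left]; grind
  have hpos : 0 < (Z₂ \ (D ∪ C)).ncard := by
    rw [ncard_pos (hfin.subset sdiff_subset), hZ₂P, union_comm, hZ₁P]
    exact hP
  rw [hZ₂C] at hsplit
  omega

/-- In a matroid where any two elements of the ground set lie in a common circuit, contracting a
circuit of the largest possible size decreases the size of the largest circuits. -/
theorem IsCircuit.ncard_lt_of_contract [M.Finite] (hC : M.IsCircuit C)
    (hmax : ∀ Z, M.IsCircuit Z → Z.ncard ≤ C.ncard)
    (hconn : ∀ e ∈ M.E, ∀ f ∈ M.E, e ≠ f → ∃ Z, M.IsCircuit Z ∧ e ∈ Z ∧ f ∈ Z)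
    (hD : (M ／ C).IsCircuit D) : D.ncard < C.ncard := by
  by_contra! hlt
  obtain ⟨D', hD', hDD', hD's⟩ := hD.exists_subset_isCircuit_of_contract
  have hDD : D = D' := eq_of_subset_of_ncard_le hDD' ((hmax _ hD').trans hlt)
    (M.ground_finite.subset hD'.subset_ground)
  subst hDD
  have hdj : Disjoint C D := by
    have := hD.subset_ground
    rw [contract_ground, subset_sdiff] at this
    exact this.2.symm
  have hskew : ∀ Z, M.IsCircuit Z → (Z ∩ C).Nonempty → (Z ∩ D).Nonempty → ¬ Z ⊆ C ∪ D := by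
    intro Z hZ hZC hZD hZs
    rw [Set.disjoint_left] at hdj
    obtain ⟨x, hxZ, hxD⟩ := hZD
    obtain ⟨c, hcZ, hcC⟩ := hZC
    have hdep := hZ.contract_dep_of_not_subset (C := C) (fun h ↦ hdj (h hxZ) hxD)
    have heq := hD.eq_of_dep_subset hdep (by grind)
    have hZD := hD'.eq_of_subset_isCircuit hZ (by grind)
    grind
  obtain ⟨c, hc⟩ := hC.nonempty
  obtain ⟨x, hx⟩ := hD'.nonempty
  obtain ⟨Z, hZ, h1, h2⟩ := hconn c (hC.subset_ground hc) x (hD'.subset_ground hx)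
    (hdj.ne_of_mem hc hx)
  obtain ⟨Z', hZ', hZc⟩ := hC.exists_isCircuit_add_lt_two_mul hD' hdj hskew
    ⟨Z, hZ, ⟨c, h1, hc⟩, ⟨x, h2, hx⟩⟩
  have := hmax Z' hZ'
  omega

theorem eRk_le_contract_eRk_add (M : Matroid α) (C S : Set α) :
    M.eRk S ≤ (M ／ C).eRk S + M.eRk C := by
  obtain ⟨J, hJ⟩ := M.exists_isBasis' C
  obtain ⟨I, hI, hJI⟩ := hJ.indep.subset_isBasis'_of_subset (hJ.subset.trans Set.subset_union_right)
    (X := S ∪ C)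
  have hIC : (M ／ C).Indep (I \ C) := by
    rw [hJ.contract_indep_iff]
    exact ⟨hI.indep.subset (Set.union_subset Set.sdiff_subset hJI), Set.disjoint_sdiff_right⟩
  calc M.eRk S ≤ M.eRk (S ∪ C) := M.eRk_mono Set.subset_union_left
    _ = I.encard := hI.eRk_eq_encard
    _ = (I \ C).encard + (I ∩ C).encard := (Set.encard_sdiff_add_encard_inter I C).symm
    _ ≤ _ := add_le_add
      (hIC.encard_le_eRk_of_subset fun x hx ↦ (hI.subset hx.1).resolve_right hx.2)
      ((hI.indep.subset Set.inter_subset_left).encard_le_eRk_of_subset Set.inter_subset_right)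

theorem contract_eRank_add_eRk_le (M : Matroid α) (C : Set α) :
    (M ／ C).eRank + M.eRk C ≤ M.eRank := by
  obtain ⟨J, hJ⟩ := M.exists_isBasis' C
  obtain ⟨B, hB⟩ := (M ／ C).exists_isBase
  obtain ⟨hi, hd⟩ := hJ.contract_indep_iff.1 hB.indep
  rw [← hB.encard_eq_eRank, ← hJ.encard_eq_eRk,
    ← Set.encard_union_eq (hd.symm.mono_right hJ.subset)]
  exact hi.encard_le_eRank

/-- If every circuit lies in `A` or in `B`, the ranks of `A` and `B` add up. -/
theorem eRk_add_eRk_le_eRank_of_isCircuit_subset {A B : Set α}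
    (hAB : Disjoint A B) (h : ∀ C, M.IsCircuit C → C ⊆ A ∨ C ⊆ B) :
    M.eRk A + M.eRk B ≤ M.eRank := by
  obtain ⟨I, hI⟩ := M.exists_isBasis' A
  obtain ⟨J, hJ⟩ := M.exists_isBasis' B
  rw [← hI.encard_eq_eRk, ← hJ.encard_eq_eRk,
    ← Set.encard_union_eq (hAB.mono hI.subset hJ.subset)]
  refine Indep.encard_le_eRank ?_
  rw [indep_iff_forall_subset_not_isCircuit
    (Set.union_subset hI.indep.subset_ground hJ.indep.subset_ground)]
  intro C hCs hC
  obtain hCA | hCB := h C hC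
  · refine hC.not_indep (hI.indep.subset fun x hx ↦ (hCs hx).resolve_right fun hxJ ↦ ?_)
    exact hAB.ne_of_mem (hCA hx) (hJ.subset hxJ) rfl
  · refine hC.not_indep (hJ.indep.subset fun x hx ↦ (hCs hx).resolve_left fun hxI ↦ ?_)
    exact hAB.ne_of_mem (hI.subset hxI) (hCB hx) rfl

/-- If all circuits of a finite matroid have at most `k` elements, then its nonloops can be covered
by at most `rank M` sets, each of rank at most `k ^ 2 + 1`. -/
theorem exists_cover_of_forall_isCircuit_ncard_le (k : ℕ) (M : Matroid α) [M.Finite]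
    (hk : ∀ C, M.IsCircuit C → C.ncard ≤ k) :
    ∃ 𝒮 : Set (Set α), 𝒮.encard ≤ M.eRank ∧ (∀ e, M.IsNonloop e → ∃ S ∈ 𝒮, e ∈ S) ∧
      ∀ S ∈ 𝒮, M.eRk S ≤ ((k ^ 2 + 1 : ℕ) : ℕ∞) := by
  induction k generalizing M with
  | zero =>
    have hI : M.Indep M.E := by
      rw [indep_iff_forall_subset_not_isCircuit]
      intro C _ hC
      have := hk C hC
      rw [Nat.le_zero, Set.ncard_eq_zero (M.ground_finite.subset hC.subset_ground)] at this
      exact hC.nonempty.ne_empty this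
    refine ⟨(fun e ↦ {e}) '' M.E, ?_, fun e he ↦ ⟨{e}, ⟨e, he.mem_ground, rfl⟩, rfl⟩, ?_⟩
    · exact (Set.encard_image_le _ _).trans hI.encard_le_eRank
    · rintro _ ⟨e, -, rfl⟩
      simp
  | succ k ih =>
    induction hn : M.E.ncard using Nat.strong_induction_on generalizing M with
    | _ n ihn =>
    subst hn
    by_cases hconn : ∀ e ∈ M.E, ∀ f ∈ M.E, e ≠ f → ∃ Z, M.IsCircuit Z ∧ e ∈ Z ∧ f ∈ Z
    · by_cases hex : ∃ C, M.IsCircuit C ∧ C.ncard = k + 1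
      · obtain ⟨C, hC, hCk⟩ := hex
        have hCfin := M.ground_finite.subset hC.subset_ground
        have hrk : M.eRk C = k := by
          have := hC.eRk_add_one_eq
          rw [← hCfin.cast_ncard_eq, hCk] at this
          push_cast at this
          simpa using this
        obtain ⟨𝒮, h1, h2, h3⟩ := ih (M ／ C) fun D hD ↦ by
          have := hC.ncard_lt_of_contract (fun Z hZ ↦ hCk ▸ hk Z hZ) hconn hD
          omega
        obtain ⟨𝒯, h4, h5, h6⟩ : ∃ 𝒯 : Set (Set α), 𝒯.encard ≤ M.eRk C ∧
            (∀ e ∈ M.closure C, M.IsNonloop e → ∃ S ∈ 𝒯, e ∈ S) ∧ ∀ S ∈ 𝒯, M.eRk S ≤ M.eRk C := by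
          obtain h0 | hpos := eq_or_ne (M.eRk C) 0
          · refine ⟨∅, by simp, fun e he hne ↦ ?_, by simp⟩
            rw [← eRk_closure_eq, eRk_eq_zero_iff] at h0
            exact (hne.not_isLoop (h0 he)).elim
          · exact ⟨{M.closure C}, by simpa [Order.one_le_iff_pos, pos_iff_ne_zero] using hpos,
              fun e he _ ↦ ⟨_, rfl, he⟩, by simp⟩
        refine ⟨𝒮 ∪ 𝒯, ?_, fun e he ↦ ?_, fun S hS ↦ hS.elim (fun hS ↦ ?_) fun hS ↦ ?_⟩
        · exact (Set.encard_union_le _ _).trans <| (add_le_add h1 h4).trans <|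
            M.contract_eRank_add_eRk_le C
        · by_cases heC : e ∈ M.closure C
          · obtain ⟨S, hS, heS⟩ := h5 e heC he
            exact ⟨S, .inr hS, heS⟩
          · obtain ⟨S, hS, heS⟩ := h2 e (contract_isNonloop_iff.2 ⟨he.mem_ground, heC⟩)
            exact ⟨S, .inl hS, heS⟩
        · refine (M.eRk_le_contract_eRk_add C S).trans ((add_le_add (h3 S hS) hrk.le).trans ?_)
          norm_cast
          nlinarith
        · refine (h6 S hS).trans (hrk.le.trans ?_)
          norm_cast
          nlinarith
      · obtain ⟨𝒮, h1, h2, h3⟩ := ih M fun C hC ↦ by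
          have := hk C hC
          have : C.ncard ≠ k + 1 := fun h ↦ hex ⟨C, hC, h⟩
          omega
        refine ⟨𝒮, h1, h2, fun S hS ↦ (h3 S hS).trans ?_⟩
        gcongr
        simp
    · push Not at hconn
      obtain ⟨e, he, f, hf, hef, hno⟩ := hconn
      let A : Set α := {x ∈ M.E | x = e ∨ ∃ Z, M.IsCircuit Z ∧ e ∈ Z ∧ x ∈ Z}
      let B : Set α := M.E \ A
      have hA : A ⊆ M.E := fun x hx ↦ hx.1
      have hB : B ⊆ M.E := Set.sdiff_subset
      have heA : e ∈ A := ⟨he, .inl rfl⟩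
      have hfA : f ∉ A := by
        rintro ⟨-, rfl | ⟨Z, h1, h2, h3⟩⟩
        · exact hef rfl
        · exact hno Z h1 h2 h3
      have hsplit : ∀ C, M.IsCircuit C → C ⊆ A ∨ C ⊆ B := by
        intro C hC
        by_cases hCA : ∃ x ∈ C, x ∈ A
        · obtain ⟨x, hxC, hx, hxA⟩ := hCA
          refine .inl fun y hyC ↦ ⟨hC.subset_ground hyC, .inr ?_⟩
          obtain rfl | ⟨Z, hZ, heZ, hxZ⟩ := hxA
          · exact ⟨C, hC, hxC, hyC⟩
          · exact exists_isCircuit_mem_mem_of_inter_nonempty hZ hC heZ hyC ⟨x, hxZ, hxC⟩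
        · exact .inr fun y hyC ↦ ⟨hC.subset_ground hyC, fun hyA ↦ hCA ⟨y, hyC, hyA⟩⟩
      have hrec : ∀ X ⊂ M.E, ∃ 𝒮 : Set (Set α), 𝒮.encard ≤ M.eRk X ∧
          (∀ e ∈ X, M.IsNonloop e → ∃ S ∈ 𝒮, e ∈ S) ∧
          ∀ S ∈ 𝒮, M.eRk S ≤ (((k + 1) ^ 2 + 1 : ℕ) : ℕ∞) := by
        intro X hX
        have : (M ↾ X).Finite := ⟨M.ground_finite.subset hX.1⟩
        obtain ⟨𝒮, h1, h2, h3⟩ := ihn X.ncard (Set.ncard_lt_ncard hX M.ground_finite) (M ↾ X)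
          (fun C hC ↦ hk C ((restrict_isCircuit_iff hX.1).1 hC).1) rfl
        refine ⟨(· ∩ X) '' 𝒮, (Set.encard_image_le _ _).trans h1, fun e he hne ↦ ?_, ?_⟩
        · obtain ⟨S, hS, heS⟩ := h2 e (restrict_isNonloop_iff.2 ⟨hne, he⟩)
          exact ⟨S ∩ X, ⟨S, hS, rfl⟩, heS, he⟩
        · rintro _ ⟨S, hS, rfl⟩
          rw [← restrict_eRk_eq']
          exact h3 S hS
      obtain ⟨𝒮, h1, h2, h3⟩ := hrec A ⟨hA, fun h ↦ hfA (h hf)⟩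
      obtain ⟨𝒯, h4, h5, h6⟩ := hrec B ⟨hB, fun h ↦ (h he).2 heA⟩
      refine ⟨𝒮 ∪ 𝒯, ?_, fun x hx ↦ ?_, fun S hS ↦ hS.elim (h3 S) (h6 S)⟩
      · exact (Set.encard_union_le _ _).trans <| (add_le_add h1 h4).trans <|
          eRk_add_eRk_le_eRank_of_isCircuit_subset Set.disjoint_sdiff_right hsplit
      · by_cases hxA : x ∈ A
        · obtain ⟨S, hS, hxS⟩ := h2 x hxA hx
          exact ⟨S, .inl hS, hxS⟩
        · obtain ⟨S, hS, hxS⟩ := h5 x ⟨hx.mem_ground, hxA⟩ hx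
          exact ⟨S, .inr hS, hxS⟩

end Matroid

section Boundary

variable {F : Type} [Field F] {V : Type} [LinearOrder V]

/-- The boundary of a cone over `τ` with apex below all vertices of `τ`. -/
theorem sbdry_insert {v : V} {τ : Finset V} (hv : ∀ w ∈ τ, v < w) :
    sbdry F (insert v τ) =
      Finsupp.single τ 1 - ∑ w ∈ τ, ((-1 : F) ^ ((τ.filter (fun u => u < w)).card)) •
        Finsupp.single (insert v (τ.erase w)) (1 : F) := by
  have hvτ : v ∉ τ := fun h ↦ (hv v h).false
  rw [sbdry, Finset.sum_insert hvτ, sub_eq_add_neg, ← Finset.sum_neg_distrib]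
  congr 1
  · have : (insert v τ).filter (fun w => w < v) = ∅ := by
      ext x
      simp only [mem_filter, mem_insert, notMem_empty, iff_false, not_and, not_lt]
      rintro (rfl | hx)
      exacts [le_rfl, (hv x hx).le]
    simp [this, hvτ]
  · refine Finset.sum_congr rfl fun w hw ↦ ?_
    have hvw := hv w hw
    rw [filter_insert, if_pos hvw, card_insert_of_notMem (by simp [hvτ]),
      erase_insert_of_ne hvw.ne, pow_succ]
    simp

/-- The linear map forgetting all simplices that contain `v`. -/
noncomputable def delMap (F : Type) [Field F] {V : Type} [LinearOrder V] (v : V) :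
    (Finset V →₀ F) →ₗ[F] (Finset V →₀ F) :=
  Finsupp.linearCombination F fun ρ ↦ if v ∈ ρ then 0 else Finsupp.single ρ 1

/-- The linear map sending a simplex containing `v` to its face opposite to `v`, and all other
simplices to `0`. -/
noncomputable def linkMap (F : Type) [Field F] {V : Type} [LinearOrder V] (v : V) :
    (Finset V →₀ F) →ₗ[F] (Finset V →₀ F) :=
  Finsupp.linearCombination F fun ρ ↦ if v ∈ ρ then Finsupp.single (ρ.erase v) 1 else 0

theorem delMap_sbdry_insert {v : V} {τ : Finset V} (hv : ∀ w ∈ τ, v < w) :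
    delMap F v (sbdry F (insert v τ)) = Finsupp.single τ 1 := by
  have hvτ : v ∉ τ := fun h ↦ (hv v h).false
  simp [sbdry_insert hv, delMap, hvτ]

theorem linkMap_sbdry_insert {v : V} {τ : Finset V} (hv : ∀ w ∈ τ, v < w) :
    linkMap F v (sbdry F (insert v τ)) = -sbdry F τ := by
  have hvτ : v ∉ τ := fun h ↦ (hv v h).false
  rw [sbdry_insert hv, sbdry, map_sub, map_sum]
  simp [linkMap, hvτ]

theorem linkMap_sbdry_of_notMem {v : V} {σ : Finset V} (hv : v ∉ σ) :
    linkMap F v (sbdry F σ) = 0 := by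
  rw [sbdry, map_sum]
  refine Finset.sum_eq_zero fun w _ ↦ ?_
  simp [linkMap, hv]

/-- The link of `v` in the set `A` of simplices. -/
def link (A : Finset (Finset V)) (v : V) : Finset (Finset V) :=
  (A.filter (v ∈ ·)).image (·.erase v)

theorem mem_link {A : Finset (Finset V)} {v : V} {τ : Finset V} :
    τ ∈ link A v ↔ v ∉ τ ∧ insert v τ ∈ A := by
  simp only [link, mem_image, mem_filter]
  constructor
  · rintro ⟨σ, ⟨hσ, hv⟩, rfl⟩
    simp [insert_erase hv, hσ]
  · rintro ⟨hv, h⟩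
    exact ⟨insert v τ, ⟨h, mem_insert_self _ _⟩, erase_insert hv⟩

theorem card_link_add_card_filter (A : Finset (Finset V)) (v : V) :
    (A.filter (v ∉ ·)).card + (link A v).card = A.card := by
  rw [link, card_image_of_injOn, add_comm, card_filter_add_card_filter_not]
  intro σ hσ τ hτ h
  simp only [coe_filter, Set.mem_ofPred_eq] at hσ hτ h
  rw [← insert_erase hσ.2, h, insert_erase hτ.2]

theorem lt_of_mem_link {A : Finset (Finset V)} {v : V} (hv : ∀ σ ∈ A, ∀ w ∈ σ, v ≤ w)
    {τ : Finset V} (hτ : τ ∈ link A v) : ∀ w ∈ τ, v < w := by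
  obtain ⟨hvτ, hA⟩ := mem_link.1 hτ
  exact fun w hw ↦ lt_of_le_of_ne (hv _ hA w (mem_insert_of_mem hw)) fun h ↦ hvτ (h ▸ hw)

theorem card_link_le_rankBd {A : Finset (Finset V)} {v : V} (hv : ∀ σ ∈ A, ∀ w ∈ σ, v ≤ w) :
    (link A v).card ≤ rankBd F A := by
  have hli : LinearIndependent F
      fun τ : link A v ↦ (⟨sbdry F (insert v τ.1), Submodule.subset_span
        ⟨_, (mem_link.1 τ.2).2, rfl⟩⟩ :
        Submodule.span F ((fun σ => sbdry F σ) '' (A : Set (Finset V)))) := by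
    refine LinearIndependent.of_comp (delMap F v ∘ₗ Submodule.subtype _) ?_
    have : (delMap F v ∘ₗ Submodule.subtype _) ∘ (fun τ : link A v ↦
        (⟨sbdry F (insert v τ.1), Submodule.subset_span ⟨_, (mem_link.1 τ.2).2, rfl⟩⟩ :
        Submodule.span F ((fun σ => sbdry F σ) '' (A : Set (Finset V))))) =
        fun τ : link A v ↦ Finsupp.single τ.1 (1 : F) := by
      ext1 τ
      exact delMap_sbdry_insert (lt_of_mem_link hv τ.2)
    rw [this]
    exact (Finsupp.linearIndependent_single_one F (Finset V)).comp _ Subtype.val_injective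
  have : FiniteDimensional F (Submodule.span F ((fun σ => sbdry F σ) '' (A : Set (Finset V)))) :=
    FiniteDimensional.span_of_finite F (A.finite_toSet.image _)
  simpa [rankBd] using hli.fintype_card_le_finrank

theorem Submodule.finrank_add_finrank_le_of_le_map {E E' : Type*} [AddCommGroup E] [Module F E]
    [AddCommGroup E'] [Module F E'] (f : E →ₗ[F] E') {W U : Submodule F E} {U' : Submodule F E'}
    [FiniteDimensional F W] (hUW : U ≤ W) (hUf : U ≤ f.ker) (hU' : U' ≤ W.map f) :
    Module.finrank F U + Module.finrank F U' ≤ Module.finrank F W := by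
  have h := (f.domRestrict W).finrank_range_add_finrank_ker
  rw [LinearMap.range_domRestrict] at h
  have h1 := Submodule.finrank_mono hU'
  have h2 : Module.finrank F U ≤ Module.finrank F (f.domRestrict W).ker := by
    rw [← (Submodule.comapSubtypeEquivOfLe hUW).finrank_eq]
    exact Submodule.finrank_mono fun x hx ↦ hUf hx
  omega

theorem rankBd_filter_add_rankBd_link_le {A : Finset (Finset V)} {v : V}
    (hv : ∀ σ ∈ A, ∀ w ∈ σ, v ≤ w) :
    rankBd F (A.filter (v ∉ ·)) + rankBd F (link A v) ≤ rankBd F A := by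
  have : FiniteDimensional F (Submodule.span F ((fun σ => sbdry F σ) '' (A : Set (Finset V)))) :=
    FiniteDimensional.span_of_finite F (A.finite_toSet.image _)
  refine Submodule.finrank_add_finrank_le_of_le_map (linkMap F v)
    (Submodule.span_mono (Set.image_mono fun σ hσ ↦ (mem_filter.1 hσ).1))
    (Submodule.span_le.2 ?_) (Submodule.span_le.2 ?_)
  · rintro _ ⟨σ, hσ, rfl⟩
    exact linkMap_sbdry_of_notMem (mem_filter.1 hσ).2
  · rintro _ ⟨τ, hτ, rfl⟩
    refine ⟨-sbdry F (insert v τ),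
      Submodule.neg_mem _ (Submodule.subset_span ⟨_, (mem_link.1 hτ).2, rfl⟩), ?_⟩
    simp [linkMap_sbdry_insert (lt_of_mem_link hv hτ)]

/-- A nonempty set of `d`-simplices whose boundaries span a space of dimension `r` has at most
`r ^ (1 + 1 / d)` elements. -/
theorem card_pow_le_rankBd_pow (d : ℕ) (A : Finset (Finset V)) (hA : A.Nonempty)
    (hcard : ∀ σ ∈ A, σ.card = d + 1) : A.card ^ d ≤ rankBd F A ^ (d + 1) := by
  induction d generalizing A with
  | zero =>
    obtain ⟨σ, hσ⟩ := hA
    obtain ⟨v, rfl⟩ := card_eq_one.1 (hcard σ hσ)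
    have : FiniteDimensional F (Submodule.span F ((fun σ => sbdry F σ) '' (A : Set (Finset V)))) :=
      FiniteDimensional.span_of_finite F (A.finite_toSet.image _)
    rw [pow_zero, zero_add, pow_one, rankBd, Submodule.one_le_finrank_iff, Ne,
      Submodule.span_eq_bot]
    intro h
    simpa [sbdry] using h _ ⟨{v}, hσ, rfl⟩
  | succ d ih =>
    obtain ⟨t, ht0, ht⟩ : ∃ t : ℝ, 0 ≤ t ∧ t ^ (d + 1) = rankBd F A :=
      ⟨(rankBd F A : ℝ) ^ ((d + 1 : ℕ) : ℝ)⁻¹, by positivity,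
        Real.rpow_inv_natCast_pow (by positivity) (by simp)⟩
    have key : ∀ n, ∀ B : Finset (Finset V), B.card = n → (∀ σ ∈ B, σ.card = d + 1 + 1) →
        (rankBd F B : ℝ) ≤ t ^ (d + 1) → (B.card : ℝ) ≤ rankBd F B * t := by
      intro n
      induction n using Nat.strong_induction_on with
      | _ n ihn =>
      rintro B rfl hB hBt
      obtain rfl | hne := B.eq_empty_or_nonempty
      · simp only [card_empty, Nat.cast_zero]
        positivity
      have hsup : (B.biUnion id).Nonempty := by
        obtain ⟨σ, hσ⟩ := hne
        obtain ⟨w, hw⟩ : σ.Nonempty := card_pos.1 (by simp [hB σ hσ])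
        exact ⟨w, mem_biUnion.2 ⟨σ, hσ, hw⟩⟩
      obtain ⟨v, hvB, hv⟩ : ∃ v ∈ B.biUnion id, ∀ w ∈ B.biUnion id, v ≤ w :=
        ⟨_, min'_mem _ hsup, fun w hw ↦ min'_le _ _ hw⟩
      replace hv : ∀ σ ∈ B, ∀ w ∈ σ, v ≤ w := fun σ hσ w hw ↦ hv w (mem_biUnion.2 ⟨σ, hσ, hw⟩)
      obtain ⟨σ, hσ, hvσ : v ∈ σ⟩ := mem_biUnion.1 hvB
      have hlink : (link B v).Nonempty :=
        ⟨σ.erase v, mem_link.2 ⟨notMem_erase _ _, by rwa [insert_erase hvσ]⟩⟩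
      have hsum := card_link_add_card_filter B v
      have hrank := rankBd_filter_add_rankBd_link_le (F := F) hv
      have hpos := hlink.card_pos
      have hdeg := card_link_le_rankBd (F := F) hv
      have hl : (link B v).card ^ d ≤ rankBd F (link B v) ^ (d + 1) := by
        refine ih _ hlink fun τ hτ ↦ ?_
        obtain ⟨hvτ, hτB⟩ := mem_link.1 hτ
        have := hB _ hτB
        rw [card_insert_of_notMem hvτ] at this
        omega
      have hdel := ihn _ (by omega) (B.filter (v ∉ ·)) rfl (fun σ hσ ↦ hB σ (mem_filter.1 hσ).1)
        (le_trans (by exact_mod_cast (by omega)) hBt)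
      have hl' : ((link B v).card : ℝ) ≤ rankBd F (link B v) * t := by
        refine (pow_le_pow_iff_left₀ (by positivity) (by positivity) (Nat.succ_ne_zero d)).1 ?_
        rw [mul_pow, pow_succ]
        refine mul_le_mul (by exact_mod_cast hl) ?_ (by positivity) (by positivity)
        exact le_trans (by exact_mod_cast hdeg) hBt
      calc (B.card : ℝ) = (B.filter (v ∉ ·)).card + (link B v).card := by exact_mod_cast hsum.symm
        _ ≤ rankBd F (B.filter (v ∉ ·)) * t + rankBd F (link B v) * t := add_le_add hdel hl'
        _ = ((rankBd F (B.filter (v ∉ ·)) + rankBd F (link B v) : ℕ) : ℝ) * t := by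
          push_cast; ring
        _ ≤ rankBd F B * t := by gcongr
    have hfinal := pow_le_pow_left₀ (by positivity) (key _ A rfl hcard ht.ge) (d + 1)
    rw [mul_pow, ht, ← pow_succ] at hfinal
    exact_mod_cast hfinal

end Boundary

section LinearMatroid

variable {F : Type*} [Field F] {α E : Type*} [AddCommGroup E] [Module F E]

theorem LinearIndepOn.finrank_span_image_eq_ncard {f : α → E} {I : Set α}
    (hI : LinearIndepOn F f I) (hfin : I.Finite) :
    Module.finrank F (Submodule.span F (f '' I)) = I.ncard := by
  have := hfin.fintype
  have h := finrank_span_eq_card hI.linearIndependent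
  rwa [← Set.image_eq_range, ← Nat.card_eq_fintype_card, Nat.card_coe_set_eq] at h

/-- The matroid of linear dependence of a finite family of vectors. -/
def linearMatroid (F : Type*) [Field F] {α E : Type*} [AddCommGroup E] [Module F E]
    (f : α → E) (K : Finset α) : Matroid α :=
  (IndepMatroid.ofFinite K.finite_toSet (fun I ↦ I ⊆ K ∧ LinearIndepOn F f I)
    ⟨Set.empty_subset _, linearIndepOn_empty _ _⟩
    (fun _ _ hJ hIJ ↦ ⟨hIJ.trans hJ.1, hJ.2.mono hIJ⟩)
    (by
      rintro I J ⟨hIK, hI⟩ ⟨hJK, hJ⟩ hIJ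
      have hIfin := K.finite_toSet.subset hIK
      have hJfin := K.finite_toSet.subset hJK
      have : ∃ e ∈ J, f e ∉ Submodule.span F (f '' I) := by
        by_contra! h
        have : FiniteDimensional F (Submodule.span F (f '' I)) :=
          FiniteDimensional.span_of_finite F (hIfin.image f)
        have hle := Submodule.finrank_mono (R := F) (Submodule.span_le.2 (Set.image_subset_iff.2 h))
        rw [hI.finrank_span_image_eq_ncard hIfin, hJ.finrank_span_image_eq_ncard hJfin] at hle
        omega
      obtain ⟨e, heJ, he⟩ := this
      exact ⟨e, heJ, fun heI ↦ he (Submodule.subset_span ⟨e, heI, rfl⟩),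
        Set.insert_subset (hJK heJ) hIK, hI.insert he⟩)
    (fun _ hI ↦ hI.1)).matroid

variable {f : α → E} {K : Finset α}

theorem linearMatroid_indep_iff {I : Set α} :
    (linearMatroid F f K).Indep I ↔ I ⊆ K ∧ LinearIndepOn F f I := Iff.rfl

instance : (linearMatroid F f K).Finite := ⟨K.finite_toSet⟩

theorem eRank_linearMatroid_le :
    (linearMatroid F f K).eRank ≤ Module.finrank F (Submodule.span F (f '' K)) := by
  obtain ⟨B, hB⟩ := (linearMatroid F f K).exists_isBase
  obtain ⟨hBK, hli⟩ := linearMatroid_indep_iff.1 hB.indep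
  have hfin := K.finite_toSet.subset hBK
  have : FiniteDimensional F (Submodule.span F (f '' K)) :=
    FiniteDimensional.span_of_finite F (K.finite_toSet.image f)
  rw [← hB.encard_eq_eRank, ← hfin.cast_ncard_eq, ← hli.finrank_span_image_eq_ncard hfin]
  exact_mod_cast Submodule.finrank_mono (Submodule.span_mono (Set.image_mono hBK))

theorem finrank_span_le_eRk_linearMatroid {S : Set α} (hS : S ⊆ K) :
    Module.finrank F (Submodule.span F (f '' S)) ≤ (linearMatroid F f K).eRk S := by
  obtain ⟨I, hI⟩ := (linearMatroid F f K).exists_isBasis S hS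
  obtain ⟨hIK, hli⟩ := linearMatroid_indep_iff.1 hI.indep
  have hfin := K.finite_toSet.subset hIK
  have : FiniteDimensional F (Submodule.span F (f '' I)) :=
    FiniteDimensional.span_of_finite F (hfin.image f)
  rw [← hI.encard_eq_eRk, ← hfin.cast_ncard_eq, ← hli.finrank_span_image_eq_ncard hfin]
  refine Nat.cast_le.2 (Submodule.finrank_mono (Submodule.span_le.2 ?_))
  rintro _ ⟨x, hx, rfl⟩
  by_contra hxI
  refine hxI (Submodule.subset_span ⟨x, ?_, rfl⟩)
  exact hI.mem_of_insert_indep hx (linearMatroid_indep_iff.2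
    ⟨Set.insert_subset (hS hx) hIK, hli.insert hxI⟩)

/-- A circuit of a linear matroid is the support of a linear dependence. -/
theorem exists_support_eq_of_isCircuit_linearMatroid {C : Set α}
    (hC : (linearMatroid F f K).IsCircuit C) :
    ∃ c : α →₀ F, (c.support : Set α) = C ∧ ∑ x ∈ c.support, c x • f x = 0 ∧
      ∀ c' : α →₀ F, ∑ x ∈ c'.support, c' x • f x = 0 → c' ≠ 0 → c'.support ⊆ c.support →
        c'.support = c.support := by
  have hCK : C ⊆ K := hC.subset_ground
  have hsupp : ∀ c : α →₀ F, (c.support : Set α) ⊆ C → ∑ x ∈ c.support, c x • f x = 0 → c ≠ 0 →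
      (c.support : Set α) = C := by
    intro c hcC hc hc0
    refine hC.eq_of_not_indep_subset (fun hi ↦ ?_) hcC
    exact linearDepOn_iff.2 ⟨c, (Finsupp.mem_supported F c).2 subset_rfl, hc, hc0⟩ (linearMatroid_indep_iff.1 hi).2
  have hdep : ¬ LinearIndepOn F f C := fun h ↦ hC.not_indep (linearMatroid_indep_iff.2 ⟨hCK, h⟩)
  obtain ⟨c, hcC, hc, hc0⟩ := linearDepOn_iff.1 hdep
  have hcC' := hsupp c hcC hc hc0
  refine ⟨c, hcC', hc, fun c' hc' hc'0 hsub ↦ ?_⟩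
  have := hsupp c' (fun x hx ↦ hcC (hsub hx)) hc' hc'0
  exact_mod_cast this.trans hcC'.symm

end LinearMatroid

theorem natCast_le_rpow_of_pow_le {a r d : ℕ} (hd : 1 ≤ d) (h : a ^ d ≤ r ^ (d + 1)) :
    (a : ℝ) ≤ (r : ℝ) ^ (1 + 1 / (d : ℝ)) := by
  have hd' : (d : ℝ) ≠ 0 := by positivity
  refine (pow_le_pow_iff_left₀ (by positivity) (by positivity) (by omega : d ≠ 0)).1 ?_
  rw [← Real.rpow_mul_natCast (by positivity), add_mul, one_div_mul_cancel hd', one_mul]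
  exact_mod_cast h

theorem sq_add_one_rpow_le {k d : ℕ} (hk : 1 ≤ k) (hd : 1 ≤ d) :
    ((k ^ 2 + 1 : ℕ) : ℝ) ^ (1 + 1 / (d : ℝ)) ≤ 4 * (k : ℝ) ^ ((2 : ℝ) + 2 / (d : ℝ)) := by
  have hk' : (1 : ℝ) ≤ k := by exact_mod_cast hk
  have hd' : 1 / (d : ℝ) ≤ 1 := by
    rw [div_le_one (by positivity)]
    exact_mod_cast hd
  calc ((k ^ 2 + 1 : ℕ) : ℝ) ^ (1 + 1 / (d : ℝ)) ≤ (2 * (k : ℝ) ^ 2) ^ (1 + 1 / (d : ℝ)) := by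
        refine Real.rpow_le_rpow (by positivity) ?_ (by positivity)
        push_cast
        nlinarith
    _ = 2 ^ (1 + 1 / (d : ℝ)) * (k : ℝ) ^ ((2 : ℝ) + 2 / (d : ℝ)) := by
        rw [Real.mul_rpow (by positivity) (by positivity), ← Real.rpow_natCast_mul (by positivity)]
        congr 2
        push_cast
        ring
    _ ≤ 4 * (k : ℝ) ^ ((2 : ℝ) + 2 / (d : ℝ)) := by
        gcongr
        calc (2 : ℝ) ^ (1 + 1 / (d : ℝ)) ≤ 2 ^ (2 : ℝ) :=
              Real.rpow_le_rpow_of_exponent_le (by norm_num) (by linarith)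
          _ = 4 := by norm_num

/-- For every `d ≥ 1` and field `F` there is a constant `b_d > 0` depending only on
`d` such that for every `k ≥ 1`: if `K` is a finite simplicial `d`-complex (given by
its finite set of `d`-simplices) whose `d`-simplices support a nontrivial `d`-cycle
over `F`, and `f_d(K) > b_d · k^{2 + 2/d} · rank_d(K)`, then `K` contains a simple
`d`-cycle of size greater than `k`. -/
theorem exists_large_simple_cycle_of_dense (F : Type) [Field F] (d : ℕ) (hd : 1 ≤ d) :
    ∃ b : ℝ, 0 < b ∧
      ∀ (k : ℕ), 1 ≤ k →
        ∀ (V : Type) [LinearOrder V] (K : Finset (Finset V)),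
          (∀ σ ∈ K, σ.card = d + 1) →
          (∃ c : (Finset V) →₀ F, IsCycle F d c ∧ c ≠ 0 ∧ c.support ⊆ K) →
          b * (k : ℝ) ^ ((2 : ℝ) + 2 / (d : ℝ)) * (rankBd F K : ℝ) < (K.card : ℝ) →
          ∃ c : (Finset V) →₀ F, IsSimpleCycle F d c ∧ c.support ⊆ K ∧
            k < c.support.card := by
  refine ⟨4, by norm_num, fun k hk V _ K hK _ hlt ↦ ?_⟩
  by_contra! hno
  let M := linearMatroid F (sbdry F) K
  have hcirc : ∀ C, M.IsCircuit C → C.ncard ≤ k := by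
    intro C hC
    obtain ⟨c, rfl, hc, hmin⟩ := exists_support_eq_of_isCircuit_linearMatroid hC
    have hcK : c.support ⊆ K := by exact_mod_cast hC.subset_ground
    rw [Set.ncard_coe_finset]
    refine hno c ⟨⟨fun σ hσ ↦ hK σ (hcK hσ), hc⟩, ?_, fun c' hc' ↦ hmin c' hc'.2⟩ hcK
    rintro rfl
    simpa using hC.nonempty
  have hpiece : ∀ A ⊆ K, A.Nonempty → A.card ^ d ≤ rankBd F A ^ (d + 1) :=
    fun A hA hne ↦ card_pow_le_rankBd_pow d A hne fun σ hσ ↦ hK σ (hA hσ)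
  have hnonloop : ∀ σ ∈ K, M.IsNonloop σ := by
    intro σ hσ
    rw [← Matroid.indep_singleton, linearMatroid_indep_iff, linearIndepOn_singleton_iff]
    refine ⟨by simpa using hσ, fun h0 ↦ ?_⟩
    have := hpiece {σ} (by simpa using hσ) (by simp)
    rw [rankBd, coe_singleton, Set.image_singleton, h0, Submodule.span_zero_singleton] at this
    simp at this
  obtain ⟨𝒮, hcard, hcover, hrank⟩ := M.exists_cover_of_forall_isCircuit_ncard_le k hcirc
  replace hcard : 𝒮.encard ≤ rankBd F K := hcard.trans eRank_linearMatroid_le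
  have hfin : 𝒮.Finite := Set.finite_of_encard_le_coe hcard
  obtain ⟨T, rfl⟩ := hfin.exists_finset_coe
  rw [Set.encard_coe_eq_coe_finsetCard, Nat.cast_le] at hcard
  classical
  have hS : ∀ S ∈ T, ((K.filter (· ∈ S)).card : ℝ) ≤ 4 * (k : ℝ) ^ ((2 : ℝ) + 2 / (d : ℝ)) := by
    intro S hS
    obtain h0 | hne := (K.filter (· ∈ S)).eq_empty_or_nonempty
    · rw [h0, card_empty, Nat.cast_zero]
      positivity
    refine (natCast_le_rpow_of_pow_le (r := k ^ 2 + 1) hd ?_).trans (sq_add_one_rpow_le hk hd)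
    refine (hpiece _ (filter_subset _ _) hne).trans (Nat.pow_le_pow_left ?_ _)
    have h1 := finrank_span_le_eRk_linearMatroid (F := F) (f := sbdry F) (K := K)
      (S := K.filter (· ∈ S)) (coe_subset.2 (filter_subset _ _))
    exact_mod_cast (h1.trans (M.eRk_mono fun σ hσ ↦ (mem_filter.1 hσ).2)).trans (hrank S hS)
  have hsub : K ⊆ T.biUnion fun S ↦ K.filter (· ∈ S) := fun σ hσ ↦ by
    obtain ⟨S, hS, hσS⟩ := hcover σ (hnonloop σ hσ)
    exact mem_biUnion.2 ⟨S, hS, mem_filter.2 ⟨hσ, hσS⟩⟩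
  refine hlt.not_ge ?_
  calc (K.card : ℝ) ≤ ∑ S ∈ T, ((K.filter (· ∈ S)).card : ℝ) := by
        exact_mod_cast (card_le_card hsub).trans card_biUnion_le
    _ ≤ T.card • (4 * (k : ℝ) ^ ((2 : ℝ) + 2 / (d : ℝ))) := sum_le_card_nsmul _ _ _ hS
    _ ≤ 4 * (k : ℝ) ^ ((2 : ℝ) + 2 / (d : ℝ)) * rankBd F K := by
        rw [nsmul_eq_mul, mul_comm]
        gcongr
end

section
/- Fix a field F and an integer d >= 1. Let K be a finite simplicial d-complex whose d-simplices support at least one nontrivial d-cycle over F. Then c_d(K) >= sqrt(gamma_d(K)/d) - 1, where c_d(K) is the maximum size of a simple d-cycle of K and gamma_d(K) = max over nonempty subsets A of the set of d-simplices of K of ceil(|A| / rank_d(A)). -/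
open Finset

/-- `γ_d(K)`: the maximum over nonempty subsets `A` of the set of `d`-simplices of
`K` of `⌈|A| / rank_d(A)⌉`. -/
noncomputable def gammaD (F : Type) [Field F] {V : Type} [LinearOrder V]
    (K : Finset (Finset V)) : ℕ :=
  sSup {n | ∃ A : Finset (Finset V), A ⊆ K ∧ A.Nonempty ∧
    n = ⌈(A.card : ℚ) / (rankBd F A : ℚ)⌉₊}

/-- A nonzero vector of `W` is elementary if no nonzero vector of `W` has strictly smaller
support: the supports of elementary vectors are the circuits of the matroid with cycle space `W`. -/
def IsElementary {F ι : Type*} [Field F] (W : Submodule F (ι →₀ F)) (u : ι →₀ F) : Prop :=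
  u ∈ W ∧ u ≠ 0 ∧ ∀ w ∈ W, w ≠ 0 → w.support ⊆ u.support → w.support = u.support

section Elementary

variable {F ι : Type*} [Field F]

lemma IsElementary.support_nonempty {W : Submodule F (ι →₀ F)} {u : ι →₀ F}
    (hu : IsElementary W u) : u.support.Nonempty :=
  Finsupp.support_nonempty_iff.2 hu.2.1

lemma mem_sup_supported {W : Submodule F (ι →₀ F)} {T : Finset ι} {w : ι →₀ F} :
    w ∈ W ⊔ Finsupp.supported F F (T : Set ι) ↔
      ∃ z : ι →₀ F, z.support ⊆ T ∧ w + z ∈ W := by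
  rw [Submodule.mem_sup]
  constructor
  · rintro ⟨y, hy, z, hz, rfl⟩
    rw [Finsupp.mem_supported] at hz
    exact ⟨-z, by simpa using hz, by simpa using hy⟩
  · rintro ⟨z, hz, h⟩
    exact ⟨w + z, h, -z, by simpa [Finsupp.mem_supported] using hz, by simp⟩

variable [DecidableEq ι]

lemma support_sub_smul_subset (u w : ι →₀ F) (t : F) :
    (u - t • w).support ⊆ u.support ∪ w.support := by
  intro x hx
  by_contra h
  simp only [mem_union, Finsupp.mem_support_iff, not_or, not_not] at h
  simp [h.1, h.2] at hx

/-- Elimination of the coordinate `x` from `u` by a multiple of `w`. -/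
lemma support_eliminate_subset (u w : ι →₀ F) {x : ι} (hx : w x ≠ 0) :
    (u - (u x / w x) • w).support ⊆ (u.support ∪ w.support).erase x := by
  intro y hy
  refine mem_erase.2 ⟨?_, support_sub_smul_subset u w _ hy⟩
  rintro rfl
  simp [hx] at hy

lemma filter_mem_support (w : ι →₀ F) (T : Finset ι) :
    (w.filter (· ∈ T)).support ⊆ T := by
  intro x hx
  rw [Finsupp.support_filter, mem_filter] at hx
  exact hx.2

lemma sub_filter_mem_support (w : ι →₀ F) {T U : Finset ι} (h : w.support ⊆ T ∪ U) :
    (w - w.filter (· ∈ T)).support ⊆ U := by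
  intro x hx
  by_cases hT : x ∈ T
  · simp [hT] at hx
  · have : x ∈ w.support := by simpa [hT] using hx
    exact (mem_union.1 (h this)).resolve_left hT

lemma IsElementary.eq_zero_of_ssubset {W : Submodule F (ι →₀ F)} {u w : ι →₀ F}
    (hu : IsElementary W u) (hw : w ∈ W) {x : ι} (hx : x ∈ u.support)
    (h : w.support ⊆ u.support.erase x) : w = 0 := by
  by_contra h0
  have := hu.2.2 w hw h0 (h.trans (erase_subset _ _))
  rw [← this] at hx
  exact notMem_erase _ _ (h hx)

lemma IsElementary.exists_eq_smul {W : Submodule F (ι →₀ F)} {u w : ι →₀ F}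
    (hu : IsElementary W u) (hw : w ∈ W) (h : w.support ⊆ u.support) : ∃ t : F, w = t • u := by
  obtain ⟨x, hx⟩ := hu.support_nonempty
  refine ⟨w x / u x, sub_eq_zero.1 (hu.eq_zero_of_ssubset
    (W.sub_mem hw (W.smul_mem _ hu.1)) hx ?_)⟩
  have := support_eliminate_subset w u (Finsupp.mem_support_iff.1 hx)
  rwa [union_eq_right.2 h] at this

lemma exists_isElementary_notMem {W P : Submodule F (ι →₀ F)} {w : ι →₀ F}
    (hw : w ∈ W) (hP : w ∉ P) :
    ∃ u, IsElementary W u ∧ u ∉ P ∧ u.support ⊆ w.support := by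
  induction hn : w.support.card using Nat.strong_induction_on generalizing w with
  | _ n ih =>
  subst hn
  by_cases he : IsElementary W w
  · exact ⟨w, he, hP, Subset.rfl⟩
  have hw0 : w ≠ 0 := by rintro rfl; exact hP P.zero_mem
  simp only [IsElementary, not_and, not_forall] at he
  obtain ⟨y, hy, hy0, hsub, hne⟩ := he hw hw0
  have hss : y.support ⊂ w.support := hsub.ssubset_of_ne hne
  by_cases hyP : y ∈ P
  · obtain ⟨x, hx⟩ := Finsupp.support_nonempty_iff.2 hy0
    have hs := support_eliminate_subset w y (Finsupp.mem_support_iff.1 hx)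
    rw [union_eq_left.2 hsub] at hs
    obtain ⟨u, hu, huP, hus⟩ := ih _ ((card_le_card hs).trans_lt
      (card_erase_lt_of_mem (hsub hx))) (W.sub_mem hw (W.smul_mem (w x / y x) hy))
      (fun h => hP ((P.sub_mem_iff_left (P.smul_mem _ hyP)).1 h)) rfl
    exact ⟨u, hu, huP, hus.trans (hs.trans (erase_subset _ _))⟩
  · obtain ⟨u, hu, huP, hus⟩ := ih _ (card_lt_card hss) hy hyP rfl
    exact ⟨u, hu, huP, hus.trans hsub⟩

/-- If two circuits meet, one avoiding being killed by `P` and the other by `Q`, then some circuit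
in their union does both.  Taking coordinate hyperplanes for `P` and `Q` this is the transitivity
of the relation of lying in a common circuit. -/
lemma exists_isElementary_notMem_notMem {W P Q : Submodule F (ι →₀ F)} {u v : ι →₀ F}
    (hu : IsElementary W u) (hv : IsElementary W v) (huP : u ∉ P) (hvQ : v ∉ Q)
    (huv : ¬ Disjoint u.support v.support) :
    ∃ e, IsElementary W e ∧ e ∉ P ∧ e ∉ Q ∧ e.support ⊆ u.support ∪ v.support := by
  induction hn : (u.support ∪ v.support).card using Nat.strong_induction_on
    generalizing u v with
  | _ n ih =>
  subst hn
  by_contra hno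
  have huQ : u ∈ Q := by
    by_contra h
    exact hno ⟨u, hu, huP, h, subset_union_left⟩
  have hvP : v ∈ P := by
    by_contra h
    exact hno ⟨v, hv, h, hvQ, subset_union_right⟩
  obtain ⟨x, hxu, hxv⟩ := not_disjoint_iff.1 huv
  have hux : u x ≠ 0 := Finsupp.mem_support_iff.1 hxu
  have hvx : v x ≠ 0 := Finsupp.mem_support_iff.1 hxv
  set w := u - (u x / v x) • v with hw
  have hws : w.support ⊆ (u.support ∪ v.support).erase x := support_eliminate_subset u v hvx
  have hwW : w ∈ W := W.sub_mem hu.1 (W.smul_mem _ hv.1)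
  have hwP : w ∉ P := fun h => huP ((P.sub_mem_iff_left (P.smul_mem _ hvP)).1 h)
  have hwQ : w ∉ Q := fun h => hvQ ((Q.smul_mem_iff (div_ne_zero hux hvx)).1
    ((Q.sub_mem_iff_right huQ).1 h))
  obtain ⟨p, hp, hpP, hps⟩ := exists_isElementary_notMem hwW hwP
  obtain ⟨q, hq, hqQ, hqs⟩ := exists_isElementary_notMem hwW hwQ
  replace hps := hps.trans hws
  replace hqs := hqs.trans hws
  -- the union of two meeting supports cannot shrink
  have key : ∀ {a b : ι →₀ F}, IsElementary W a → IsElementary W b → a ∉ P → b ∉ Q →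
      ¬ Disjoint a.support b.support → a.support ∪ b.support ⊆ u.support ∪ v.support →
      a.support ∪ b.support = u.support ∪ v.support := by
    intro a b ha hb haP hbQ hab hsub
    by_contra hne
    obtain ⟨e, he, heP, heQ, hes⟩ :=
      ih _ (card_lt_card (hsub.ssubset_of_ne hne)) ha hb haP hbQ hab rfl
    exact hno ⟨e, he, heP, heQ, hes.trans hsub⟩
  have hpv : ∃ z ∈ p.support, z ∈ v.support ∧ z ∉ u.support := by
    by_contra! h
    refine hp.2.1 (hu.eq_zero_of_ssubset hp.1 hxu fun z hz => ?_)
    have := hps hz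
    grind
  have hqu : ∃ z ∈ q.support, z ∈ u.support ∧ z ∉ v.support := by
    by_contra! h
    refine hq.2.1 (hv.eq_zero_of_ssubset hq.1 hxv fun z hz => ?_)
    have := hqs hz
    grind
  obtain ⟨z, hzp, hzv, hzu⟩ := hpv
  obtain ⟨z', hzq, hzu', hzv'⟩ := hqu
  have hqsub : q.support ⊆ u.support ∪ v.support := hqs.trans (erase_subset _ _)
  have hpsub : p.support ⊆ u.support ∪ v.support := hps.trans (erase_subset _ _)
  have h2 := key hu hq huP hqQ (not_disjoint_iff.2 ⟨z', hzu', hzq⟩)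
    (union_subset subset_union_left hqsub)
  have hz : z ∈ q.support := by
    have : z ∈ u.support ∪ q.support := h2 ▸ mem_union_right _ hzv
    exact (mem_union.1 this).resolve_left hzu
  have h3 := key hp hq hpP hqQ (not_disjoint_iff.2 ⟨z, hzp, hz⟩) (union_subset hpsub hqsub)
  have : x ∈ p.support ∪ q.support := h3 ▸ mem_union_left _ hxu
  rcases mem_union.1 this with h | h
  · exact notMem_erase _ _ (hps h)
  · exact notMem_erase _ _ (hqs h)

lemma exists_sub_smul_half_support {c z : ι →₀ F} (hz : z.support ⊆ c.support)
    (h : ∀ t : F, z ≠ t • c) :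
    ∃ t : F, ∃ x ∈ c.support, (z - t • c) x = 0 ∧
      c.support.card ≤ 2 * (z - t • c).support.card := by
  have hc : c.support.Nonempty := by
    rw [Finsupp.support_nonempty_iff]
    rintro rfl
    exact h 0 (by simpa using hz)
  obtain ⟨a, ha⟩ := hc
  have ha' : c a ≠ 0 := Finsupp.mem_support_iff.1 ha
  obtain ⟨b, hb⟩ := Finsupp.support_nonempty_iff.2 (sub_ne_zero.2 (h (z a / c a)))
  have hbc : b ∈ c.support := by
    have := support_sub_smul_subset z c _ hb
    rwa [union_eq_right.2 hz] at this
  have hb' : c b ≠ 0 := Finsupp.mem_support_iff.1 hbc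
  have hcov : c.support ⊆ (z - (z a / c a) • c).support ∪ (z - (z b / c b) • c).support := by
    intro x hx
    have hx' : c x ≠ 0 := Finsupp.mem_support_iff.1 hx
    by_contra hn
    simp only [mem_union, Finsupp.mem_support_iff, not_or, not_not, Finsupp.coe_sub,
      Finsupp.coe_smul, Pi.sub_apply, Pi.smul_apply, smul_eq_mul] at hn hb
    have hab : z a / c a = z b / c b :=
      mul_right_cancel₀ hx' ((sub_eq_zero.1 hn.1).symm.trans (sub_eq_zero.1 hn.2))
    apply hb
    rw [hab]
    field_simp
    ring
  have := (card_le_card hcov).trans (card_union_le _ _)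
  rcases le_total (z - (z a / c a) • c).support.card (z - (z b / c b) • c).support.card with hl | hl
  · exact ⟨z b / c b, b, hbc, by simp [hb'], by omega⟩
  · exact ⟨z a / c a, a, ha, by simp [ha'], by omega⟩

/-- A circuit `y` of the contraction by a circuit `c` which is not a circuit itself extends to a
circuit that contains `y` and at least half of `c`. -/
lemma IsElementary.exists_extend {W : Submodule F (ι →₀ F)} {c y : ι →₀ F}
    (hc : IsElementary W c)
    (hy : IsElementary (W ⊔ Finsupp.supported F F (c.support : Set ι)) y)
    (hdisj : Disjoint c.support y.support) (hyW : y ∉ W) :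
    ∃ g, IsElementary W g ∧ (g - y).support ⊆ c.support ∧
      c.support.card + 2 * y.support.card ≤ 2 * g.support.card := by
  obtain ⟨z₀, hz₀, hw₀⟩ := mem_sup_supported.1 hy.1
  have hnot : ∀ t : F, z₀ ≠ t • c := by
    rintro t rfl
    exact hyW ((W.add_mem_iff_left (W.smul_mem t hc.1)).1 hw₀)
  obtain ⟨t, x, hx, hzx, hcard⟩ := exists_sub_smul_half_support hz₀ hnot
  set z := z₀ - t • c with hz
  have hzs : z.support ⊆ c.support := by
    have := support_sub_smul_subset z₀ c t
    rwa [union_eq_right.2 hz₀] at this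
  have hgW : y + z ∈ W := by
    rw [hz, ← add_sub_assoc]
    exact W.sub_mem hw₀ (W.smul_mem t hc.1)
  have hyz : Disjoint y.support z.support := (hdisj.mono_left hzs).symm
  have hgs : (y + z).support = y.support ∪ z.support := Finsupp.support_add_eq hyz
  refine ⟨y + z, ⟨hgW, ?_, ?_⟩, by simpa using hzs, ?_⟩
  · rw [← Finsupp.support_nonempty_iff, hgs]
    exact hy.support_nonempty.mono subset_union_left
  · intro w hw hw0 hws
    have hsplit : w.support ⊆ c.support ∪ y.support := by
      rw [hgs] at hws
      exact hws.trans (union_subset subset_union_right (hzs.trans subset_union_left))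
    have hmem : w - w.filter (· ∈ c.support) ∈
        W ⊔ Finsupp.supported F F (c.support : Set ι) := by
      refine mem_sup_supported.2 ⟨w.filter (· ∈ c.support), filter_mem_support _ _, ?_⟩
      simpa using hw
    obtain ⟨s, hs⟩ := hy.exists_eq_smul hmem (sub_filter_mem_support w hsplit)
    have hxg : (y + z) x = 0 := by
      have : y x = 0 := Finsupp.notMem_support_iff.1 (disjoint_left.1 hdisj hx)
      simp [this, hzx]
    have hxw : w x = 0 := by
      by_contra h
      exact Finsupp.mem_support_iff.1 (hws (Finsupp.mem_support_iff.2 h)) hxg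
    have hzero : w - s • (y + z) = 0 := by
      refine hc.eq_zero_of_ssubset (W.sub_mem hw (W.smul_mem s hgW)) hx fun a ha => ?_
      refine mem_erase.2 ⟨?_, ?_⟩
      · rintro rfl
        rw [Finsupp.mem_support_iff, Finsupp.sub_apply, Finsupp.smul_apply, hxg, hxw] at ha
        simp at ha
      · have hrw : w - s • (y + z) = w.filter (· ∈ c.support) - s • z := by
          rw [smul_add, ← hs]
          abel
        rw [hrw] at ha
        have := support_sub_smul_subset _ _ _ ha
        exact union_subset (filter_mem_support w c.support) hzs this
    have hs0 : s ≠ 0 := by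
      rintro rfl
      exact hw0 (by simpa using hzero)
    rw [sub_eq_zero.1 hzero, Finsupp.support_smul_eq hs0]
  · rw [hgs, card_union_of_disjoint hyz]
    omega

/-- In an inseparable set containing two skew circuits, some circuit of the contraction by both is
attached to each of them. -/
lemma exists_isElementary_attached {W : Submodule F (ι →₀ F)} {S : Finset ι}
    (hconn : ∀ T ⊆ S, (∀ w ∈ W, w.support ⊆ S → w.filter (· ∈ T) ∈ W) → T = ∅ ∨ T = S)
    {c y : ι →₀ F} (hc : IsElementary W c) (hcS : c.support ⊆ S)
    (hy : IsElementary (W ⊔ Finsupp.supported F F (c.support : Set ι)) y)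
    (hyS : y.support ⊆ S) (hdisj : Disjoint c.support y.support) (hyW : y ∈ W) :
    ∃ u, IsElementary (W ⊔ Finsupp.supported F F (c.support : Set ι) ⊔
        Finsupp.supported F F (y.support : Set ι)) u ∧
      u.support ⊆ S \ (c.support ∪ y.support) ∧
      u ∉ W ⊔ Finsupp.supported F F (c.support : Set ι) ∧
      u ∉ W ⊔ Finsupp.supported F F (y.support : Set ι) := by
  classical
  by_contra! hno
  set C := c.support with hC
  set D := y.support with hD
  set O := S \ (C ∪ D) with hO
  set W' := W ⊔ Finsupp.supported F F (C : Set ι) ⊔ Finsupp.supported F F (D : Set ι) with hW'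
  have hOC : ∀ x ∈ O, x ∉ C ∧ x ∉ D ∧ x ∈ S := by
    intro x hx
    rw [hO] at hx
    grind
  set T := O.filter (fun x => ∃ u, IsElementary W' u ∧ u.support ⊆ O ∧
    u ∉ W ⊔ Finsupp.supported F F (D : Set ι) ∧ x ∈ u.support) with hT
  have hTO : T ⊆ O := filter_subset _ _
  -- elementary vectors of the contraction do not cross `T`
  have hcross : ∀ u, IsElementary W' u → u.support ⊆ O →
      u.support ⊆ T ∨ Disjoint u.support T := by
    intro u hu huO
    by_contra! h
    obtain ⟨x, hxu, hxT⟩ := not_subset.1 h.1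
    obtain ⟨z, hzu, hzT⟩ := not_disjoint_iff.1 h.2
    obtain ⟨-, p, hp, hpO, hpD, hzp⟩ := mem_filter.1 hzT
    obtain ⟨e, he, heP, heQ, hes⟩ := exists_isElementary_notMem_notMem
      (Q := LinearMap.ker (Finsupp.lapply x : (ι →₀ F) →ₗ[F] F)) hp hu hpD
      (by simpa using hxu) (not_disjoint_iff.2 ⟨z, hzp, hzu⟩)
    exact hxT (mem_filter.2 ⟨huO hxu, e, he, hes.trans (union_subset hpO huO), heP,
      by simpa using heQ⟩)
  have hskew : ∀ w ∈ W, w.support ⊆ C ∪ D → w.filter (· ∈ C) ∈ W := by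
    intro w hw hws
    have hmem : w - w.filter (· ∈ C) ∈ W ⊔ Finsupp.supported F F (C : Set ι) := by
      refine mem_sup_supported.2 ⟨w.filter (· ∈ C), filter_mem_support _ _, ?_⟩
      simpa using hw
    obtain ⟨s, hs⟩ := hy.exists_eq_smul hmem (sub_filter_mem_support w hws)
    rw [← W.sub_mem_iff_right hw, hs]
    exact W.smul_mem s hyW
  have hlift : ∀ u, IsElementary W' u → u.support ⊆ O → ∃ z : ι →₀ F,
      z.support ⊆ C ∪ D ∧ u + z ∈ W ∧ (u + z).filter (· ∈ C ∪ T) ∈ W := by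
    intro u hu huO
    have hin : ∀ z : ι →₀ F, (u + z).support ⊆ C ∪ T → u + z ∈ W →
        (u + z).filter (· ∈ C ∪ T) ∈ W := by
      intro z hz hW
      rwa [(Finsupp.filter_eq_self_iff _ _).2]
      exact fun x hx => hz (Finsupp.mem_support_iff.2 hx)
    by_cases huD : u ∈ W ⊔ Finsupp.supported F F (D : Set ι)
    · obtain ⟨z, hz, hzW⟩ := mem_sup_supported.1 huD
      rcases hcross u hu huO with hsub | hdis
      · by_cases huC : u ∈ W ⊔ Finsupp.supported F F (C : Set ι)
        · obtain ⟨z', hz', hzW'⟩ := mem_sup_supported.1 huC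
          refine ⟨z', hz'.trans subset_union_left, hzW', hin z' ?_ hzW'⟩
          exact Finsupp.support_add.trans (union_subset (hsub.trans subset_union_right)
            (hz'.trans subset_union_left))
        · exfalso
          obtain ⟨x, hx⟩ := hu.support_nonempty
          obtain ⟨-, p, hp, hpO, hpD, hxp⟩ := mem_filter.1 (hsub hx)
          obtain ⟨e, he, heP, heQ, hes⟩ := exists_isElementary_notMem_notMem hp hu hpD huC
            (not_disjoint_iff.2 ⟨x, hxp, hx⟩)
          exact heP (hno e he (hes.trans (union_subset hpO huO)) heQ)
      · refine ⟨z, hz.trans subset_union_right, hzW, ?_⟩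
        rw [(Finsupp.filter_eq_zero_iff _ _).2]
        · exact W.zero_mem
        · intro x hx
          by_contra hne
          have hxs := Finsupp.support_add (Finsupp.mem_support_iff.2 hne)
          rcases mem_union.1 hxs with h | h
          · have := hOC x (huO h)
            rcases mem_union.1 hx with h' | h'
            · exact this.1 h'
            · exact disjoint_left.1 hdis h h'
          · have h := hz h
            rcases mem_union.1 hx with h' | h'
            · exact disjoint_left.1 hdisj h' h
            · exact (hOC x (hTO h')).2.1 h
    · have huC : u ∈ W ⊔ Finsupp.supported F F (C : Set ι) := by
        by_contra h
        exact huD (hno u hu huO h)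
      obtain ⟨z, hz, hzW⟩ := mem_sup_supported.1 huC
      refine ⟨z, hz.trans subset_union_left, hzW, hin z ?_ hzW⟩
      refine Finsupp.support_add.trans (union_subset ?_ (hz.trans subset_union_left))
      exact fun x hx => mem_union_right _ (mem_filter.2 ⟨huO hx, u, hu, huO, huD, hx⟩)
  have hsep : ∀ n : ℕ, ∀ w ∈ W, w.support ⊆ S → (w.support ∩ O).card = n →
      w.filter (· ∈ C ∪ T) ∈ W := by
    intro n
    induction n using Nat.strong_induction_on with
    | _ n ih =>
    intro w hw hwS hn
    by_cases hwO : w.support ∩ O = ∅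
    · have hwCD : w.support ⊆ C ∪ D := by
        intro x hx
        by_contra h
        exact notMem_empty x (hwO ▸ mem_inter.2 ⟨hx, mem_sdiff.2 ⟨hwS hx, h⟩⟩)
      convert hskew w hw hwCD using 1
      ext x
      simp only [Finsupp.filter_apply]
      by_cases hxC : x ∈ C
      · simp [hxC]
      · by_cases hxT : x ∈ T
        · have : w x = 0 := by
            by_contra h
            exact notMem_empty x (hwO ▸ mem_inter.2 ⟨Finsupp.mem_support_iff.2 h, hTO hxT⟩)
          simp [this]
        · simp [hxC, hxT]
    · obtain ⟨x₀, hx₀⟩ := nonempty_iff_ne_empty.2 hwO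
      obtain ⟨hx₀w, hx₀O⟩ := mem_inter.1 hx₀
      have hwO' : w.filter (· ∈ O) ∈ W' := by
        rw [hW', sup_assoc, ← Finsupp.supported_union, ← coe_union]
        refine mem_sup_supported.2 ⟨w - w.filter (· ∈ O), ?_, by simpa using hw⟩
        refine sub_filter_mem_support w fun x hx => ?_
        have := hwS hx
        rw [hO]
        grind
      have hne : w.filter (· ∈ O) ∉ (⊥ : Submodule F (ι →₀ F)) := by
        intro h
        have := DFunLike.congr_fun ((Submodule.mem_bot F).1 h) x₀
        rw [Finsupp.filter_apply_pos _ _ hx₀O] at this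
        exact Finsupp.mem_support_iff.1 hx₀w this
      obtain ⟨u, hu, -, hus⟩ := exists_isElementary_notMem hwO' hne
      have huO : u.support ⊆ O := hus.trans (filter_mem_support _ _)
      have huw : u.support ⊆ w.support := hus.trans (by
        rw [Finsupp.support_filter]; exact filter_subset _ _)
      obtain ⟨z, hz, hzW, hzf⟩ := hlift u hu huO
      obtain ⟨x, hx⟩ := hu.support_nonempty
      have hzO : ∀ a ∈ O, z a = 0 := by
        intro a ha
        by_contra h
        have := hz (Finsupp.mem_support_iff.2 h)
        have := hOC a ha
        grind
      set t := w x / u x with ht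
      have hrec : (w - t • (u + z)).filter (· ∈ C ∪ T) ∈ W := by
        refine ih _ ?_ _ (W.sub_mem hw (W.smul_mem t hzW)) ?_ rfl
        · rw [← hn]
          refine card_lt_card (ssubset_of_subset_of_ne ?_ ?_)
          · intro a ha
            obtain ⟨ha, haO⟩ := mem_inter.1 ha
            refine mem_inter.2 ⟨?_, haO⟩
            rcases mem_union.1 (support_sub_smul_subset _ _ _ ha) with h | h
            · exact h
            · refine huw (Finsupp.mem_support_iff.2 ?_)
              simpa [hzO a haO] using h
          · intro h
            have hx' : x ∈ (w - t • (u + z)).support ∩ O := by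
              rw [h]
              exact mem_inter.2 ⟨huw hx, huO hx⟩
            have := (mem_inter.1 hx').1
            simp [ht, hzO x (huO hx), Finsupp.mem_support_iff.1 hx] at this
        · refine (support_sub_smul_subset _ _ _).trans (union_subset hwS ?_)
          exact Finsupp.support_add.trans (union_subset (huw.trans hwS)
            (hz.trans (union_subset hcS hyS)))
      rw [Finsupp.filter_sub, Finsupp.filter_smul] at hrec
      exact (W.sub_mem_iff_left (W.smul_mem t hzf)).1 hrec
  have hsub : C ∪ T ⊆ S := union_subset hcS fun x hx => (hOC x (hTO hx)).2.2
  obtain ⟨a, ha⟩ := hc.support_nonempty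
  obtain ⟨b, hb⟩ := hy.support_nonempty
  rcases hconn (C ∪ T) hsub (fun w hw hwS => hsep _ w hw hwS rfl) with h | h
  · exact notMem_empty a (h ▸ mem_union_left _ ha)
  · have hb' : b ∈ C ∪ T := h ▸ hyS hb
    rcases mem_union.1 hb' with h' | h'
    · exact disjoint_left.1 hdisj h' hb
    · exact (hOC b (hTO h')).2.1 hb

/-- Contracting a largest circuit of an inseparable set decreases the maximal size of circuits. -/
lemma IsElementary.card_lt_of_contract {W : Submodule F (ι →₀ F)} {S : Finset ι}
    (hconn : ∀ T ⊆ S, (∀ w ∈ W, w.support ⊆ S → w.filter (· ∈ T) ∈ W) → T = ∅ ∨ T = S)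
    {c y : ι →₀ F} (hc : IsElementary W c) (hcS : c.support ⊆ S)
    (hmax : ∀ u, IsElementary W u → u.support ⊆ S → u.support.card ≤ c.support.card)
    (hy : IsElementary (W ⊔ Finsupp.supported F F (c.support : Set ι)) y)
    (hyS : y.support ⊆ S) (hdisj : Disjoint c.support y.support) :
    y.support.card < c.support.card := by
  have hsub : ∀ {g a b : ι →₀ F}, (g - a).support ⊆ b.support →
      g.support ⊆ a.support ∪ b.support := by
    intro g a b h
    have : g.support ⊆ a.support ∪ (g - a).support := by
      simpa using Finsupp.support_add (g₁ := a) (g₂ := g - a)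
    exact this.trans (union_subset_union Subset.rfl h)
  have hcpos := hc.support_nonempty.card_pos
  by_cases hyW : y ∈ W
  · obtain ⟨u, hu, huS, huC, huD⟩ :=
      exists_isElementary_attached hconn hc hcS hy hyS hdisj hyW
    have huS' : u.support ⊆ S := huS.trans sdiff_subset
    have hdisjO : Disjoint u.support (c.support ∪ y.support) :=
      disjoint_sdiff_self_left.mono_left huS
    rw [disjoint_union_right] at hdisjO
    obtain ⟨g, hg, hgu, hgcard⟩ := hy.exists_extend hu hdisjO.2.symm huC
    have hgs := hsub hgu
    have hgW : g ∉ W := by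
      intro h
      refine huD (mem_sup_supported.2 ⟨g - u, hgu, by simpa using h⟩)
    obtain ⟨k, hk, hkg, hkcard⟩ := hc.exists_extend hg
      ((disjoint_union_right.2 ⟨hdisjO.1.symm, hdisj⟩).mono_right hgs) hgW
    have hks := hsub hkg
    have := hmax k hk (hks.trans (union_subset (hgs.trans (union_subset huS' hyS)) hcS))
    have := hu.support_nonempty.card_pos
    omega
  · obtain ⟨g, hg, hgy, hgcard⟩ := hc.exists_extend hy hdisj hyW
    have := hmax g hg ((hsub hgy).trans (union_subset hyS hcS))
    omega

/-- A circuit of a contraction extends to a circuit. -/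
lemma IsElementary.exists_lift {W : Submodule F (ι →₀ F)} {T : Finset ι} {u : ι →₀ F}
    (hu : IsElementary (W ⊔ Finsupp.supported F F (T : Set ι)) u)
    (hdisj : Disjoint u.support T) :
    ∃ y, IsElementary W y ∧ u.support ⊆ y.support ∧ y.support ⊆ u.support ∪ T := by
  obtain ⟨z, hz, hw⟩ := mem_sup_supported.1 hu.1
  obtain ⟨x, hx⟩ := hu.support_nonempty
  have hzx : z x = 0 := by
    by_contra h
    exact disjoint_left.1 hdisj hx (hz (Finsupp.mem_support_iff.2 h))
  obtain ⟨y, hy, hyx, hys⟩ := exists_isElementary_notMem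
    (P := LinearMap.ker (Finsupp.lapply x : (ι →₀ F) →ₗ[F] F)) hw
    (by simpa [hzx] using hx)
  have hys' : y.support ⊆ u.support ∪ T :=
    hys.trans (Finsupp.support_add.trans (union_subset_union Subset.rfl hz))
  refine ⟨y, hy, ?_, hys'⟩
  have hxT : x ∉ T := disjoint_left.1 hdisj hx
  have hmem : y - y.filter (· ∈ T) ∈ W ⊔ Finsupp.supported F F (T : Set ι) :=
    mem_sup_supported.2 ⟨y.filter (· ∈ T), filter_mem_support _ _, by simpa using hy.1⟩
  have hne : y - y.filter (· ∈ T) ≠ 0 := by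
    intro h
    have := DFunLike.congr_fun h x
    simp [hxT] at this
    exact hyx (by simpa using this)
  rw [← hu.2.2 _ hmem hne (sub_filter_mem_support y (by rwa [union_comm]))]
  intro a ha
  rw [Finsupp.mem_support_iff] at ha ⊢
  by_cases haT : a ∈ T
  · simp [haT] at ha
  · simpa [haT] using ha

end Elementary

section Contraction

variable {F ι E : Type*} [Field F] [AddCommGroup E] [Module F E]

/-- The cycles relative to `X`: combinations of the vectors `b i` that lie in the span of the
`b x`, `x ∈ X`. -/
noncomputable def relCycles (b : ι → E) (X : Finset ι) : Submodule F (ι →₀ F) :=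
  (Submodule.span F (b '' (X : Set ι))).comap (Finsupp.linearCombination F b)

lemma mem_relCycles {b : ι → E} {X : Finset ι} {w : ι →₀ F} :
    w ∈ relCycles b X ↔
      Finsupp.linearCombination F b w ∈ Submodule.span F (b '' (X : Set ι)) :=
  Iff.rfl

lemma mem_span_image_iff_exists_support {b : ι → E} {X : Finset ι} {v : E} :
    v ∈ Submodule.span F (b '' (X : Set ι)) ↔
      ∃ z : ι →₀ F, z.support ⊆ X ∧ Finsupp.linearCombination F b z = v := by
  simp [Finsupp.mem_span_image_iff_linearCombination, Finsupp.mem_supported]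

variable [DecidableEq ι]

lemma relCycles_union (b : ι → E) (X Y : Finset ι) :
    relCycles (F := F) b (X ∪ Y) =
      relCycles b X ⊔ Finsupp.supported F F (Y : Set ι) := by
  ext w
  rw [mem_sup_supported, mem_relCycles, coe_union, Set.image_union, Submodule.span_union,
    Submodule.mem_sup]
  simp only [mem_relCycles, map_add]
  constructor
  · rintro ⟨p, hp, q, hq, h⟩
    obtain ⟨z, hz, rfl⟩ := mem_span_image_iff_exists_support.1 hq
    refine ⟨-z, by simpa using hz, ?_⟩
    rw [← h]
    simpa using hp
  · rintro ⟨z, hz, h⟩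
    refine ⟨_, h, -Finsupp.linearCombination F b z, ?_, by simp⟩
    exact Submodule.neg_mem _ (mem_span_image_iff_exists_support.2 ⟨z, hz, rfl⟩)

lemma finrank_span_union_add_le {b : ι → E} {X S T : Finset ι} (hT : T ⊆ S)
    (h : ∀ w ∈ relCycles (F := F) b X, w.support ⊆ S → w.filter (· ∈ T) ∈ relCycles b X) :
    Module.finrank F (Submodule.span F (b '' ((X ∪ T : Finset ι) : Set ι))) +
      Module.finrank F (Submodule.span F (b '' ((X ∪ (S \ T) : Finset ι) : Set ι))) ≤
    Module.finrank F (Submodule.span F (b '' ((X ∪ S : Finset ι) : Set ι))) +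
      Module.finrank F (Submodule.span F (b '' (X : Set ι))) := by
  have hfin : ∀ Y : Finset ι, FiniteDimensional F (Submodule.span F (b '' (Y : Set ι))) :=
    fun Y => FiniteDimensional.span_of_finite F (Y.finite_toSet.image b)
  have := hfin (X ∪ T)
  have := hfin (X ∪ (S \ T))
  have := hfin (X ∪ S)
  have := hfin X
  rw [← Submodule.finrank_sup_add_finrank_inf_eq]
  refine add_le_add (Submodule.finrank_mono ?_) (Submodule.finrank_mono ?_)
  · rw [← Submodule.span_union, ← Set.image_union, ← coe_union]
    refine Submodule.span_mono (Set.image_mono ?_)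
    rw [coe_subset]
    exact union_subset (union_subset_union Subset.rfl hT)
      (union_subset_union Subset.rfl sdiff_subset)
  · rintro v ⟨hv₁, hv₂⟩
    simp only [SetLike.mem_coe, coe_union, Set.image_union, Submodule.span_union,
      Submodule.mem_sup] at hv₁ hv₂
    obtain ⟨p, hp, p', hp', rfl⟩ := hv₁
    obtain ⟨q, hq, q', hq', hpq⟩ := hv₂
    obtain ⟨z, hz, rfl⟩ := mem_span_image_iff_exists_support.1 hp'
    obtain ⟨z', hz', rfl⟩ := mem_span_image_iff_exists_support.1 hq'
    refine Submodule.add_mem _ hp ?_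
    have hzz : z - z' ∈ relCycles b X := by
      rw [mem_relCycles, map_sub]
      have : Finsupp.linearCombination F b z - Finsupp.linearCombination F b z' = q - p := by
        rw [sub_eq_sub_iff_add_eq_add, add_comm, ← hpq]
      rw [this]
      exact Submodule.sub_mem _ hq hp
    have hf := h _ hzz (Finsupp.support_sub.trans
      (union_subset (hz.trans hT) (hz'.trans sdiff_subset)))
    have hfz : (z - z').filter (· ∈ T) = z := by
      ext x
      by_cases hx : x ∈ T
      · have : z' x = 0 := by
          by_contra hne
          exact (mem_sdiff.1 (hz' (Finsupp.mem_support_iff.2 hne))).2 hx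
        simp [hx, this]
      · have : z x = 0 := by
          by_contra hne
          exact hx (hz (Finsupp.mem_support_iff.2 hne))
        simp [hx, this]
    rw [hfz] at hf
    exact hf

lemma exists_relative_basis (b : ι → E) (X S : Finset ι) :
    ∃ B ⊆ S, Module.finrank F (Submodule.span F (b '' (X : Set ι))) + B.card =
        Module.finrank F (Submodule.span F (b '' ((X ∪ S : Finset ι) : Set ι))) ∧
      ∀ σ ∈ S, b σ ∈ Submodule.span F (b '' ((X ∪ B : Finset ι) : Set ι)) := by
  suffices h : ∃ B ⊆ S, Module.finrank F (Submodule.span F (b '' (X : Set ι))) + B.card =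
        Module.finrank F (Submodule.span F (b '' ((X ∪ S : Finset ι) : Set ι))) ∧
      Submodule.span F (b '' ((X ∪ B : Finset ι) : Set ι)) =
        Submodule.span F (b '' ((X ∪ S : Finset ι) : Set ι)) by
    obtain ⟨B, hB, hr, hs⟩ := h
    refine ⟨B, hB, hr, fun σ hσ => ?_⟩
    rw [hs]
    exact Submodule.subset_span ⟨σ, by simp [hσ], rfl⟩
  have hins : ∀ (Y : Finset ι) (s : ι),
      Submodule.span F (b '' ((X ∪ insert s Y : Finset ι) : Set ι)) =
        Submodule.span F (b '' ((X ∪ Y : Finset ι) : Set ι)) ⊔ Submodule.span F {b s} := by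
    intro Y s
    rw [union_insert, coe_insert, Set.image_insert_eq, Submodule.span_insert, sup_comm]
  induction S using Finset.induction_on with
  | empty => exact ⟨∅, Subset.rfl, by rw [card_empty, add_zero, union_empty], rfl⟩
  | insert s S hs ih =>
    obtain ⟨B, hB, hr, hsp⟩ := ih
    by_cases hmem : b s ∈ Submodule.span F (b '' ((X ∪ S : Finset ι) : Set ι))
    · have heq : Submodule.span F (b '' ((X ∪ insert s S : Finset ι) : Set ι)) =
          Submodule.span F (b '' ((X ∪ S : Finset ι) : Set ι)) := by
        rw [hins, sup_eq_left, Submodule.span_singleton_le_iff_mem]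
        exact hmem
      exact ⟨B, hB.trans (subset_insert _ _), by rw [heq]; exact hr, by rw [heq]; exact hsp⟩
    · refine ⟨insert s B, insert_subset_insert _ hB, ?_, by rw [hins, hins, hsp]⟩
      have hs0 : b s ≠ 0 := fun h => hmem (h ▸ Submodule.zero_mem _)
      have : FiniteDimensional F (Submodule.span F (b '' ((X ∪ S : Finset ι) : Set ι))) :=
        FiniteDimensional.span_of_finite F ((X ∪ S).finite_toSet.image b)
      have hdim := Submodule.finrank_sup_add_finrank_inf_eq
        (Submodule.span F (b '' ((X ∪ S : Finset ι) : Set ι))) (Submodule.span F {b s})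
      rw [((Submodule.disjoint_span_singleton' hs0).2 hmem).eq_bot, finrank_bot,
        finrank_span_singleton hs0] at hdim
      rw [hins, card_insert_of_notMem (fun h => hs (hB h))]
      omega

end Contraction

section Faces

variable {F ι φ : Type*} [Field F]

lemma exists_mem_support_of_mem_span {b : ι → φ →₀ F} {X : Finset ι} {v : φ →₀ F}
    (hv : v ∈ Submodule.span F (b '' (X : Set ι))) {f : φ} (hf : f ∈ v.support) :
    ∃ σ ∈ X, f ∈ (b σ).support := by
  by_contra! h
  have hle : Submodule.span F (b '' (X : Set ι)) ≤
      LinearMap.ker (Finsupp.lapply f : (φ →₀ F) →ₗ[F] F) := by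
    rw [Submodule.span_le]
    rintro _ ⟨σ, hσ, rfl⟩
    simpa using h σ hσ
  exact Finsupp.mem_support_iff.1 hf (by simpa using hle hv)

variable [DecidableEq φ]

/-- In a relative cycle every face outside the contracted part is covered at least twice. -/
lemma two_mul_card_faces_sdiff_le {b : ι → φ →₀ F} {X : Finset ι} {Φ : Finset φ} {d : ℕ}
    (hX : ∀ σ ∈ X, (b σ).support ⊆ Φ) {c : ι →₀ F} (hc : c ∈ relCycles b X)
    (hcard : ∀ σ ∈ c.support, (b σ).support.card = d + 1) :
    2 * (c.support.biUnion (fun σ => (b σ).support) \ Φ).card ≤ (d + 1) * c.support.card := by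
  have h := card_mul_le_card_mul (fun (f : φ) (σ : ι) => f ∈ (b σ).support)
    (s := c.support.biUnion (fun σ => (b σ).support) \ Φ) (t := c.support) (m := 2) (n := d + 1)
    ?_ ?_
  · linarith
  · intro f hf
    obtain ⟨hf, hfΦ⟩ := mem_sdiff.1 hf
    obtain ⟨σ, hσ, hfσ⟩ := mem_biUnion.1 hf
    by_contra! hlt
    have hone : ∀ τ ∈ c.support, f ∈ (b τ).support → τ = σ := by
      intro τ hτ hfτ
      exact card_le_one.1 (Nat.lt_succ_iff.1 hlt) τ
        ((mem_bipartiteAbove _).2 ⟨hτ, hfτ⟩) σ ((mem_bipartiteAbove _).2 ⟨hσ, hfσ⟩)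
    have hval : Finsupp.linearCombination F b c f = c σ * b σ f := by
      rw [Finsupp.linearCombination_apply, Finsupp.sum, Finsupp.finsetSum_apply,
        sum_eq_single_of_mem σ hσ]
      · simp
      · intro τ hτ hne
        have : b τ f = 0 := by
          by_contra h0
          exact hne (hone τ hτ (Finsupp.mem_support_iff.2 h0))
        simp [this]
    obtain ⟨τ, hτ, hfτ⟩ := exists_mem_support_of_mem_span (mem_relCycles.1 hc) (f := f) (by
      rw [Finsupp.mem_support_iff, hval]
      exact mul_ne_zero (Finsupp.mem_support_iff.1 hσ) (Finsupp.mem_support_iff.1 hfσ))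
    exact hfΦ (hX τ hτ hfτ)
  · intro σ hσ
    rw [← hcard σ hσ]
    exact card_le_card fun f hf => ((mem_bipartiteBelow _).1 hf).2

/-- A face lies in few simplices of a family whose faces all belong to a given set. -/
lemma mul_card_star_le {b : ι → φ →₀ F} {S : Finset ι} {Ψ : Finset φ} {d : ℕ}
    (hcard : ∀ σ ∈ S, (b σ).support.card = d + 1)
    (hshare : ∀ σ ∈ S, ∀ τ ∈ S, σ ≠ τ → ((b σ).support ∩ (b τ).support).card ≤ 1)
    (hS : ∀ σ ∈ S, (b σ).support ⊆ Ψ) (f : φ) :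
    d * (S.filter (fun σ => f ∈ (b σ).support)).card ≤ Ψ.card := by
  have hdisj : ((S.filter (fun σ => f ∈ (b σ).support) : Finset ι) : Set ι).PairwiseDisjoint
      (fun σ => (b σ).support.erase f) := by
    intro σ hσ τ hτ hne
    obtain ⟨hσ, hfσ⟩ := mem_filter.1 (mem_coe.1 hσ)
    obtain ⟨hτ, hfτ⟩ := mem_filter.1 (mem_coe.1 hτ)
    refine disjoint_left.2 fun g hg hg' => (mem_erase.1 hg).1 ?_
    exact card_le_one.1 (hshare σ hσ τ hτ hne) g
      (mem_inter.2 ⟨(mem_erase.1 hg).2, (mem_erase.1 hg').2⟩) f (mem_inter.2 ⟨hfσ, hfτ⟩)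
  have hcount := card_biUnion hdisj
  rw [sum_congr rfl (g := fun _ => d) (fun σ hσ => by
    obtain ⟨hσ, hfσ⟩ := mem_filter.1 hσ
    rw [card_erase_of_mem hfσ, hcard σ hσ, Nat.add_sub_cancel]), sum_const, smul_eq_mul,
    mul_comm] at hcount
  rw [← hcount]
  refine card_le_card (biUnion_subset.2 fun σ hσ => ?_)
  exact (erase_subset _ _).trans (hS σ (mem_filter.1 hσ).1)

variable [DecidableEq ι]

/-- A set whose members have all faces in `Ψ`, but not all in the set `Φ` of faces of `X`, has
bounded density over `X`. -/
lemma mul_card_le_of_faces_subset {b : ι → φ →₀ F} {X S : Finset ι} {Φ Ψ : Finset φ} {d : ℕ}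
    (hcard : ∀ σ ∈ S, (b σ).support.card = d + 1)
    (hshare : ∀ σ ∈ S, ∀ τ ∈ S, σ ≠ τ → ((b σ).support ∩ (b τ).support).card ≤ 1)
    (hX : ∀ σ ∈ X, (b σ).support ⊆ Φ) (hSΦ : ∀ σ ∈ S, ¬ (b σ).support ⊆ Φ)
    (hSΨ : ∀ σ ∈ S, (b σ).support ⊆ Ψ) {B : Finset ι} (hB : B ⊆ S)
    (hspan : ∀ σ ∈ S, b σ ∈ Submodule.span F (b '' ((X ∪ B : Finset ι) : Set ι))) :
    d * S.card ≤ B.card * (d + 1) * Ψ.card := by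
  set G := B.biUnion (fun σ => (b σ).support) with hG
  have hcov : S ⊆ G.biUnion (fun f => S.filter (fun σ => f ∈ (b σ).support)) := by
    intro σ hσ
    obtain ⟨f, hf, hfΦ⟩ := not_subset.1 (hSΦ σ hσ)
    obtain ⟨τ, hτ, hfτ⟩ := exists_mem_support_of_mem_span (hspan σ hσ) hf
    refine mem_biUnion.2 ⟨f, mem_biUnion.2 ⟨τ, ?_, hfτ⟩, mem_filter.2 ⟨hσ, hf⟩⟩
    exact (mem_union.1 hτ).resolve_left fun h => hfΦ (hX τ h hfτ)
  calc d * S.card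
      ≤ d * ∑ f ∈ G, (S.filter (fun σ => f ∈ (b σ).support)).card :=
        Nat.mul_le_mul_left _ ((card_le_card hcov).trans card_biUnion_le)
    _ = ∑ f ∈ G, d * (S.filter (fun σ => f ∈ (b σ).support)).card := mul_sum _ _ _
    _ ≤ ∑ _f ∈ G, Ψ.card := sum_le_sum fun f _ => mul_card_star_le hcard hshare hSΨ f
    _ = G.card * Ψ.card := by rw [sum_const, smul_eq_mul]
    _ ≤ B.card * (d + 1) * Ψ.card := Nat.mul_le_mul_right _
        (card_biUnion_le_card_mul _ _ _ fun σ hσ => (hcard σ (hB hσ)).le)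

/-- The density of `S` over `X` is bounded in terms of the size of circuits.  By induction on that
size: contracting a largest circuit of a minimal dense subset, together with all members whose
faces are then already present, leaves a dense set with shorter circuits. -/
lemma card_le_mul_relative_rank {b : ι → φ →₀ F} {K : Finset ι} {d m : ℕ} (hd : 1 ≤ d)
    (hcard : ∀ σ ∈ K, (b σ).support.card = d + 1)
    (hshare : ∀ σ ∈ K, ∀ τ ∈ K, σ ≠ τ → ((b σ).support ∩ (b τ).support).card ≤ 1)
    (k : ℕ) : ∀ (X S : Finset ι) (Φ : Finset φ), S ⊆ K → S.Nonempty →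
    (∀ σ ∈ X, (b σ).support ⊆ Φ) → (∀ σ ∈ S, ¬ (b σ).support ⊆ Φ) →
    (∀ u, IsElementary (relCycles (F := F) b X) u → u.support ⊆ S → u.support.card ≤ k) →
    4 * Φ.card + (d + 1) * (k * (k + 1)) ≤ (d + 1) * (m * (m + 1)) →
    S.card + d * (m + 1) ^ 2 * Module.finrank F (Submodule.span F (b '' (X : Set ι))) ≤
      d * (m + 1) ^ 2 *
        Module.finrank F (Submodule.span F (b '' ((X ∪ S : Finset ι) : Set ι))) := by
  classical
  induction k using Nat.strong_induction_on with
  | _ k ih =>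
  intro X S₀ Φ hS₀K hS₀ne hX hS₀Φ hk₀ hΦ
  set r : Finset ι → ℕ :=
    fun Y => Module.finrank F (Submodule.span F (b '' (Y : Set ι))) with hr
  set δ := d * (m + 1) ^ 2 with hδ
  by_contra hdense₀
  change ¬ (S₀.card + δ * r X ≤ δ * r (X ∪ S₀)) at hdense₀
  -- a minimal dense subset
  obtain ⟨S, hSmem, hSmin⟩ := exists_min_image
    (S₀.powerset.filter fun S => S.Nonempty ∧ δ * r (X ∪ S) < S.card + δ * r X) card
    ⟨S₀, mem_filter.2 ⟨mem_powerset_self _, hS₀ne, not_le.1 hdense₀⟩⟩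
  obtain ⟨hSS₀, hSne, hdense⟩ := mem_filter.1 hSmem
  rw [mem_powerset] at hSS₀
  have hmin : ∀ T ⊂ S, T.Nonempty → T.card + δ * r X ≤ δ * r (X ∪ T) := by
    intro T hT hTne
    by_contra! h
    exact (card_lt_card hT).not_ge
      (hSmin T (mem_filter.2 ⟨mem_powerset.2 (hT.subset.trans hSS₀), hTne, h⟩))
  have hSK : S ⊆ K := hSS₀.trans hS₀K
  have hSΦ : ∀ σ ∈ S, ¬ (b σ).support ⊆ Φ := fun σ hσ => hS₀Φ σ (hSS₀ hσ)
  have hk : ∀ u, IsElementary (relCycles b X) u → u.support ⊆ S → u.support.card ≤ k :=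
    fun u hu hus => hk₀ u hu (hus.trans hSS₀)
  have hconn : ∀ T ⊆ S, (∀ w ∈ relCycles (F := F) b X, w.support ⊆ S →
      w.filter (· ∈ T) ∈ relCycles b X) → T = ∅ ∨ T = S := by
    intro T hT hsep
    by_contra! hne
    have h₁ := hmin T (hT.ssubset_of_ne hne.2) hne.1
    have h₂ := hmin (S \ T) (sdiff_ssubset hT hne.1)
      (sdiff_nonempty.2 fun h => hne.2 (hT.antisymm h))
    have h₃ : r (X ∪ T) + r (X ∪ (S \ T)) ≤ r (X ∪ S) + r X := finrank_span_union_add_le hT hsep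
    have h₄ := card_sdiff_add_card_eq_card hT
    have h₅ := Nat.mul_le_mul_left δ h₃
    rw [mul_add, mul_add] at h₅
    omega
  obtain ⟨B, hBS, hBr, hBspan⟩ := exists_relative_basis (F := F) b X S
  change r X + B.card = r (X ∪ S) at hBr
  have hδ1 : 1 ≤ δ := Nat.mul_pos hd (by positivity)
  have hdenseB : δ * B.card < S.card := by
    rw [← hBr, mul_add] at hdense
    omega
  -- a largest circuit
  have hexists : ∃ u, IsElementary (relCycles (F := F) b X) u ∧ u.support ⊆ S := by
    have hBlt : B.card < S.card := lt_of_le_of_lt (Nat.le_mul_of_pos_left _ hδ1) hdenseB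
    obtain ⟨s, hs, hsB⟩ := exists_mem_notMem_of_card_lt_card hBlt
    have hsingle : Finsupp.single s (1 : F) ∈
        relCycles b X ⊔ Finsupp.supported F F (B : Set ι) := by
      rw [← relCycles_union, mem_relCycles]
      simpa using hBspan s hs
    obtain ⟨z, hz, hzW⟩ := mem_sup_supported.1 hsingle
    have hne : Finsupp.single s (1 : F) + z ∉ (⊥ : Submodule F (ι →₀ F)) := by
      intro h
      have hzs : z s = 0 := by
        by_contra h0
        exact hsB (hz (Finsupp.mem_support_iff.2 h0))
      have := DFunLike.congr_fun ((Submodule.mem_bot F).1 h) s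
      simp [hzs] at this
    obtain ⟨u, hu, -, hus⟩ := exists_isElementary_notMem hzW hne
    refine ⟨u, hu, hus.trans (Finsupp.support_add.trans (union_subset ?_ (hz.trans hBS)))⟩
    exact Finsupp.support_single_subset.trans (singleton_subset_iff.2 hs)
  obtain ⟨c, ⟨hc, hcS⟩, hcmax⟩ : ∃ c, (IsElementary (relCycles (F := F) b X) c ∧
      c.support ⊆ S) ∧ ∀ u, IsElementary (relCycles b X) u → u.support ⊆ S →
      u.support.card ≤ c.support.card := by
    obtain ⟨s, hs, hsmax⟩ := exists_max_image (S.powerset.filter fun s =>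
      ∃ u, IsElementary (relCycles (F := F) b X) u ∧ u.support = s) card (by
        obtain ⟨u, hu, hus⟩ := hexists
        exact ⟨u.support, mem_filter.2 ⟨mem_powerset.2 hus, u, hu, rfl⟩⟩)
    obtain ⟨hsS, c, hc, rfl⟩ := mem_filter.1 hs
    exact ⟨c, ⟨hc, mem_powerset.1 hsS⟩, fun u hu hus =>
      hsmax _ (mem_filter.2 ⟨mem_powerset.2 hus, u, hu, rfl⟩)⟩
  have hck := hk c hc hcS
  have hcpos := hc.support_nonempty.card_pos
  set Ψ := Φ ∪ c.support.biUnion (fun σ => (b σ).support) with hΨ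
  have hΨcard : 2 * Ψ.card ≤ 2 * Φ.card + (d + 1) * c.support.card := by
    have h := two_mul_card_faces_sdiff_le hX hc.1 (fun σ hσ => hcard σ (hSK (hcS hσ)))
    rw [hΨ, ← union_sdiff_self_eq_union, card_union_of_disjoint disjoint_sdiff]
    omega
  obtain ⟨j, hj⟩ : ∃ j, c.support.card = j + 1 := ⟨_, (Nat.succ_pred_eq_of_pos hcpos).symm⟩
  have hΨm : 4 * Ψ.card + (d + 1) * (j * (j + 1)) ≤ (d + 1) * (m * (m + 1)) := by
    have h₁ : (j + 1) * (j + 2) ≤ k * (k + 1) := Nat.mul_le_mul (by omega) (by omega)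
    have h₂ := Nat.mul_le_mul_left (d + 1) h₁
    rw [hj] at hΨcard
    nlinarith
  set T := S.filter (fun σ => (b σ).support ⊆ Ψ) with hT
  have hTS : T ⊆ S := filter_subset _ _
  have hcT : c.support ⊆ T := by
    intro σ hσ
    refine mem_filter.2 ⟨hcS hσ, Subset.trans ?_ subset_union_right⟩
    exact subset_biUnion_of_mem (fun σ => (b σ).support) hσ
  by_cases hTeq : T = S
  · have hSΨ : ∀ σ ∈ S, (b σ).support ⊆ Ψ := fun σ hσ => by
      rw [← hTeq] at hσ
      exact (mem_filter.1 hσ).2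
    have hcount := mul_card_le_of_faces_subset (fun σ hσ => hcard σ (hSK hσ))
      (fun σ hσ τ hτ => hshare σ (hSK hσ) τ (hSK hτ)) hX hSΦ hSΨ hBS hBspan
    have h₁ : 4 * Ψ.card ≤ (d + 1) * (m * (m + 1)) := le_trans (Nat.le_add_right _ _) hΨm
    have h₂ : (d + 1) * (d + 1) * (m * (m + 1)) ≤ 4 * d * δ := by
      have h₃ : (d + 1) * (d + 1) ≤ 4 * d * d := by nlinarith
      have h₄ : m * (m + 1) ≤ (m + 1) ^ 2 := by nlinarith
      calc _ ≤ 4 * d * d * (m + 1) ^ 2 := Nat.mul_le_mul h₃ h₄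
        _ = 4 * d * δ := by rw [hδ]; ring
    have h₅ : 4 * d * S.card ≤ 4 * d * (δ * B.card) := by
      calc 4 * d * S.card = 4 * (d * S.card) := by ring
        _ ≤ 4 * (B.card * (d + 1) * Ψ.card) := Nat.mul_le_mul_left _ hcount
        _ = B.card * (d + 1) * (4 * Ψ.card) := by ring
        _ ≤ B.card * (d + 1) * ((d + 1) * (m * (m + 1))) := Nat.mul_le_mul_left _ h₁
        _ = B.card * ((d + 1) * (d + 1) * (m * (m + 1))) := by ring
        _ ≤ B.card * (4 * d * δ) := Nat.mul_le_mul_left _ h₂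
        _ = 4 * d * (δ * B.card) := by ring
    exact hdenseB.not_ge (Nat.le_of_mul_le_mul_left h₅ (by omega))
  · have hTmin := hmin T (hTS.ssubset_of_ne hTeq) (hc.support_nonempty.mono hcT)
    have hunion : X ∪ T ∪ (S \ T) = X ∪ S := by
      rw [union_assoc, union_sdiff_of_subset hTS]
    have hstep := ih j (by omega) (X ∪ T) (S \ T) Ψ (sdiff_subset.trans hSK)
      (sdiff_nonempty.2 fun h => hTeq (hTS.antisymm h)) ?_ ?_ ?_ hΨm
    · rw [hunion] at hstep
      change (S \ T).card + δ * r (X ∪ T) ≤ δ * r (X ∪ S) at hstep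
      have := card_sdiff_add_card_eq_card hTS
      omega
    · intro σ hσ
      rcases mem_union.1 hσ with h | h
      · exact (hX σ h).trans subset_union_left
      · exact (mem_filter.1 h).2
    · intro σ hσ h
      obtain ⟨hσS, hσT⟩ := mem_sdiff.1 hσ
      exact hσT (mem_filter.2 ⟨hσS, h⟩)
    · intro u hu hus
      have huT : Disjoint u.support T := disjoint_sdiff_self_left.mono_left hus
      have hrel : relCycles (F := F) b (X ∪ T) =
          relCycles b X ⊔ Finsupp.supported F F (c.support : Set ι) ⊔
            Finsupp.supported F F (T : Set ι) := by
        rw [← relCycles_union, ← relCycles_union, union_assoc, union_eq_right.2 hcT]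
      rw [hrel] at hu
      obtain ⟨y, hy, huy, hyu⟩ := hu.exists_lift huT
      have hdisj : Disjoint c.support y.support := by
        rw [disjoint_left]
        intro x hxc hxy
        have hxW : Finsupp.single x (1 : F) ∈
            relCycles b X ⊔ Finsupp.supported F F (c.support : Set ι) :=
          Submodule.mem_sup_right (Finsupp.single_mem_supported F 1 hxc)
        have hsupp : (Finsupp.single x (1 : F)).support = {x} :=
          Finsupp.support_single x one_ne_zero
        have hyx := hy.2.2 _ hxW (by simp) (by rw [hsupp]; exact singleton_subset_iff.2 hxy)
        rw [hsupp] at hyx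
        obtain ⟨z, hz⟩ := hu.support_nonempty
        have hzx := huy hz
        rw [← hyx, mem_singleton] at hzx
        exact disjoint_left.1 huT hz (hzx ▸ hcT hxc)
      have hlt := hc.card_lt_of_contract hconn hcS hcmax hy
        (hyu.trans (union_subset (hus.trans sdiff_subset) hTS)) hdisj
      have := card_le_card huy
      omega

end Faces

section Simplices

variable {F : Type} [Field F] {V : Type} [LinearOrder V]

lemma erase_injOn_self (σ : Finset V) : Set.InjOn σ.erase (σ : Set V) :=
  fun _ hv _ _ h => (erase_inj σ hv).1 h

lemma support_sbdry (σ : Finset V) : (sbdry F σ).support = σ.image σ.erase := by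
  ext f
  rw [Finsupp.mem_support_iff, sbdry, Finsupp.finsetSum_apply, mem_image]
  constructor
  · intro h
    by_contra! hne
    exact h (sum_eq_zero fun v hv => by simp [hne v hv])
  · rintro ⟨v, hv, rfl⟩
    rw [sum_eq_single_of_mem v hv]
    · simp
    · intro w hw hne
      have : σ.erase w ≠ σ.erase v := fun h => hne (erase_injOn_self σ hw hv h)
      simp [this]

lemma card_support_sbdry (σ : Finset V) : (sbdry F σ).support.card = σ.card := by
  rw [support_sbdry, card_image_of_injOn (erase_injOn_self σ)]

lemma card_support_sbdry_inter_le {σ τ : Finset V} (hcard : σ.card = τ.card) (hne : σ ≠ τ) :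
    ((sbdry F σ).support ∩ (sbdry F τ).support).card ≤ 1 := by
  rw [card_le_one]
  intro f hf g hg
  rw [support_sbdry, support_sbdry, mem_inter, mem_image, mem_image] at hf hg
  obtain ⟨⟨a, ha, rfl⟩, a', ha', haa⟩ := hf
  obtain ⟨⟨e, he, rfl⟩, e', he', hee⟩ := hg
  by_contra hfg
  have hae : a ≠ e := by
    rintro rfl
    exact hfg rfl
  refine hne (eq_of_subset_of_card_le (fun x hx => ?_) hcard.ge)
  by_cases hxa : x = a
  · have : x ∈ σ.erase e := mem_erase.2 ⟨hxa ▸ hae, hx⟩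
    rw [← hee] at this
    exact mem_of_mem_erase this
  · have : x ∈ σ.erase a := mem_erase.2 ⟨hxa, hx⟩
    rw [← haa] at this
    exact mem_of_mem_erase this

lemma isCycle_iff_mem_relCycles {d : ℕ} {c : Finset V →₀ F}
    (hc : ∀ σ ∈ c.support, σ.card = d + 1) :
    IsCycle F d c ↔ c ∈ relCycles (sbdry F) (∅ : Finset (Finset V)) := by
  rw [IsCycle, mem_relCycles, coe_empty, Set.image_empty, Submodule.span_empty,
    Submodule.mem_bot, Finsupp.linearCombination_apply, Finsupp.sum]
  exact and_iff_right hc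

lemma isSimpleCycle_iff_isElementary {d : ℕ} {c : Finset V →₀ F}
    (hc : ∀ σ ∈ c.support, σ.card = d + 1) :
    IsSimpleCycle F d c ↔ IsElementary (relCycles (sbdry F) (∅ : Finset (Finset V))) c := by
  rw [IsSimpleCycle, IsElementary, isCycle_iff_mem_relCycles hc]
  refine and_congr_right fun _ => and_congr_right fun _ => forall_congr' fun w => ?_
  constructor
  · intro h hw hw0 hws
    exact h ((isCycle_iff_mem_relCycles fun σ hσ => hc σ (hws hσ)).2 hw) hw0 hws
  · intro h hw hw0 hws
    exact h ((isCycle_iff_mem_relCycles hw.1).1 hw) hw0 hws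

/-- If simple cycles have at most `m` simplices, then `γ_d(K) ≤ d (m + 1)²`. -/
lemma gammaD_le {d m : ℕ} (hd : 1 ≤ d) {K : Finset (Finset V)} (hK : ∀ σ ∈ K, σ.card = d + 1)
    (hne : K.Nonempty)
    (hm : ∀ c : Finset V →₀ F, IsSimpleCycle F d c → c.support ⊆ K → c.support.card ≤ m) :
    gammaD F K ≤ d * (m + 1) ^ 2 := by
  refine csSup_le ⟨_, K, Subset.rfl, hne, rfl⟩ ?_
  rintro _ ⟨A, hA, hAne, rfl⟩
  have hfaces : ∀ σ ∈ A, ¬ (sbdry F σ).support ⊆ ∅ := by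
    intro σ hσ hsub
    have := card_support_sbdry (F := F) σ
    rw [subset_empty.1 hsub, hK σ (hA hσ), card_empty] at this
    omega
  have hsize : ∀ u, IsElementary (relCycles (F := F) (sbdry F) (∅ : Finset (Finset V))) u →
      u.support ⊆ A → u.support.card ≤ m := fun u hu hus =>
    hm u ((isSimpleCycle_iff_isElementary fun σ hσ => hK σ (hA (hus hσ))).2 hu) (hus.trans hA)
  have h := card_le_mul_relative_rank (F := F) (b := sbdry F) (m := m) hd
    (fun σ hσ => (card_support_sbdry σ).trans (hK σ hσ))
    (fun σ hσ τ hτ => card_support_sbdry_inter_le ((hK σ hσ).trans (hK τ hτ).symm))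
    m ∅ A ∅ hA hAne (by simp) hfaces hsize (by simp)
  have hbot : Submodule.span F (sbdry F '' ((∅ : Finset (Finset V)) : Set (Finset V))) = ⊥ := by
    simp
  rw [hbot, finrank_bot, mul_zero, add_zero, empty_union] at h
  change A.card ≤ d * (m + 1) ^ 2 * rankBd F A at h
  rw [Nat.ceil_le]
  rcases Nat.eq_zero_or_pos (rankBd F A) with h0 | h0
  · rw [h0, Nat.cast_zero, div_zero]
    positivity
  · rw [div_le_iff₀ (by exact_mod_cast h0)]
    exact_mod_cast h

end Simplices

/-- Let `d ≥ 1` and let `K` be a finite simplicial `d`-complex (given by its finite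
set of `d`-simplices) whose `d`-simplices support a nontrivial `d`-cycle over a field
`F`.  Then `c_d(K) ≥ sqrt(γ_d(K)/d) - 1`: `K` has a simple `d`-cycle of size at least
`sqrt(γ_d(K)/d) - 1`. -/
theorem cMax_ge_sqrt_gamma (F : Type) [Field F] {V : Type} [LinearOrder V]
    (d : ℕ) (hd : 1 ≤ d) (K : Finset (Finset V)) (hK : ∀ σ ∈ K, σ.card = d + 1)
    (hcyc : ∃ c : (Finset V) →₀ F, IsCycle F d c ∧ c ≠ 0 ∧ c.support ⊆ K) :
    ∃ c : (Finset V) →₀ F, IsSimpleCycle F d c ∧ c.support ⊆ K ∧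
      Real.sqrt ((gammaD F K : ℝ) / (d : ℝ)) - 1 ≤ (c.support.card : ℝ) := by
  obtain ⟨c₀, hc₀, hc₀ne, hc₀K⟩ := hcyc
  have hcard : ∀ c : Finset V →₀ F, c.support ⊆ K → ∀ σ ∈ c.support, σ.card = d + 1 :=
    fun c hc σ hσ => hK σ (hc hσ)
  classical
  have hne : (K.powerset.filter fun s =>
      ∃ c : Finset V →₀ F, IsSimpleCycle F d c ∧ c.support = s).Nonempty := by
    obtain ⟨u, hu, -, hus⟩ := exists_isElementary_notMem
      ((isCycle_iff_mem_relCycles (hcard c₀ hc₀K)).1 hc₀)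
      (P := ⊥) (by simpa using hc₀ne)
    have huK := hus.trans hc₀K
    exact ⟨u.support, mem_filter.2 ⟨mem_powerset.2 huK, u,
      (isSimpleCycle_iff_isElementary (hcard u huK)).2 hu, rfl⟩⟩
  obtain ⟨s, hs, hsmax⟩ := exists_max_image _ card hne
  obtain ⟨hsK, c, hc, rfl⟩ := mem_filter.1 hs
  refine ⟨c, hc, mem_powerset.1 hsK, ?_⟩
  have hγ := gammaD_le hd hK ((Finsupp.support_nonempty_iff.2 hc₀ne).mono hc₀K)
    (fun w hw hwK => hsmax _ (mem_filter.2 ⟨mem_powerset.2 hwK, w, hw, rfl⟩))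
  have hγ' : (gammaD F K : ℝ) ≤ d * ((c.support.card : ℝ) + 1) ^ 2 := by exact_mod_cast hγ
  have hd' : (0 : ℝ) < d := by exact_mod_cast hd
  rw [sub_le_iff_le_add]
  refine Real.sqrt_le_iff.2 ⟨by positivity, ?_⟩
  rw [div_le_iff₀ hd']
  linarith
end

section
/- Let q be a prime power and let M be a finite simple matroid representable over F_q that contains at least one circuit. Then c(M) > (1/3) * log_q(log_q(gamma(M))), where c(M) is the size of the largest circuit of M and gamma(M) = max over nonempty subsets A of the ground set of ceil(|A| / rank(A)). -/
open Set Matroid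

variable {α : Type*}

/-- A matroid is simple if it has no loops (one-element circuits) and no parallel
pairs (two-element circuits); equivalently every circuit has at least 3 elements. -/
def Matroid.Simple' (M : Matroid α) : Prop :=
  ∀ C, M.IsCircuit' C → 3 ≤ C.ncard

/-- `M` is representable over the field `F` if (being finite) it is isomorphic to the
linear matroid of a family of vectors in some `F^n`. -/
def Matroid.RepresentableOver (M : Matroid α) (F : Type) [Field F] : Prop :=
  ∃ (n : ℕ) (v : α → (Fin n → F)), ∀ I ⊆ M.E,
    (M.Indep I ↔ LinearIndependent F (fun x : I => v x))

/-- Over a finite field, only boundedly many vectors are supported in a given finite set of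
coordinates. -/
lemma card_le_of_support_subset {ι F : Type*} [Field F] [Fintype F] {A : Finset α}
    {r : α → ι →₀ F} (hinj : Set.InjOn r A) (U : Finset ι)
    (hU : ∀ x ∈ A, (r x).support ⊆ U) : A.card ≤ Fintype.card F ^ U.card := by
  classical
  have h : Function.Injective (fun (x : A) (i : U) => r x i) := by
    intro x y hxy
    apply Subtype.ext
    apply hinj x.2 y.2
    ext i
    by_cases hi : i ∈ U
    · exact congrFun hxy ⟨i, hi⟩
    · rw [Finsupp.notMem_support_iff.1 fun h => hi (hU x x.2 h),
        Finsupp.notMem_support_iff.1 fun h => hi (hU y y.2 h)]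
  simpa using Fintype.card_le_of_injective _ h

/-- If each coordinate is used by many of the vectors `r x`, `x ∈ A`, and all these vectors have
small support, then every vector using a certain coordinate `b` is, on a set `T` of `k`
coordinates, a combination with nonzero coefficients of `k` members of the family that are
linearly independent on `T`. -/
lemma exists_long_expansion {ι F : Type*} [Field F] [Fintype F] [Nonempty ι] {A : Finset α}
    {r : α → ι →₀ F} {e : ι → α} (heA : ∀ i, e i ∈ A)
    (he : ∀ i, r (e i) = Finsupp.single i 1) (hinj : Set.InjOn r A) {c : ℕ} (hc : 1 ≤ c)
    (hsupp : ∀ x ∈ A, (r x).support.card ≤ c)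
    (hdeg : ∀ i, ∃ D ⊆ A, (∀ x ∈ D, r x i ≠ 0) ∧ Fintype.card F ^ (c * c) < D.card)
    (k : ℕ) (hk : k ≤ c) :
    ∃ (U T : Finset ι) (b : ι), U.card ≤ (k + 1) * c ∧ T ⊆ U ∧ b ∈ U ∧
      ∀ w : ι →₀ F, w b ≠ 0 → ∃ (I : Finset α) (l : α → F), I ⊆ A ∧ I.card = k + 1 ∧
        (∀ y ∈ I, (r y).support ⊆ U) ∧ (∀ y ∈ I, l y ≠ 0) ∧
        (∀ i ∈ T, w i = ∑ y ∈ I, l y * r y i) ∧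
        ∀ m : α → F, (∀ i ∈ T, ∑ y ∈ I, m y * r y i = 0) → ∀ y ∈ I, m y = 0 := by
  classical
  induction k with
  | zero =>
    obtain ⟨b⟩ := ‹Nonempty ι›
    refine ⟨{b}, {b}, b, by simpa using hc, subset_rfl, by simp, fun w hw => ?_⟩
    refine ⟨{e b}, fun _ => w b, by simpa using heA b, by simp, ?_, by simpa using hw, ?_, ?_⟩
    · simp [he]
    · simp [he]
    · simp [he]
  | succ k ih =>
    obtain ⟨U, T, b, hUc, hTU, hbU, hmain⟩ := ih (by omega)
    obtain ⟨x, hxA, hxb, b', hb'x, hb'U⟩ :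
        ∃ x ∈ A, r x b ≠ 0 ∧ ∃ b', r x b' ≠ 0 ∧ b' ∉ U := by
      by_contra! hcon
      obtain ⟨D, hDA, hD, hcard⟩ := hdeg b
      have h1 := card_le_of_support_subset (hinj.mono (by exact_mod_cast hDA)) U
        (fun x hx i hi => hcon x (hDA hx) (hD x hx) i (Finsupp.mem_support_iff.1 hi))
      have h2 : Fintype.card F ^ U.card ≤ Fintype.card F ^ (c * c) :=
        Nat.pow_le_pow_right Fintype.card_pos (hUc.trans (Nat.mul_le_mul_right c hk))
      omega
    have hbb' : b ≠ b' := fun h => hb'U (h ▸ hbU)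
    refine ⟨U ∪ (r x).support, insert b' T, b', ?_, ?_, ?_, fun w hw => ?_⟩
    · have h1 := Finset.card_union_le U (r x).support
      have h2 := hsupp x hxA
      nlinarith
    · refine Finset.insert_subset ?_ (hTU.trans Finset.subset_union_left)
      exact Finset.mem_union_right _ (Finsupp.mem_support_iff.2 hb'x)
    · exact Finset.mem_union_right _ (Finsupp.mem_support_iff.2 hb'x)
    obtain ⟨u, t, huA, hu, hub', ht, hwb', hwb⟩ : ∃ (u : α) (t : F), u ∈ A ∧
        (r u).support ⊆ U ∪ (r x).support ∧ r u b' ≠ 0 ∧ t ≠ 0 ∧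
        (w - t • r u) b' = 0 ∧ (w - t • r u) b ≠ 0 := by
      by_cases hwb : w b = 0
      · refine ⟨x, w b' / r x b', hxA, Finset.subset_union_right, hb'x, div_ne_zero hw hb'x,
          ?_, ?_⟩
        · simp [hb'x]
        · simp [hwb, hw, hb'x, hxb]
      · refine ⟨e b', w b', heA b', ?_, by simp [he], hw, by simp [he], ?_⟩
        · rw [he]
          refine Finsupp.support_single_subset.trans ?_
          simpa using Or.inr hb'x
        · simpa [he, Finsupp.single_apply, hbb'.symm] using hwb
    obtain ⟨I, l, hIA, hIc, hIU, hl, hwI, hind⟩ := hmain _ hwb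
    have hzero : ∀ y ∈ I, r y b' = 0 := fun y hy =>
      Finsupp.notMem_support_iff.1 fun h => hb'U (hIU y hy h)
    have huI : u ∉ I := fun h => hub' (hzero u h)
    have hne : ∀ y ∈ I, y ≠ u := fun y hy h => huI (h ▸ hy)
    refine ⟨insert u I, Function.update l u t, Finset.insert_subset huA hIA, ?_, ?_, ?_, ?_, ?_⟩
    · rw [Finset.card_insert_of_notMem huI, hIc]
    · intro y hy
      rcases Finset.mem_insert.1 hy with rfl | hy
      · exact hu
      · exact (hIU y hy).trans Finset.subset_union_left
    · intro y hy
      rcases Finset.mem_insert.1 hy with rfl | hy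
      · simpa using ht
      · simpa [Function.update_of_ne (hne y hy)] using hl y hy
    · intro i hi
      have hsum : ∑ y ∈ I, Function.update l u t y * r y i = ∑ y ∈ I, l y * r y i :=
        Finset.sum_congr rfl fun y hy => by rw [Function.update_of_ne (hne y hy)]
      rw [Finset.sum_insert huI, Function.update_self, hsum]
      rcases Finset.mem_insert.1 hi with rfl | hi
      · rw [Finset.sum_eq_zero fun y hy => by rw [hzero y hy, mul_zero], add_zero]
        simpa [sub_eq_zero] using hwb'
      · rw [← hwI i hi]
        simp
    · intro m hm
      have hmu : m u = 0 := by
        have h := hm b' (Finset.mem_insert_self _ _)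
        rw [Finset.sum_insert huI,
          Finset.sum_eq_zero fun y hy => by rw [hzero y hy, mul_zero], add_zero] at h
        exact (mul_eq_zero.1 h).resolve_right hub'
      have hmI := hind m fun i hi => by
        have h := hm i (Finset.mem_insert_of_mem hi)
        rwa [Finset.sum_insert huI, hmu, zero_mul, zero_add] at h
      intro y hy
      rcases Finset.mem_insert.1 hy with rfl | hy
      · exact hmu
      · exact hmI y hy

/-- If the family `r` contains the coordinate vectors and no member of it is a combination with
nonzero coefficients of more than `c` linearly independent members, then some coordinate is used
by a bounded number of members. -/
lemma exists_small_degree {ι F : Type*} [Field F] [Fintype F] [Nonempty ι] {A : Finset α}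
    {r : α → ι →₀ F} {e : ι → α} (heA : ∀ i, e i ∈ A)
    (he : ∀ i, r (e i) = Finsupp.single i 1) (hinj : Set.InjOn r A) {c : ℕ} (hc : 1 ≤ c)
    (H : ∀ I ⊆ A, LinearIndepOn F r (I : Set α) → ∀ x ∈ A, ∀ l : α → F, (∀ y ∈ I, l y ≠ 0) →
      r x = ∑ y ∈ I, l y • r y → I.card ≤ c) :
    ∃ i, ∀ D ⊆ A, (∀ x ∈ D, r x i ≠ 0) → D.card ≤ Fintype.card F ^ (c * c) := by
  classical
  have he_inj : Function.Injective e := fun i j hij => by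
    have h := he i
    rw [hij, he j] at h
    exact (Finsupp.single_left_injective one_ne_zero h).symm
  have hsum : ∀ (S : Finset ι) (l : ι → F) (i : ι),
      ∑ j ∈ S, l j * r (e j) i = if i ∈ S then l i else 0 := fun S l i => by
    simp [he, Finsupp.single_apply]
  set g : α → ι := Function.invFun e with hg
  have hge : ∀ i, g (e i) = i := Function.leftInverse_invFun he_inj
  by_contra! hdeg
  -- Each vector is supported on a small set, by expanding it in the coordinate vectors.
  have hsupp : ∀ x ∈ A, (r x).support.card ≤ c := by
    intro x hx
    have h := H ((r x).support.image e) (by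
        intro y hy
        obtain ⟨i, -, rfl⟩ := Finset.mem_image.1 hy
        exact heA i) ?_ x hx (fun y => r x (g y)) ?_ ?_
    · rwa [Finset.card_image_of_injective _ he_inj] at h
    · rw [linearIndepOn_finset_iff]
      intro m hm y hy
      obtain ⟨i, hi, rfl⟩ := Finset.mem_image.1 hy
      have h := DFunLike.congr_fun hm i
      rw [Finset.sum_image he_inj.injOn] at h
      simp only [Finsupp.finsetSum_apply, Finsupp.smul_apply, smul_eq_mul] at h
      rw [hsum _ (fun j => m (e j)), if_pos hi] at h
      simpa using h
    · intro y hy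
      obtain ⟨i, hi, rfl⟩ := Finset.mem_image.1 hy
      simpa [hge] using hi
    · ext i
      rw [Finset.sum_image he_inj.injOn]
      simp only [Finsupp.finsetSum_apply, Finsupp.smul_apply, smul_eq_mul, hge]
      rw [hsum _ (fun j => r x j)]
      simp +contextual [eq_comm]
  obtain ⟨U, T, b, -, hTU, -, hmain⟩ :=
    exists_long_expansion heA he hinj hc hsupp hdeg c le_rfl
  obtain ⟨D, hDA, hD, hcard⟩ := hdeg b
  obtain ⟨x, hxD⟩ : D.Nonempty := Finset.card_pos.1 (by omega)
  obtain ⟨I, l, hIA, hIc, hIU, hl, hwI, hind⟩ := hmain (r x) (hD x hxD)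
  -- The remaining part of `r x` is expanded in the coordinate vectors outside `T`.
  set z : ι →₀ F := r x - ∑ y ∈ I, l y • r y with hz
  have hzT : ∀ i ∈ z.support, i ∉ T := fun i hi hiT => by
    rw [Finsupp.mem_support_iff] at hi
    apply hi
    simp [hz, hwI i hiT]
  have heT : ∀ i ∈ z.support, ∀ j ∈ T, r (e i) j = 0 := fun i hi j hj => by
    rw [he, Finsupp.single_apply, if_neg]
    rintro rfl
    exact hzT i hi hj
  have hdisj : Disjoint I (z.support.image e) := by
    rw [Finset.disjoint_left]
    intro y hyI hy
    obtain ⟨i, hi, rfl⟩ := Finset.mem_image.1 hy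
    have := hind (fun y => if y = e i then 1 else 0)
      (fun j hj => by simp [hyI, heT i hi j hj]) _ hyI
    simp at this
  have hfinal := H (I ∪ z.support.image e) ?_ ?_ x (hDA hxD)
    (fun y => if y ∈ I then l y else z (g y)) ?_ ?_
  · have := Finset.card_le_card (Finset.subset_union_left (s₁ := I) (s₂ := z.support.image e))
    omega
  · refine Finset.union_subset hIA fun y hy => ?_
    obtain ⟨i, -, rfl⟩ := Finset.mem_image.1 hy
    exact heA i
  · rw [linearIndepOn_finset_iff]
    intro m hm
    have hcoord : ∀ i, ∑ y ∈ I, m y * r y i + (if i ∈ z.support then m (e i) else 0) = 0 := by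
      intro i
      have h := DFunLike.congr_fun hm i
      rw [Finset.sum_union hdisj, Finset.sum_image he_inj.injOn] at h
      simp only [Finsupp.finsetSum_apply, Finsupp.add_apply, Finsupp.smul_apply,
        smul_eq_mul] at h
      rwa [hsum _ (fun j => m (e j))] at h
    have hmI := hind m fun i hi => by
      have h := hcoord i
      rwa [if_neg fun h => hzT i h hi, add_zero] at h
    intro y hy
    rcases Finset.mem_union.1 hy with hy | hy
    · exact hmI y hy
    · obtain ⟨i, hi, rfl⟩ := Finset.mem_image.1 hy
      have h := hcoord i
      rwa [if_pos hi, Finset.sum_eq_zero fun y hy => by rw [hmI y hy, zero_mul], zero_add] at h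
  · intro y hy
    by_cases hyI : y ∈ I
    · simpa [hyI] using hl y hyI
    · obtain ⟨i, hi, rfl⟩ := Finset.mem_image.1 ((Finset.mem_union.1 hy).resolve_left hyI)
      simpa [hyI, hge] using hi
  · rw [Finset.sum_union hdisj, Finset.sum_congr rfl fun y hy => by rw [if_pos hy],
      Finset.sum_congr (s₁ := z.support.image e) rfl fun y hy => by
        rw [if_neg (Finset.disjoint_right.1 hdisj hy)], Finset.sum_image he_inj.injOn,
      ← sub_eq_iff_eq_add', ← hz]
    ext i
    simp only [Finsupp.finsetSum_apply, Finsupp.smul_apply, smul_eq_mul, hge]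
    rw [hsum _ (fun j => z j)]
    simp +contextual [eq_comm]

/-- A family of distinct nonzero vectors over a finite field, none of which is a combination with
nonzero coefficients of more than `c` linearly independent members, has size linear in its rank. -/
lemma card_le_mul_card_basis {F V : Type*} [Field F] [Fintype F] [AddCommGroup V] [Module F V]
    {v : α → V} {c : ℕ} (hc : 1 ≤ c) (n : ℕ) (A B : Finset α)
    (hinj : Set.InjOn v A) (hne : ∀ x ∈ A, v x ≠ 0)
    (H : ∀ I ⊆ A, LinearIndepOn F v (I : Set α) → ∀ x ∈ A, ∀ l : α → F, (∀ y ∈ I, l y ≠ 0) →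
      v x = ∑ y ∈ I, l y • v y → I.card ≤ c)
    (hBA : B ⊆ A) (hB : LinearIndepOn F v (B : Set α))
    (hAB : ∀ x ∈ A, v x ∈ Submodule.span F (v '' B)) (hn : B.card = n) :
    A.card ≤ Fintype.card F ^ (c * c) * n := by
  classical
  induction n generalizing A B with
  | zero =>
    obtain rfl := Finset.card_eq_zero.1 hn
    rw [Finset.eq_empty_of_forall_notMem fun x hx => hne x hx (by simpa using hAB x hx)]
    simp
  | succ n ih =>
    have hBne : Nonempty B := (Finset.card_pos.1 (by omega : 0 < B.card)).to_subtype
    have hli : LinearIndependent F (fun b : B => v b) := hB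
    have hrange : Set.range (fun b : B => v b) = v '' B := by
      ext; simp
    have hrep : ∀ x, ∃ f : B →₀ F, x ∈ A → Finsupp.linearCombination F (fun b : B => v b) f = v x
        := by
      intro x
      by_cases hx : x ∈ A
      · have h := hAB x hx
        rw [← hrange, Finsupp.mem_span_range_iff_exists_finsupp] at h
        obtain ⟨f, hf⟩ := h
        exact ⟨f, fun _ => hf⟩
      · exact ⟨0, fun h => absurd h hx⟩
    choose r hr using hrep
    have hrinj : Set.InjOn r A := fun x hx y hy hxy => hinj hx hy (by
      rw [← hr x hx, ← hr y hy, hxy])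
    have hre : ∀ b : B, r b = Finsupp.single b 1 := fun b =>
      hli (by rw [hr b (hBA b.2)]; simp)
    obtain ⟨b, hb⟩ := exists_small_degree (e := fun b : B => (b : α)) (fun b => hBA b.2) hre
      hrinj hc (by
        intro I hI hIr x hx l hl hxl
        refine H I hI ?_ x hx l hl ?_
        · rw [linearIndepOn_finset_iff] at hIr ⊢
          intro m hm
          refine hIr m (hli ?_)
          rw [map_sum, map_zero, ← hm]
          exact Finset.sum_congr rfl fun y hy => by rw [map_smul, hr y (hI hy)]
        · rw [← hr x hx, hxl, map_sum]
          exact Finset.sum_congr rfl fun y hy => by rw [map_smul, hr y (hI hy)])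
    have hD := hb (A.filter fun x => r x b ≠ 0) (Finset.filter_subset _ _) (by simp)
    have hsub : A.filter (fun x => r x b = 0) ⊆ A := Finset.filter_subset _ _
    have hrest := ih (A.filter fun x => r x b = 0) (B.erase b) (hinj.mono (by exact_mod_cast hsub))
      (fun x hx => hne x (hsub hx)) (fun I hI hIr x hx => H I (hI.trans hsub) hIr x (hsub hx))
      ?_ (hB.mono (by simp)) ?_ (by rw [Finset.card_erase_of_mem b.2, hn]; rfl)
    · have hsplit := Finset.card_filter_add_card_filter_not (s := A) (fun x => r x b = 0)
      rw [mul_add, mul_one]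
      simp only [ne_eq] at hD
      omega
    · intro y hy
      rw [Finset.mem_erase] at hy
      refine Finset.mem_filter.2 ⟨hBA hy.2, ?_⟩
      rw [hre ⟨y, hy.2⟩, Finsupp.single_apply, if_neg]
      exact fun h => hy.1 (congrArg Subtype.val h)
    · intro x hx
      obtain ⟨hxA, hxb⟩ := Finset.mem_filter.1 hx
      rw [← hr x hxA, Finsupp.linearCombination_apply]
      refine Submodule.sum_mem _ fun a ha => Submodule.smul_mem _ _ (Submodule.subset_span ?_)
      refine ⟨a, ?_, rfl⟩
      have hab : (a : α) ≠ b := fun h => by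
        rw [Subtype.ext h, Finsupp.mem_support_iff] at ha
        exact ha hxb
      simp [hab]

/-- A vector that is a combination with nonzero coefficients of linearly independent vectors
forms a circuit together with them. -/
lemma isCircuit'_insert {F V : Type*} [Field F] [AddCommGroup V] [Module F V] {M : Matroid α}
    {v : α → V} (hv : ∀ I ⊆ M.E, (M.Indep I ↔ LinearIndepOn F v I)) {I : Finset α}
    (hIE : (I : Set α) ⊆ M.E) (hI : LinearIndepOn F v (I : Set α)) {x : α} (hxE : x ∈ M.E)
    (hxI : x ∉ I) {l : α → F} (hl : ∀ y ∈ I, l y ≠ 0) (hx : v x = ∑ y ∈ I, l y • v y) :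
    M.IsCircuit' (insert x (I : Set α)) := by
  classical
  have hE : insert x (I : Set α) ⊆ M.E := Set.insert_subset hxE hIE
  refine ⟨hE, ?_, fun D hD => ?_⟩
  · rw [hv _ hE, linearIndepOn_insert (by simpa using hxI)]
    rintro ⟨-, h⟩
    apply h
    rw [hx]
    exact Submodule.sum_mem _ fun y hy =>
      Submodule.smul_mem _ _ (Submodule.subset_span ⟨y, hy, rfl⟩)
  · rw [hv _ (hD.subset.trans hE)]
    obtain ⟨y, hy, hyD⟩ := Set.exists_of_ssubset hD
    rcases hy with rfl | hy
    · exact hI.mono fun z hz => (hD.subset hz).resolve_left fun h => hyD (h ▸ hz)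
    · have hyI : y ∈ I := hy
      have hsub : D ⊆ (insert x (I.erase y) : Finset α) := fun z hz => by
        have hzy : z ≠ y := fun h => hyD (h ▸ hz)
        simpa [hzy] using hD.subset hz
      refine LinearIndepOn.mono ?_ hsub
      have hxe : x ∉ I.erase y := fun h => hxI (Finset.mem_of_mem_erase h)
      rw [linearIndepOn_finset_iff] at hI ⊢
      intro m hm
      rw [Finset.sum_insert hxe] at hm
      have hcomb : ∑ z ∈ I, (m x * l z + if z = y then 0 else m z) • v z = 0 := by
        rw [← hm, hx, Finset.smul_sum, ← Finset.add_sum_erase I (fun z => m x • l z • v z) hyI,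
          ← Finset.add_sum_erase I _ hyI, add_assoc, ← Finset.sum_add_distrib]
        congr 1
        · simp [mul_smul]
        · refine Finset.sum_congr rfl fun z hz => ?_
          rw [if_neg (Finset.ne_of_mem_erase hz), add_smul, mul_smul]
      have hzero := hI _ hcomb
      have hmx : m x = 0 := by simpa [hl y hyI] using hzero y hyI
      intro z hz
      rcases Finset.mem_insert.1 hz with rfl | hz
      · exact hmx
      · simpa [hmx, Finset.ne_of_mem_erase hz] using hzero z (Finset.mem_of_mem_erase hz)

lemma ncard_le_cMax {M : Matroid α} [M.Finite] {C : Set α} (hC : M.IsCircuit' C) :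
    C.ncard ≤ M.cMax := by
  refine le_csSup ⟨M.E.ncard, ?_⟩ ⟨C, hC, rfl⟩
  rintro _ ⟨D, hD, rfl⟩
  exact Set.ncard_le_ncard hD.1 M.ground_finite

lemma ncard_le_rk' {M : Matroid α} [M.Finite] {A I : Set α} (hIA : I ⊆ A) (hI : M.Indep I) :
    I.ncard ≤ M.rk' A := by
  refine le_csSup ⟨M.E.ncard, ?_⟩ ⟨I, hIA, hI, rfl⟩
  rintro _ ⟨J, -, hJ, rfl⟩
  exact Set.ncard_le_ncard hJ.subset_ground M.ground_finite

/-- In a simple matroid, every set of at most two elements is independent. -/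
lemma Matroid.Simple'.indep_of_ncard_le {M : Matroid α} [M.Finite] (hM : M.Simple') {D : Set α}
    (hDE : D ⊆ M.E) (hD : D.ncard ≤ 2) : M.Indep D := by
  by_contra h
  obtain ⟨C, hCD, hC⟩ := ((Matroid.not_indep_iff hDE).1 h).exists_isCircuit_subset
  have h3 := hM C ⟨hC.subset_ground, hC.not_indep, fun _ hss => hC.ssubset_indep hss⟩
  have := Set.ncard_le_ncard hCD (M.ground_finite.subset hDE)
  omega

lemma ncard_le_mul_rk' {F : Type} [Field F] [Fintype F] {M : Matroid α} [M.Finite]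
    (hSimple : M.Simple') (hrep : M.RepresentableOver F) (hc : 1 ≤ M.cMax) {A : Set α}
    (hA : A ⊆ M.E) : A.ncard ≤ Fintype.card F ^ (M.cMax * M.cMax) * M.rk' A := by
  classical
  obtain ⟨n, v, hv⟩ := hrep
  have hv' : ∀ I ⊆ M.E, (M.Indep I ↔ LinearIndepOn F v I) := hv
  have hAfin := M.ground_finite.subset hA
  obtain ⟨A, rfl⟩ := hAfin.exists_finset_coe
  obtain ⟨B, hB⟩ := M.exists_isBasis (A : Set α)
  obtain ⟨B, rfl⟩ := (hAfin.subset hB.subset).exists_finset_coe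
  have hBli := (hv' _ (hB.subset.trans hA)).1 hB.indep
  have hspan : ∀ x ∈ A, v x ∈ Submodule.span F (v '' B) := by
    intro x hx
    by_cases hxB : x ∈ B
    · exact Submodule.subset_span ⟨x, hxB, rfl⟩
    by_contra hcon
    have hins := hBli.insert hcon
    rw [← hv' _ (Set.insert_subset (hA hx) (hB.subset.trans hA))] at hins
    exact hxB (hB.mem_of_insert_indep hx hins)
  have hcard := card_le_mul_card_basis hc B.card A B ?_ ?_ ?_ (by exact_mod_cast hB.subset)
    hBli hspan rfl
  · have := ncard_le_rk' hB.subset hB.indep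
    rw [Set.ncard_coe_finset] at this ⊢
    exact hcard.trans (Nat.mul_le_mul_left _ this)
  · intro x hx y hy hxy
    by_contra hne
    have hsub : ({x, y} : Set α) ⊆ M.E := Set.insert_subset (hA hx) (by simpa using hA hy)
    have h := (hv' _ hsub).1 (hSimple.indep_of_ncard_le hsub (Set.ncard_pair hne).le)
    exact hne (h.injOn (by simp) (by simp) hxy)
  · intro x hx
    have hsub : ({x} : Set α) ⊆ M.E := by simpa using hA hx
    exact ((hv' _ hsub).1 (hSimple.indep_of_ncard_le hsub (by simp))).ne_zero (by simp)
  · intro I hI hIli x hx l hl hxl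
    by_cases hxI : x ∈ I
    · refine le_trans (Finset.card_le_one.2 ?_) hc
      suffices h : ∀ y ∈ I, y = x from fun y hy z hz => (h y hy).trans (h z hz).symm
      intro y hy
      by_contra hyx
      rw [linearIndepOn_finset_iff] at hIli
      have := hIli (fun z => l z - if z = x then 1 else 0)
        (by simp [sub_smul, Finset.sum_sub_distrib, ite_smul, hxI, ← hxl]) y hy
      simp [hyx, hl y hy] at this
    · have hIE : (I : Set α) ⊆ M.E := fun y hy => hA (hI hy)
      have h := ncard_le_cMax (isCircuit'_insert hv' hIE hIli (hA hx) hxI hl hxl)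
      rw [← Finset.coe_insert, Set.ncard_coe_finset, Finset.card_insert_of_notMem hxI] at h
      omega

lemma gamma_le {F : Type} [Field F] [Fintype F] {M : Matroid α} [M.Finite]
    (hSimple : M.Simple') (hrep : M.RepresentableOver F) (hc : 1 ≤ M.cMax) :
    M.gamma ≤ Fintype.card F ^ (M.cMax * M.cMax) := by
  refine csSup_le' ?_
  rintro _ ⟨A, hA, -, rfl⟩
  refine Nat.ceil_le.2 (div_le_of_le_mul₀ (by positivity) (by positivity) ?_)
  exact_mod_cast ncard_le_mul_rk' hSimple hrep hc hA

/-- If `M` is a finite simple matroid representable over the field `F_q` with `q`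
elements and containing at least one circuit, then
`c(M) > (1/3) · log_q(log_q(γ(M)))`. -/
theorem cMax_gt_loglog_gamma (q : ℕ) (F : Type) [Field F] [Fintype F]
    (hq : Fintype.card F = q) (M : Matroid α) [M.Finite]
    (hSimple : M.Simple') (hrep : M.RepresentableOver F)
    (hex : ∃ C, M.IsCircuit' C) :
    (1 / 3 : ℝ) * Real.logb q (Real.logb q (M.gamma)) < (M.cMax : ℝ) := by
  obtain ⟨C, hC⟩ := hex
  have hc : 1 ≤ M.cMax := by
    have := hSimple C hC
    have := ncard_le_cMax hC
    omega
  have hgamma := gamma_le hSimple hrep hc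
  rw [hq] at hgamma
  have hq2 : 2 ≤ q := hq ▸ Fintype.one_lt_card
  have hq1 : (1 : ℝ) < q := by exact_mod_cast hq2
  generalize M.cMax = c at *
  generalize M.gamma = γ at *
  have hcpos : (0 : ℝ) < c := by exact_mod_cast hc
  have hlog : Real.logb q γ ≤ (c * c : ℕ) := by
    rcases Nat.eq_zero_or_pos γ with rfl | hγ
    · simp; positivity
    · rw [Real.logb_le_iff_le_rpow hq1 (by exact_mod_cast hγ), Real.rpow_natCast]
      exact_mod_cast hgamma
  have hlog0 : 0 ≤ Real.logb q γ := by
    rcases Nat.eq_zero_or_pos γ with rfl | hγ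
    · simp
    · exact Real.logb_nonneg hq1 (by exact_mod_cast hγ)
  rcases hlog0.eq_or_lt with h0 | hpos
  · rw [← h0]
    simpa using hcpos
  have hcq : c * c ≤ q ^ (2 * c) := by
    have h : c ≤ q ^ c := (Nat.lt_pow_self hq2).le
    calc c * c ≤ q ^ c * q ^ c := Nat.mul_le_mul h h
      _ = q ^ (2 * c) := by ring
  have hle : Real.logb q (Real.logb q γ) ≤ (2 * c : ℕ) := by
    rw [Real.logb_le_iff_le_rpow hq1 hpos, Real.rpow_natCast]
    exact hlog.trans (by exact_mod_cast hcq)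
  push_cast at hle
  linarith
end
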